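/- arXiv:1405.3324 — 2 statements merged into one kernel-verified Lean document; each statement's English description precedes it below -/
import Mathlib

section
/- Let F be an algebraically closed field of characteristic p ≠ 2 (p an odd prime or 0), and let X ≤ A_n be a subgroup isomorphic to A_m acting transitively on Ω = {1,…,n}, where n > m ≥ 9. Then for every F A_n-module V with dim_F V > 1, the restriction of V to X is a reducible F X-module. -/
/-- A submodule is invariant under a representation. -/
def RepInvariant {F G V : Type*} [Field F] [Monoid G] [AddCommGroup V] [Module F V]
    (ρ : Representation F G V) (p : Submodule F V) : Prop :=
  ∀ g : G, ∀ v ∈ p, ρ g v ∈ p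

/-- A representation is irreducible if the space is nonzero and the only invariant
submodules are `⊥` and `⊤`. -/
def RepIrreducible {F G V : Type*} [Field F] [Monoid G] [AddCommGroup V] [Module F V]
    (ρ : Representation F G V) : Prop :=
  Nontrivial V ∧ ∀ p : Submodule F V, RepInvariant ρ p → p = ⊥ ∨ p = ⊤

set_option linter.unusedSectionVars false
set_option linter.unusedSimpArgs false

section

open Equiv

section TranspositionSums

variable {F W Ω : Type*} [Field F] [AddCommGroup W] [Module F W] [Fintype Ω] [DecidableEq Ω]
  (σ : Representation F (Perm Ω) W)

/-- The linear combination `∑ w(a,b) σ(a b)` of transposition operators. -/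
def transpSum (w : Ω → Ω → F) : Module.End F W := ∑ a, ∑ b, w a b • σ (swap a b)

/-- The operator `(a c) - (a d) - (b c) + (b d)`. -/
def quadOp (a b c d : Ω) : Module.End F W :=
  σ (swap a c) - σ (swap a d) - σ (swap b c) + σ (swap b d)

/-- The second difference of a pair function along `{a,b}` and `{c,d}`. -/
def secondDiff {R : Type*} [Ring R] (w : Ω → Ω → R) (a b c d : Ω) : R :=
  w a c - w a d - w b c + w b d

theorem conj_swap (g : Perm Ω) (a b : Ω) :
    σ g * σ (swap a b) * σ g⁻¹ = σ (swap (g a) (g b)) := by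
  rw [← map_mul, ← map_mul]
  congr 1
  rw [Equiv.swap_apply_apply]

theorem conj_transpSum (g : Perm Ω) (w : Ω → Ω → F) :
    σ g * transpSum σ w * σ g⁻¹ = transpSum σ (fun a b => w (g⁻¹ a) (g⁻¹ b)) := by
  unfold transpSum
  rw [← Equiv.sum_comp g (fun a => ∑ b, w (g⁻¹ a) (g⁻¹ b) • σ (swap a b))]
  rw [Finset.mul_sum, Finset.sum_mul]
  refine Finset.sum_congr rfl fun a _ => ?_
  rw [← Equiv.sum_comp g (fun b => w (g⁻¹ (g a)) (g⁻¹ b) • σ (swap (g a) b))]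
  rw [Finset.mul_sum, Finset.sum_mul]
  refine Finset.sum_congr rfl fun b _ => ?_
  rw [← conj_swap]
  simp

theorem conj_quadOp (g : Perm Ω) (a b c d : Ω) :
    σ g * quadOp σ a b c d * σ g⁻¹ = quadOp σ (g a) (g b) (g c) (g d) := by
  simp only [quadOp, ← conj_swap, mul_add, mul_sub, add_mul, sub_mul]

theorem conj_swap_transpSum (x y : Ω) (w : Ω → Ω → F) :
    σ (swap x y) * transpSum σ w * σ (swap x y) =
      transpSum σ (fun a b => w (swap x y a) (swap x y b)) := by
  have := conj_transpSum σ (swap x y) w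
  rwa [swap_inv] at this

theorem transpSum_sub (w w' : Ω → Ω → F) :
    transpSum σ w - transpSum σ w' = transpSum σ (fun a b => w a b - w' a b) := by
  simp only [transpSum, sub_smul, Finset.sum_sub_distrib]

theorem secondDiff_swap_eq {w : Ω → Ω → F} (hw : ∀ a b, w a b = w b a) {a b c d : Ω}
    (hab : a ≠ b) (hac : a ≠ c) (had : a ≠ d) (hbc : b ≠ c) (hbd : b ≠ d) (hcd : c ≠ d)
    (x y : Ω) :
    (w x y - w (swap a b x) (swap a b y)) -
      (w (swap c d x) (swap c d y) - w (swap a b (swap c d x)) (swap a b (swap c d y))) =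
    secondDiff w a b c d *
      (((if x = a then 1 else 0) - (if x = b then 1 else 0)) *
        ((if y = c then 1 else 0) - (if y = d then 1 else 0)) +
      ((if x = c then 1 else 0) - (if x = d then 1 else 0)) *
        ((if y = a then 1 else 0) - (if y = b then 1 else 0))) := by
  have key : ∀ z : Ω, z = a ∨ z = b ∨ z = c ∨ z = d ∨ (z ≠ a ∧ z ≠ b ∧ z ≠ c ∧ z ≠ d) := by
    intro z; tauto
  unfold secondDiff
  rcases key x with rfl | rfl | rfl | rfl | ⟨h1, h2, h3, h4⟩ <;>
  rcases key y with rfl | rfl | rfl | rfl | ⟨k1, k2, k3, k4⟩ <;>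
  simp [swap_apply_of_ne_of_ne, *, Ne.symm, hab.symm, hac.symm, had.symm, hbc.symm, hbd.symm,
    hcd.symm] <;> (rw [hw]; ring)

theorem transpSum_secondDiff {w : Ω → Ω → F} (hw : ∀ a b, w a b = w b a) {a b c d : Ω}
    (hab : a ≠ b) (hac : a ≠ c) (had : a ≠ d) (hbc : b ≠ c) (hbd : b ≠ d) (hcd : c ≠ d) :
    (transpSum σ w - σ (swap a b) * transpSum σ w * σ (swap a b)) -
      σ (swap c d) * (transpSum σ w - σ (swap a b) * transpSum σ w * σ (swap a b)) *
        σ (swap c d) = (2 * secondDiff w a b c d) • quadOp σ a b c d := by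
  rw [conj_swap_transpSum, transpSum_sub, conj_swap_transpSum, transpSum_sub]
  simp only [secondDiff_swap_eq hw hab hac had hbc hbd hcd, transpSum]
  simp only [sub_mul, mul_add, mul_sub, add_smul, sub_smul, ite_mul, mul_ite, zero_mul, mul_zero,
    mul_one, one_mul, ite_smul, zero_smul, Finset.sum_add_distrib, Finset.sum_sub_distrib,
    Finset.sum_ite_eq', Finset.mem_univ, if_true,
    quadOp, two_mul, swap_comm c a, swap_comm c b, swap_comm d a,
    swap_comm d b]
  module

theorem quadOp_eq_zero_of_transpSum_scalar (h2 : (2 : F) ≠ 0) {w : Ω → Ω → F}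
    (hw : ∀ a b, w a b = w b a) {a b c d : Ω}
    (hab : a ≠ b) (hac : a ≠ c) (had : a ≠ d) (hbc : b ≠ c) (hbd : b ≠ d) (hcd : c ≠ d)
    (hξ : secondDiff w a b c d ≠ 0) (k : F) (hu : transpSum σ w = k • 1) :
    quadOp σ a b c d = 0 := by
  have h := transpSum_secondDiff σ hw hab hac had hbc hbd hcd
  rw [hu] at h
  have hs : ∀ x y : Ω, σ (swap x y) * σ (swap x y) = 1 := fun x y => by
    rw [← map_mul, swap_mul_self, map_one]
  simp only [mul_smul_comm, smul_mul_assoc, mul_one, hs, sub_self, mul_zero, zero_mul] at h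
  exact (smul_eq_zero.1 h.symm).resolve_left (mul_ne_zero h2 hξ)

theorem commute_swap_quadOp {x y a b c d : Ω} (hxa : x ≠ a) (hxb : x ≠ b) (hxc : x ≠ c)
    (hxd : x ≠ d) (hya : y ≠ a) (hyb : y ≠ b) (hyc : y ≠ c) (hyd : y ≠ d) :
    Commute (σ (swap x y)) (quadOp σ a b c d) := by
  have h := conj_quadOp σ (swap x y) a b c d
  rw [swap_apply_of_ne_of_ne hxa.symm hya.symm, swap_apply_of_ne_of_ne hxb.symm hyb.symm,
    swap_apply_of_ne_of_ne hxc.symm hyc.symm, swap_apply_of_ne_of_ne hxd.symm hyd.symm] at h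
  calc σ (swap x y) * quadOp σ a b c d
      = σ (swap x y) * quadOp σ a b c d * (σ (swap x y)⁻¹ * σ (swap x y)) := by
        rw [← map_mul]; simp
    _ = quadOp σ a b c d * σ (swap x y) := by rw [← mul_assoc, h]

/-- Conjugating an anticommutation identity by an involution fixing `d` and subtracting. -/
theorem anticomm_step {R : Type*} [Ring R] {s u d e : R} (hs : s * s = 1)
    (hd : d - s * d * s = 0) (he : s * e * s = e) (h : u * d + d * u = e) :
    (u - s * u * s) * d + d * (u - s * u * s) = 0 := by
  have hd' : s * d * s = d := (sub_eq_zero.1 hd).symm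
  have h1 : (s * u * s) * d + d * (s * u * s) = e := by
    calc (s * u * s) * d + d * (s * u * s)
        = (s * u * s) * (s * d * s) + (s * d * s) * (s * u * s) := by rw [hd']
      _ = s * u * (s * s) * d * s + s * d * (s * s) * u * s := by noncomm_ring
      _ = s * (u * d + d * u) * s := by rw [hs]; noncomm_ring
      _ = e := by rw [h, he]
  calc (u - s * u * s) * d + d * (u - s * u * s)
      = (u * d + d * u) - ((s * u * s) * d + d * (s * u * s)) := by noncomm_ring
    _ = 0 := by rw [h, h1, sub_self]

theorem quadOp_mul_eq_zero (h2 : (2 : F) ≠ 0) {w : Ω → Ω → F}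
    (hw : ∀ a b, w a b = w b a) {f : Fin 8 → Ω} (hf : Function.Injective f)
    (h12 : secondDiff w (f 0) (f 1) (f 2) (f 3) ≠ 0)
    (h34 : secondDiff w (f 4) (f 5) (f 6) (f 7) ≠ 0)
    (h13 : secondDiff w (f 0) (f 1) (f 4) (f 5) = 0)
    (h14 : secondDiff w (f 0) (f 1) (f 6) (f 7) = 0)
    (k : F) (hu : transpSum σ w * transpSum σ w = k • 1) :
    quadOp σ (f 0) (f 1) (f 2) (f 3) * quadOp σ (f 4) (f 5) (f 6) (f 7) = 0 := by
  have ne : ∀ i j : Fin 8, i ≠ j → f i ≠ f j := fun i j h => hf.ne h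
  have hs : ∀ x y : Ω, σ (swap x y) * σ (swap x y) = 1 := fun x y => by
    rw [← map_mul, swap_mul_self, map_one]
  have hss : ∀ x y : Ω, ∀ T, σ (swap x y) * (σ (swap x y) * T) = T := fun x y T => by
    rw [← mul_assoc, hs, one_mul]
  have e12 := transpSum_secondDiff σ hw (ne 0 1 (by decide)) (ne 0 2 (by decide))
    (ne 0 3 (by decide)) (ne 1 2 (by decide)) (ne 1 3 (by decide)) (ne 2 3 (by decide))
  have e13 := transpSum_secondDiff σ hw (ne 0 1 (by decide)) (ne 0 4 (by decide))
    (ne 0 5 (by decide)) (ne 1 4 (by decide)) (ne 1 5 (by decide)) (ne 4 5 (by decide))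
  have e14 := transpSum_secondDiff σ hw (ne 0 1 (by decide)) (ne 0 6 (by decide))
    (ne 0 7 (by decide)) (ne 1 6 (by decide)) (ne 1 7 (by decide)) (ne 6 7 (by decide))
  have e34 := transpSum_secondDiff σ hw (ne 4 5 (by decide)) (ne 4 6 (by decide))
    (ne 4 7 (by decide)) (ne 5 6 (by decide)) (ne 5 7 (by decide)) (ne 6 7 (by decide))
  rw [h13, mul_zero, zero_smul] at e13
  rw [h14, mul_zero, zero_smul] at e14
  set u := transpSum σ w with hu_def
  set d := u - σ (swap (f 0) (f 1)) * u * σ (swap (f 0) (f 1)) with hd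
  have hud : u * d + d * u = d * d := by
    have h1 : (σ (swap (f 0) (f 1)) * u * σ (swap (f 0) (f 1))) *
        (σ (swap (f 0) (f 1)) * u * σ (swap (f 0) (f 1))) = k • 1 := by
      simp only [mul_assoc, hss]
      rw [← mul_assoc u u, hu]
      simp [hs]
    rw [← sub_eq_zero]
    calc u * d + d * u - d * d = u * u - (σ (swap (f 0) (f 1)) * u * σ (swap (f 0) (f 1))) *
        (σ (swap (f 0) (f 1)) * u * σ (swap (f 0) (f 1))) := by rw [hd]; noncomm_ring
      _ = 0 := by rw [hu, h1, sub_self]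
  have hdd : σ (swap (f 4) (f 5)) * (d * d) * σ (swap (f 4) (f 5)) = d * d := by
    have : σ (swap (f 4) (f 5)) * d * σ (swap (f 4) (f 5)) = d := (sub_eq_zero.1 e13).symm
    calc σ (swap (f 4) (f 5)) * (d * d) * σ (swap (f 4) (f 5))
        = σ (swap (f 4) (f 5)) * d * (σ (swap (f 4) (f 5)) * σ (swap (f 4) (f 5))) * d *
          σ (swap (f 4) (f 5)) := by rw [hs]; noncomm_ring
      _ = (σ (swap (f 4) (f 5)) * d * σ (swap (f 4) (f 5))) *
          (σ (swap (f 4) (f 5)) * d * σ (swap (f 4) (f 5))) := by noncomm_ring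
      _ = d * d := by rw [this]
  have h3 := anticomm_step (hs _ _) e13 hdd hud
  have h4 := anticomm_step (hs _ _) e14 (by simp) h3
  rw [e34] at h4
  have hc : ∀ i j : Fin 8, i ≠ 4 → i ≠ 5 → i ≠ 6 → i ≠ 7 → j ≠ 4 → j ≠ 5 → j ≠ 6 → j ≠ 7 →
      Commute (σ (swap (f i) (f j))) (quadOp σ (f 4) (f 5) (f 6) (f 7)) :=
    fun i j h1 h2 h3 h4 h5 h6 h7 h8 => commute_swap_quadOp σ (ne _ _ h1) (ne _ _ h2) (ne _ _ h3)
      (ne _ _ h4) (ne _ _ h5) (ne _ _ h6) (ne _ _ h7) (ne _ _ h8)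
  set y := quadOp σ (f 4) (f 5) (f 6) (f 7) with hy
  set z := quadOp σ (f 0) (f 1) (f 2) (f 3) with hz
  have hzy : Commute z y := by
    rw [hz, quadOp]
    refine (((hc _ _ ?_ ?_ ?_ ?_ ?_ ?_ ?_ ?_).sub_left (hc _ _ ?_ ?_ ?_ ?_ ?_ ?_ ?_ ?_)).sub_left
      (hc _ _ ?_ ?_ ?_ ?_ ?_ ?_ ?_ ?_)).add_left (hc _ _ ?_ ?_ ?_ ?_ ?_ ?_ ?_ ?_) <;> decide
  have hyd : y * d + d * y = 0 := by
    have : (2 * secondDiff w (f 4) (f 5) (f 6) (f 7)) • (y * d + d * y) = 0 := by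
      rw [smul_add, ← smul_mul_assoc, ← mul_smul_comm, h4]
    exact (smul_eq_zero.1 this).resolve_left (mul_ne_zero h2 h34)
  have hs2y : Commute (σ (swap (f 2) (f 3))) y := by
    refine hc _ _ ?_ ?_ ?_ ?_ ?_ ?_ ?_ ?_ <;> decide
  have h5 : d * y + y * d = 0 := by rw [add_comm]; exact hyd
  have h6 := anticomm_step (hs (f 2) (f 3)) (u := d) (d := y) (e := 0)
    (by rw [hs2y.eq, mul_assoc, hs, mul_one, sub_self]) (by simp) h5
  rw [e12, smul_mul_assoc, mul_smul_comm, ← hzy.eq, ← smul_add, ← two_smul F (z * y), smul_smul]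
    at h6
  exact (smul_eq_zero.1 h6).resolve_left (mul_ne_zero (mul_ne_zero h2 h12) h2)

/-- If `Y` commutes with the four transpositions and `quadOp a b c d` kills `Y`, then
`(a b)(c d)` fixes `Y`. -/
theorem double_swap_mul_eq (h2 : (2 : F) ≠ 0) {a b c d : Ω}
    (hab : a ≠ b) (hac : a ≠ c) (had : a ≠ d) (hbc : b ≠ c) (hbd : b ≠ d) (hcd : c ≠ d)
    {Y : Module.End F W} (h1 : Commute (σ (swap a c)) Y) (h3 : Commute (σ (swap b d)) Y)
    (h4 : Commute (σ (swap a d)) Y) (h5 : Commute (σ (swap b c)) Y)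
    (hq : quadOp σ a b c d * Y = 0) : σ (swap a b * swap c d) * Y = Y := by
  have hs : ∀ x y : Ω, σ (swap x y) * σ (swap x y) = 1 := fun x y => by
    rw [← map_mul, swap_mul_self, map_one]
  have hc1 : σ (swap b d) * σ (swap a c) = σ (swap a c) * σ (swap b d) := by
    rw [← map_mul, ← map_mul]
    congr 1
    exact ((Equiv.Perm.disjoint_swap_swap (by simp_all [Ne.symm])).commute).eq
  have hc2 : σ (swap b c) * σ (swap a d) = σ (swap a d) * σ (swap b c) := by
    rw [← map_mul, ← map_mul]
    congr 1
    exact ((Equiv.Perm.disjoint_swap_swap (by simp_all [Ne.symm])).commute).eq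
  have hprod : swap a d * swap b c * (swap a c * swap b d) = swap a b * swap c d := by
    ext x
    simp only [Perm.mul_apply]
    by_cases hxa : x = a
    · subst hxa
      simp [swap_apply_of_ne_of_ne, *, Ne.symm, hab.symm, hac.symm, had.symm, hbc.symm, hbd.symm,
        hcd.symm]
    by_cases hxb : x = b
    · subst hxb
      simp [swap_apply_of_ne_of_ne, *, Ne.symm, hab.symm, hac.symm, had.symm, hbc.symm, hbd.symm,
        hcd.symm]
    by_cases hxc : x = c
    · subst hxc
      simp [swap_apply_of_ne_of_ne, *, Ne.symm, hab.symm, hac.symm, had.symm, hbc.symm, hbd.symm,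
        hcd.symm]
    by_cases hxd : x = d
    · subst hxd
      simp [swap_apply_of_ne_of_ne, *, Ne.symm, hab.symm, hac.symm, had.symm, hbc.symm, hbd.symm,
        hcd.symm]
    simp [swap_apply_of_ne_of_ne, *]
  rw [← hprod, map_mul, map_mul, map_mul]
  rw [quadOp] at hq
  have hα := hs a c
  have hβ := hs b d
  have hγ := hs a d
  have hδ := hs b c
  generalize σ (swap a c) = α at *
  generalize σ (swap b d) = β at *
  generalize σ (swap a d) = γ at *
  generalize σ (swap b c) = δ at *
  have hP : (α + β) * Y = (γ + δ) * Y := by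
    rw [← sub_eq_zero, ← hq]; noncomm_ring
  have hQY : Commute (γ + δ) Y := h4.add_left h5
  have hPP : (α + β) * ((α + β) * Y) = (γ + δ) * ((γ + δ) * Y) := by
    rw [hP, hQY.eq, ← mul_assoc, hP, mul_assoc, ← hQY.eq]
  have e1 : (α + β) * ((α + β) * Y) = (2 : F) • Y + (2 : F) • (α * β * Y) := by
    calc (α + β) * ((α + β) * Y) = (α * α) * Y + (β * β) * Y + α * β * Y + (β * α) * Y := by
          noncomm_ring
      _ = _ := by rw [hα, hβ, hc1]; simp only [two_smul, one_mul]; abel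
  have e2 : (γ + δ) * ((γ + δ) * Y) = (2 : F) • Y + (2 : F) • (γ * δ * Y) := by
    calc (γ + δ) * ((γ + δ) * Y) = (γ * γ) * Y + (δ * δ) * Y + γ * δ * Y + (δ * γ) * Y := by
          noncomm_ring
      _ = _ := by rw [hγ, hδ, hc2]; simp only [two_smul, one_mul]; abel
  have h6 : α * β * Y = γ * δ * Y := by
    have : (2 : F) • (α * β * Y) = (2 : F) • (γ * δ * Y) := by
      rw [e1, e2] at hPP; exact add_left_cancel hPP
    exact smul_right_injective _ h2 this
  calc γ * δ * (α * β) * Y = γ * δ * (α * β * Y) := by noncomm_ring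
    _ = γ * δ * (γ * δ * Y) := by rw [h6]
    _ = γ * (δ * γ) * δ * Y := by noncomm_ring
    _ = (γ * γ) * (δ * δ) * Y := by rw [hc2]; noncomm_ring
    _ = Y := by rw [hγ, hδ]; simp

end TranspositionSums

end

section

open Equiv

theorem exists_perm_map_injective {Ω κ : Type*} [Finite Ω] {f f' : κ → Ω}
    (hf : Function.Injective f) (hf' : Function.Injective f') :
    ∃ g : Perm Ω, ∀ i, g (f i) = f' i := by
  classical
  have := Fintype.ofFinite Ω
  let e : {x // x ∈ Set.range f} ≃ {x // x ∈ Set.range f'} :=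
    (Equiv.ofInjective f hf).symm.trans (Equiv.ofInjective f' hf')
  refine ⟨e.extendSubtype, fun i => ?_⟩
  rw [Equiv.extendSubtype_apply_of_mem e (f i) ⟨i, rfl⟩]
  simp [e, Equiv.ofInjective_symm_apply]

section ListOperators

variable {F W : Type*} [Field F] [AddCommGroup W] [Module F W]

theorem list_prod_apply_eq_zero (l : List (Module.End F W))
    (hc : ∀ A ∈ l, ∀ B ∈ l, Commute A B) (z : W) (hz : ∃ A ∈ l, A z = 0) : l.prod z = 0 := by
  induction l with
  | nil => simp at hz
  | cons B l ih =>
    rw [List.prod_cons, Module.End.mul_apply]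
    obtain ⟨A, hA, hAz⟩ := hz
    rcases List.mem_cons.1 hA with rfl | hA
    · have : Commute A l.prod :=
        Commute.list_prod_right _ _ fun C hC => hc _ (by simp) _ (by simp [hC])
      rw [← Module.End.mul_apply, this.eq, Module.End.mul_apply, hAz, map_zero]
    · rw [ih (fun A hA B hB => hc _ (by simp [hA]) _ (by simp [hB])) ⟨A, hA, hAz⟩, map_zero]

theorem list_prod_apply_eq_smul (l : List (Module.End F W)) (k : F) (x : W)
    (h : ∀ A ∈ l, A x = k • x) : l.prod x = k ^ l.length • x := by
  induction l with
  | nil => simp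
  | cons B l ih =>
    rw [List.prod_cons, Module.End.mul_apply, ih fun A hA => h A (by simp [hA]), map_smul,
      h B (by simp), smul_smul, List.length_cons, pow_succ]

theorem exists_common_eigenvector [Nontrivial W] (l : List (Module.End F W))
    (hc : ∀ A ∈ l, ∀ B ∈ l, Commute A B) (hi : ∀ A ∈ l, A * A = 1) :
    ∃ x : W, x ≠ 0 ∧ ∀ A ∈ l, A x = x ∨ A x = -x := by
  induction l with
  | nil => simpa using exists_ne (0 : W)
  | cons B l ih =>
    obtain ⟨x, hx, h⟩ := ih (fun A hA B hB => hc _ (by simp [hA]) _ (by simp [hB]))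
      (fun A hA => hi A (by simp [hA]))
    by_cases hB : x + B x = 0
    · refine ⟨x, hx, fun A hA => ?_⟩
      rcases List.mem_cons.1 hA with rfl | hA
      · exact Or.inr (by rw [eq_neg_iff_add_eq_zero, add_comm]; exact hB)
      · exact h A hA
    · refine ⟨x + B x, hB, fun A hA => ?_⟩
      rcases List.mem_cons.1 hA with rfl | hA
      · left
        rw [map_add, ← Module.End.mul_apply, hi A (by simp)]
        simp [add_comm]
      · have hAB : A (B x) = B (A x) := by
          rw [← Module.End.mul_apply, (hc A (by simp [hA]) B (by simp)).eq, Module.End.mul_apply]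
        rcases h A hA with h | h
        · left; rw [map_add, hAB, h]
        · right; rw [map_add, hAB, h, map_neg, neg_add]

end ListOperators

section LocalSign

variable {F W Ω : Type*} [Field F] [AddCommGroup W] [Module F W] [Fintype Ω] [DecidableEq Ω]
  (σ : Representation F (Perm Ω) W)

theorem span_orbit_eq_top {G : Type*} [Group G] (σ : Representation F G W)
    (hirr : ∀ p : Submodule F W, RepInvariant σ p → p = ⊥ ∨ p = ⊤) {v : W} (hv : v ≠ 0) :
    Submodule.span F (Set.range fun g => σ g v) = ⊤ := by
  refine (hirr _ ?_).resolve_left ?_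
  · intro g x hx
    induction hx using Submodule.span_induction with
    | mem x hx =>
      obtain ⟨h, rfl⟩ := hx
      exact Submodule.subset_span ⟨g * h, by simp⟩
    | zero => simp
    | add x y _ _ hx hy => rw [map_add]; exact add_mem hx hy
    | smul a x _ hx => rw [map_smul]; exact Submodule.smul_mem _ _ hx
  · intro h
    have : v ∈ Submodule.span F (Set.range fun g => σ g v) :=
      Submodule.subset_span ⟨1, by simp⟩
    rw [h] at this
    exact hv (by simpa using this)

theorem commute_disjoint_swaps {ι : Type*} {e : ι × Bool → Ω} (he : Function.Injective e)
    (i j : ι) : Commute (σ (swap (e (i, false)) (e (i, true))))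
      (σ (swap (e (j, false)) (e (j, true)))) := by
  by_cases h : i = j
  · rw [h]
  · refine Commute.map ?_ σ
    refine (Equiv.Perm.disjoint_swap_swap ?_).commute
    simp [he.eq_iff, h]

theorem prod_swap_sub_eq_zero
    (hirr : ∀ p : Submodule F W, RepInvariant σ p → p = ⊥ ∨ p = ⊤) {v : W} (hv : v ≠ 0)
    {Δ : Finset Ω} (ε : F) (hΔ : ∀ c d, c ≠ d → c ∉ Δ → d ∉ Δ → σ (swap c d) v = ε • v)
    {ι : Type*} {e : ι × Bool → Ω} (he : Function.Injective e) (S : Finset ι)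
    (hS : Δ.card < S.card) (x : W) :
    (S.toList.map fun i => σ (swap (e (i, false)) (e (i, true))) - ε • 1).prod x = 0 := by
  have hx : x ∈ Submodule.span F (Set.range fun g => σ g v) := by
    rw [span_orbit_eq_top σ hirr hv]; trivial
  rw [← LinearMap.mem_ker]
  refine Submodule.span_le.2 ?_ hx
  rintro _ ⟨g, rfl⟩
  rw [SetLike.mem_coe, LinearMap.mem_ker]
  refine list_prod_apply_eq_zero _ ?_ _ ?_
  · simp only [List.mem_map]
    rintro _ ⟨i, -, rfl⟩ _ ⟨j, -, rfl⟩
    refine Commute.sub_left (Commute.sub_right (commute_disjoint_swaps σ he i j) ?_)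
      (Commute.sub_right ?_ ?_)
    · exact (Commute.one_right _).smul_right _
    · exact (Commute.one_left _).smul_left _
    · exact ((Commute.one_left _).smul_left _)
  · have : ∃ i ∈ S, g⁻¹ (e (i, false)) ∉ Δ ∧ g⁻¹ (e (i, true)) ∉ Δ := by
      by_contra! hcon
      have hb : ∀ i ∈ S, ∃ b, g⁻¹ (e (i, b)) ∈ Δ := fun i hi => by
        by_cases h : g⁻¹ (e (i, false)) ∈ Δ
        · exact ⟨_, h⟩
        · exact ⟨_, hcon i hi h⟩
      choose! b hb using hb
      refine absurd (Finset.card_le_card_of_injOn (fun i => g⁻¹ (e (i, b i))) hb ?_)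
        (not_le.2 hS)
      intro i _ j _ hij
      have := he (g⁻¹.injective hij)
      simpa using congrArg Prod.fst this
    obtain ⟨i, hi, h1, h2⟩ := this
    refine ⟨_, List.mem_map.2 ⟨i, by simpa using hi, rfl⟩, ?_⟩
    have hne : g⁻¹ (e (i, false)) ≠ g⁻¹ (e (i, true)) := fun h => by
      have := he (g⁻¹.injective h)
      simp at this
    have h3 := hΔ _ _ hne h1 h2
    have h4 : σ (swap (e (i, false)) (e (i, true))) * σ g =
        σ g * σ (swap (g⁻¹ (e (i, false))) (g⁻¹ (e (i, true)))) := by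
      rw [← map_mul, ← map_mul]
      congr 1
      rw [Equiv.swap_apply_apply]
      group
    have h5 := LinearMap.congr_fun h4 v
    rw [Module.End.mul_apply, Module.End.mul_apply, h3] at h5
    simp [h5]

theorem false_of_local_sign (h2 : (2 : F) ≠ 0) [Nontrivial W]
    (hirr : ∀ p : Submodule F W, RepInvariant σ p → p = ⊥ ∨ p = ⊤)
    (hΩ : 18 ≤ Fintype.card Ω) {Δ : Finset Ω} (hΔ : Δ.card ≤ 4) {v v' : W} (hv : v ≠ 0)
    (hv' : v' ≠ 0) (h : ∀ c d, c ≠ d → c ∉ Δ → d ∉ Δ → σ (swap c d) v = v)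
    (h' : ∀ c d, c ≠ d → c ∉ Δ → d ∉ Δ → σ (swap c d) v' = -v') : False := by
  obtain ⟨e⟩ : Nonempty (Fin 9 × Bool ↪ Ω) :=
    Function.Embedding.nonempty_of_card_le (by simpa using hΩ)
  have he := e.injective
  set t : Fin 9 → Module.End F W := fun i => σ (swap (e (i, false)) (e (i, true))) with ht
  obtain ⟨x, hx, hxt⟩ := exists_common_eigenvector (List.ofFn t)
    (by
      simp only [List.mem_ofFn]
      rintro _ ⟨i, rfl⟩ _ ⟨j, rfl⟩
      exact commute_disjoint_swaps σ he i j)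
    (by
      simp only [List.mem_ofFn]
      rintro _ ⟨i, rfl⟩
      simp only [ht]
      rw [← map_mul, swap_mul_self, map_one])
  have hxt' : ∀ i, t i x = x ∨ t i x = -x := fun i => hxt _ (List.mem_ofFn.2 ⟨i, rfl⟩)
  have key : ∀ (ε k : F) (u : W), k ≠ 0 → u ≠ 0 →
      (∀ c d, c ≠ d → c ∉ Δ → d ∉ Δ → σ (swap c d) u = ε • u) →
      ∀ S : Finset (Fin 9), 4 < S.card → (∀ i ∈ S, (t i - ε • 1) x = k • x) → False := by
    intro ε k u hk hu hεu S hS hSx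
    have h1 := prod_swap_sub_eq_zero σ hirr hu ε hεu he S (hΔ.trans_lt hS) x
    rw [list_prod_apply_eq_smul _ k x] at h1
    · exact hx ((smul_eq_zero.1 h1).resolve_left (pow_ne_zero _ hk))
    · simp only [List.mem_map, Finset.mem_toList]
      rintro _ ⟨i, hi, rfl⟩
      exact hSx i hi
  classical
  have hcard := Finset.card_filter_add_card_filter_not (s := (Finset.univ : Finset (Fin 9)))
    (fun i => t i x = x)
  rw [Finset.card_univ, Fintype.card_fin] at hcard
  by_cases hS : 4 < (Finset.univ.filter fun i => t i x = x).card
  · refine key (-1) 2 v' h2 hv' (by simpa using h') _ hS ?_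
    intro i hi
    rw [Finset.mem_filter] at hi
    rw [LinearMap.sub_apply, hi.2]
    simp [two_smul]
  · refine key 1 (-2) v (neg_ne_zero.2 h2) hv (by simpa using h)
      (Finset.univ.filter fun i => ¬ t i x = x) (by omega) ?_
    intro i hi
    rw [Finset.mem_filter] at hi
    rw [LinearMap.sub_apply, (hxt' i).resolve_left hi.2]
    simp [neg_smul, two_smul]
    abel

end LocalSign

end

section

open Equiv

section Induced

variable {F V Ω : Type*} [Field F] [AddCommGroup V] [Module F V] [Fintype Ω] [DecidableEq Ω]
  (ρ : Representation F (alternatingGroup Ω) V)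

open Classical in
/-- The extension by zero of a representation of the alternating group to all permutations. -/
noncomputable def extendZero (s : Perm Ω) : Module.End F V :=
  if h : s ∈ alternatingGroup Ω then ρ ⟨s, h⟩ else 0

theorem extendZero_coe (g : alternatingGroup Ω) : extendZero ρ (g : Perm Ω) = ρ g := by
  simp [extendZero]

theorem extendZero_of_odd {s : Perm Ω} (h : s ∉ alternatingGroup Ω) : extendZero ρ s = 0 := by
  simp only [extendZero, h, dite_false]

theorem extendZero_one : extendZero ρ (1 : Perm Ω) = 1 := by
  have := extendZero_coe ρ 1
  simpa using this

theorem extendZero_mul {τ : Perm Ω} (hτ : Perm.sign τ = -1) (hτ2 : τ * τ = 1) (s t : Perm Ω) :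
    extendZero ρ (s * t) =
      extendZero ρ s * extendZero ρ t + extendZero ρ (s * τ) * extendZero ρ (τ * t) := by
  have hst : s * τ * (τ * t) = s * t := by
    rw [mul_assoc, ← mul_assoc τ τ, hτ2, one_mul]
  rcases Int.units_eq_one_or (Perm.sign s) with hs | hs <;>
  rcases Int.units_eq_one_or (Perm.sign t) with ht | ht
  · lift s to alternatingGroup Ω using hs
    lift t to alternatingGroup Ω using ht
    rw [extendZero_of_odd ρ (s := (s : Perm Ω) * τ)
        (by simp [Perm.mem_alternatingGroup, hτ, Perm.mem_alternatingGroup.1 s.2]),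
      ← Subgroup.coe_mul, extendZero_coe, extendZero_coe, extendZero_coe]
    simp
  · rw [extendZero_of_odd ρ (s := s * τ) (by simp [Perm.mem_alternatingGroup, hτ, hs]),
      extendZero_of_odd ρ (s := t) (by simp [Perm.mem_alternatingGroup, ht]),
      extendZero_of_odd ρ (s := s * t) (by simp [Perm.mem_alternatingGroup, hs, ht])]
    simp
  · rw [extendZero_of_odd ρ (s := s) (by simp [Perm.mem_alternatingGroup, hs]),
      extendZero_of_odd ρ (s := τ * t) (by simp [Perm.mem_alternatingGroup, ht, hτ]),
      extendZero_of_odd ρ (s := s * t) (by simp [Perm.mem_alternatingGroup, hs, ht])]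
    simp
  · rw [extendZero_of_odd ρ (s := s) (by simp [Perm.mem_alternatingGroup, hs]), ← hst]
    have h1 : s * τ ∈ alternatingGroup Ω := by simp [Perm.mem_alternatingGroup, hs, hτ]
    have h2 : τ * t ∈ alternatingGroup Ω := by simp [Perm.mem_alternatingGroup, ht, hτ]
    generalize s * τ = s' at *
    generalize τ * t = t' at *
    lift s' to alternatingGroup Ω using h1
    lift t' to alternatingGroup Ω using h2
    rw [← Subgroup.coe_mul, extendZero_coe, extendZero_coe, extendZero_coe]
    simp

/-- The representation of the symmetric group induced from the alternating group, written
with respect to the coset representatives `1` and `τ`. -/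
noncomputable def inducedRep {τ : Perm Ω} (hτ : Perm.sign τ = -1) (hτ2 : τ * τ = 1) :
    Representation F (Perm Ω) (V × V) where
  toFun s := (extendZero ρ s ∘ₗ LinearMap.fst F V V +
      extendZero ρ (s * τ) ∘ₗ LinearMap.snd F V V).prod
    (extendZero ρ (τ * s) ∘ₗ LinearMap.fst F V V +
      extendZero ρ (τ * s * τ) ∘ₗ LinearMap.snd F V V)
  map_one' := by
    have : extendZero ρ τ = 0 := extendZero_of_odd ρ (by simp [Perm.mem_alternatingGroup, hτ])
    ext x <;> simp [this, hτ2, extendZero_one]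
  map_mul' s t := by
    have h1 := extendZero_mul ρ hτ hτ2 s t
    have h2 := extendZero_mul ρ hτ hτ2 s (t * τ)
    have h3 := extendZero_mul ρ hτ hτ2 (τ * s) t
    have h4 := extendZero_mul ρ hτ hτ2 (τ * s) (t * τ)
    simp only [← mul_assoc] at h1 h2 h3 h4
    ext x <;> simp [h1, h2, h3, h4, ← mul_assoc]

theorem inducedRep_apply {τ : Perm Ω} (hτ : Perm.sign τ = -1) (hτ2 : τ * τ = 1) (s : Perm Ω)
    (x : V × V) : inducedRep ρ hτ hτ2 s x =
      (extendZero ρ s x.1 + extendZero ρ (s * τ) x.2,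
        extendZero ρ (τ * s) x.1 + extendZero ρ (τ * s * τ) x.2) := rfl

theorem inducedRep_even_fst {τ : Perm Ω} (hτ : Perm.sign τ = -1) (hτ2 : τ * τ = 1)
    (g : alternatingGroup Ω) (x : V × V) : (inducedRep ρ hτ hτ2 (g : Perm Ω) x).1 = ρ g x.1 := by
  rw [inducedRep_apply, extendZero_coe,
    extendZero_of_odd ρ (s := g * τ)
      (by simp [Perm.mem_alternatingGroup, hτ, Perm.mem_alternatingGroup.1 g.2])]
  simp

theorem inducedRep_even_inl {τ : Perm Ω} (hτ : Perm.sign τ = -1) (hτ2 : τ * τ = 1)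
    (g : alternatingGroup Ω) (v : V) : inducedRep ρ hτ hτ2 (g : Perm Ω) (v, 0) = (ρ g v, 0) := by
  rw [inducedRep_apply, extendZero_coe,
    extendZero_of_odd ρ (s := τ * g)
      (by simp [Perm.mem_alternatingGroup, hτ, Perm.mem_alternatingGroup.1 g.2])]
  simp

theorem inducedRep_odd_inl {τ : Perm Ω} (hτ : Perm.sign τ = -1) (hτ2 : τ * τ = 1)
    {s : Perm Ω} (hs : Perm.sign s = -1) (v : V) :
    inducedRep ρ hτ hτ2 s (v, 0) = (0, extendZero ρ (τ * s) v) := by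
  rw [inducedRep_apply, 
    extendZero_of_odd ρ (s := s) (by simp [Perm.mem_alternatingGroup, hs])]
  simp

theorem inducedRep_odd_inr {τ : Perm Ω} (hτ : Perm.sign τ = -1) (hτ2 : τ * τ = 1)
    {s : Perm Ω} (hs : Perm.sign s = -1) (v : V) :
    inducedRep ρ hτ hτ2 s (0, v) = (extendZero ρ (s * τ) v, 0) := by
  rw [inducedRep_apply, 
    extendZero_of_odd ρ (s := τ * s * τ) (by simp [Perm.mem_alternatingGroup, hs, hτ])]
  simp

theorem inducedRep_self_inl {τ : Perm Ω} (hτ : Perm.sign τ = -1) (hτ2 : τ * τ = 1) (v : V) :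
    inducedRep ρ hτ hτ2 τ (v, 0) = (0, v) := by
  rw [inducedRep_odd_inl ρ hτ hτ2 hτ, hτ2, extendZero_one]; rfl

theorem inducedRep_self_inr {τ : Perm Ω} (hτ : Perm.sign τ = -1) (hτ2 : τ * τ = 1) (v : V) :
    inducedRep ρ hτ hτ2 τ (0, v) = (v, 0) := by
  rw [inducedRep_odd_inr ρ hτ hτ2 hτ, hτ2, extendZero_one]; rfl

theorem false_of_apply_eq_one (hΩ : 5 ≤ Fintype.card Ω) {X : Subgroup (alternatingGroup Ω)}
    (hirr : RepIrreducible (ρ.comp X.subtype)) (hdim : 1 < Module.rank F V)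
    {g : alternatingGroup Ω} (hg : g ≠ 1) (hρ : ρ g = 1) : False := by
  have := alternatingGroup.isSimpleGroup (α := Ω) (by simpa using hΩ)
  have htop : ρ.ker = ⊤ := by
    refine (Subgroup.Normal.eq_bot_or_eq_top inferInstance).resolve_left fun h => hg ?_
    have : g ∈ ρ.ker := hρ
    rwa [h, Subgroup.mem_bot] at this
  have h1 : ∀ g, ρ g = 1 := fun g => by
    have : g ∈ ρ.ker := htop ▸ Subgroup.mem_top g
    exact this
  obtain ⟨hnt, hirr⟩ := hirr
  obtain ⟨v, hv⟩ := exists_ne (0 : V)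
  have h2 : Submodule.span F {v} = ⊤ := by
    refine (hirr _ ?_).resolve_left (by simpa using hv)
    intro g x hx
    simpa [h1] using hx
  have h3 : Module.rank F (Submodule.span F {v}) ≤ 1 := by
    simpa using rank_span_le (R := F) ({v} : Set V)
  rw [h2, rank_top] at h3
  exact absurd hdim (not_lt.2 h3)

theorem finiteDimensional_of_repIrreducible {G : Type*} [Group G] [Finite G]
    {ρ : Representation F G V} (hirr : RepIrreducible ρ) : FiniteDimensional F V := by
  obtain ⟨hnt, hirr⟩ := hirr
  obtain ⟨v, hv⟩ := exists_ne (0 : V)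
  have h := span_orbit_eq_top ρ hirr hv
  exact ⟨(Submodule.fg_def.2 ⟨_, Set.finite_range _, h⟩)⟩

theorem exists_eq_smul_one_of_commute [IsAlgClosed F] {G : Type*} [Group G] [Finite G]
    {ρ : Representation F G V} (hirr : RepIrreducible ρ) {T : Module.End F V}
    (hT : ∀ g, Commute (ρ g) T) : ∃ k : F, T = k • 1 := by
  have := finiteDimensional_of_repIrreducible hirr
  obtain ⟨hnt, hirr⟩ := hirr
  obtain ⟨k, hk⟩ := Module.End.exists_eigenvalue T
  refine ⟨k, ?_⟩
  have : Module.End.eigenspace T k = ⊤ := by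
    refine (hirr _ ?_).resolve_left hk
    intro g v hv
    rw [Module.End.mem_eigenspace_iff] at hv ⊢
    rw [← Module.End.mul_apply, ← (hT g).eq, Module.End.mul_apply, hv, map_smul]
  ext v
  have hv : v ∈ Module.End.eigenspace T k := this ▸ Submodule.mem_top
  simpa using Module.End.mem_eigenspace_iff.1 hv

end Induced

end

section

open Equiv

section RepMain

variable {F V W Ω : Type*} [Field F] [AddCommGroup V] [Module F V] [AddCommGroup W] [Module F W]
  [Fintype Ω] [DecidableEq Ω]

theorem commute_transpSum (σ : Representation F (Perm Ω) W) {w : Ω → Ω → F} {g : Perm Ω}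
    (h : ∀ a b, w (g a) (g b) = w a b) : Commute (σ g) (transpSum σ w) := by
  have h1 := conj_transpSum σ g w
  have h2 : (fun a b => w (g⁻¹ a) (g⁻¹ b)) = w := by
    ext a b
    rw [← h (g⁻¹ a) (g⁻¹ b)]
    simp
  rw [h2] at h1
  calc σ g * transpSum σ w = σ g * transpSum σ w * (σ g⁻¹ * σ g) := by
        rw [← map_mul]; simp
    _ = transpSum σ w * σ g := by rw [← mul_assoc, h1]

theorem swap_mul_swap_ne_one {a b c d : Ω} (hab : a ≠ b) (hac : a ≠ c) (had : a ≠ d) :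
    swap a b * swap c d ≠ 1 := by
  intro h
  have := Equiv.ext_iff.1 h a
  rw [Perm.mul_apply, swap_apply_of_ne_of_ne hac had, swap_apply_left] at this
  exact hab this.symm

theorem swap_mul_swap_mem {a b c d : Ω} (hab : a ≠ b) (hcd : c ≠ d) :
    swap a b * swap c d ∈ alternatingGroup Ω := by
  simp [Perm.mem_alternatingGroup, Perm.sign_swap hab, Perm.sign_swap hcd]

/-- If `quadOp` vanishes then a double transposition acts trivially. -/
theorem double_swap_eq_one (σ : Representation F (Perm Ω) W) (h2 : (2 : F) ≠ 0) {a b c d : Ω}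
    (hab : a ≠ b) (hac : a ≠ c) (had : a ≠ d) (hbc : b ≠ c) (hbd : b ≠ d) (hcd : c ≠ d)
    (hq : quadOp σ a b c d = 0) : σ (swap a b * swap c d) = 1 := by
  have := double_swap_mul_eq σ h2 hab hac had hbc hbd hcd (Y := 1) (Commute.one_right _)
    (Commute.one_right _) (Commute.one_right _) (Commute.one_right _) (by rw [hq, zero_mul])
  rwa [mul_one] at this

variable (ρ : Representation F (alternatingGroup Ω) V) {τ : Perm Ω} (hτ : Perm.sign τ = -1)
  (hτ2 : τ * τ = 1)

theorem false_of_invariant_submodule [IsAlgClosed F] (h2 : (2 : F) ≠ 0)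
    (hΩ : 5 ≤ Fintype.card Ω) {X : Subgroup (alternatingGroup Ω)}
    (hirr : RepIrreducible (ρ.comp X.subtype)) (hdim : 1 < Module.rank F V)
    {w : Ω → Ω → F} (hw : ∀ a b, w a b = w b a)
    (hX : ∀ g ∈ X, ∀ a b, w ((g : Perm Ω) a) ((g : Perm Ω) b) = w a b) {a b c d : Ω}
    (hab : a ≠ b) (hac : a ≠ c) (had : a ≠ d) (hbc : b ≠ c) (hbd : b ≠ d) (hcd : c ≠ d)
    (hξ : secondDiff w a b c d ≠ 0)
    {p : Submodule F (V × V)} (hp : RepInvariant (inducedRep ρ hτ hτ2) p)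
    (hbot : p ≠ ⊥) (htop : p ≠ ⊤) : False := by
  set σ := inducedRep ρ hτ hτ2 with hσ
  have h1 : p.comap (LinearMap.inl F V V) = ⊥ := by
    refine (hirr.2 _ ?_).resolve_right fun h => htop ?_
    · intro g v hv
      have := hp ((g : alternatingGroup Ω) : Perm Ω) _ hv
      rwa [LinearMap.inl_apply, inducedRep_even_inl] at this
    · have hl : ∀ v, (v, (0 : V)) ∈ p := fun v => by
        have : v ∈ p.comap (LinearMap.inl F V V) := h ▸ Submodule.mem_top
        exact this
      rw [eq_top_iff]
      rintro ⟨v, v'⟩ -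
      have h3 := hp τ _ (hl v')
      rw [inducedRep_self_inl] at h3
      simpa using add_mem (hl v) h3
  have hl : ∀ v, (v, (0 : V)) ∈ p → v = 0 := fun v hv => by
    have : v ∈ p.comap (LinearMap.inl F V V) := hv
    rwa [h1, Submodule.mem_bot] at this
  have hr : ∀ v, ((0 : V), v) ∈ p → v = 0 := fun v hv => by
    have := hp τ _ hv
    rw [inducedRep_self_inr] at this
    exact hl v this
  have h3 : p.map (LinearMap.fst F V V) = ⊤ := by
    refine (hirr.2 _ ?_).resolve_left fun h => hbot ?_
    · rintro g _ ⟨x, hx, rfl⟩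
      refine ⟨_, hp ((g : alternatingGroup Ω) : Perm Ω) x hx, ?_⟩
      exact inducedRep_even_fst ρ hτ hτ2 g x
    · rw [eq_bot_iff]
      rintro ⟨v, v'⟩ hv
      have : v ∈ p.map (LinearMap.fst F V V) := ⟨_, hv, rfl⟩
      rw [h, Submodule.mem_bot] at this
      subst this
      rw [hr v' hv]
      exact Submodule.zero_mem _
  let σp : Representation F (Perm Ω) p :=
    { toFun := fun g => (σ g).restrict (hp g)
      map_one' := by ext x <;> simp [LinearMap.restrict_apply]
      map_mul' := fun g h => by ext x <;> simp [LinearMap.restrict_apply] }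
  let φ : p ≃ₗ[F] V := LinearEquiv.ofBijective ((LinearMap.fst F V V).domRestrict p) (by
    constructor
    · rw [injective_iff_map_eq_zero]
      rintro ⟨⟨v, v'⟩, hv⟩ h
      have : v = 0 := h
      subst this
      have := hr v' hv
      subst this
      rfl
    · intro v
      have : v ∈ p.map (LinearMap.fst F V V) := h3 ▸ Submodule.mem_top
      obtain ⟨x, hx, rfl⟩ := this
      exact ⟨⟨x, hx⟩, rfl⟩)
  have hφ : ∀ (g : alternatingGroup Ω) (x : p), φ (σp (g : Perm Ω) x) = ρ g (φ x) := fun g x =>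
    inducedRep_even_fst ρ hτ hτ2 g x
  obtain ⟨k, hk⟩ := exists_eq_smul_one_of_commute hirr
    (T := φ.toLinearMap ∘ₗ transpSum σp w ∘ₗ φ.symm.toLinearMap) (by
      intro g
      have hc := commute_transpSum σp (hX g.1 g.2)
      ext v
      obtain ⟨x, rfl⟩ := φ.surjective v
      have h4 := LinearMap.congr_fun hc.eq x
      simp only [Module.End.mul_apply] at h4
      simp only [Module.End.mul_apply, MonoidHom.comp_apply, Subgroup.subtype_apply,
        LinearMap.comp_apply, LinearEquiv.coe_coe, ← hφ, LinearEquiv.symm_apply_apply, h4])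
  have hu : transpSum σp w = k • 1 := by
    ext1 x
    have := LinearMap.congr_fun hk (φ x)
    simp only [LinearMap.comp_apply, LinearEquiv.coe_coe, LinearEquiv.symm_apply_apply,
      LinearMap.smul_apply, Module.End.one_apply] at this ⊢
    apply φ.injective
    rw [this, map_smul]
  have h5 := double_swap_eq_one σp h2 hab hac had hbc hbd hcd
    (quadOp_eq_zero_of_transpSum_scalar σp h2 hw hab hac had hbc hbd hcd hξ k hu)
  refine false_of_apply_eq_one ρ hΩ hirr hdim (g := ⟨_, swap_mul_swap_mem hab hcd⟩) ?_ ?_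
  · intro h
    exact swap_mul_swap_ne_one hab hac had (congrArg Subtype.val h)
  · ext v
    obtain ⟨x, rfl⟩ := φ.surjective v
    rw [← hφ]
    simp [h5]

/-- An operator on `V × V` interchanging the two factors. -/
def IsOddOp (T : Module.End F (V × V)) : Prop :=
  (∀ v, (T (v, 0)).1 = 0) ∧ ∀ v, (T (0, v)).2 = 0

theorem isOddOp_inducedRep {s : Perm Ω} (hs : Perm.sign s = -1) :
    IsOddOp (inducedRep ρ hτ hτ2 s) :=
  ⟨fun v => by rw [inducedRep_odd_inl ρ hτ hτ2 hs], fun v => by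
    rw [inducedRep_odd_inr ρ hτ hτ2 hs]⟩

theorem isOddOp_transpSum {w : Ω → Ω → F} (hw : ∀ a, w a a = 0) :
    IsOddOp (transpSum (inducedRep ρ hτ hτ2) w) := by
  have key : ∀ a b, IsOddOp (w a b • inducedRep ρ hτ hτ2 (swap a b)) := fun a b => by
    by_cases hab : a = b
    · subst hab
      rw [hw, zero_smul]
      exact ⟨fun _ => rfl, fun _ => rfl⟩
    · have := isOddOp_inducedRep ρ hτ hτ2 (Perm.sign_swap hab)
      exact ⟨fun v => by simp [this.1 v], fun v => by simp [this.2 v]⟩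
  constructor
  · intro v
    simp only [transpSum, LinearMap.sum_apply, Prod.fst_sum]
    exact Finset.sum_eq_zero fun a _ => Finset.sum_eq_zero fun b _ => (key a b).1 v
  · intro v
    simp only [transpSum, LinearMap.sum_apply, Prod.snd_sum]
    exact Finset.sum_eq_zero fun a _ => Finset.sum_eq_zero fun b _ => (key a b).2 v

theorem isOddOp_quadOp {a b c d : Ω} (hac : a ≠ c) (had : a ≠ d) (hbc : b ≠ c) (hbd : b ≠ d) :
    IsOddOp (quadOp (inducedRep ρ hτ hτ2) a b c d) := by
  have h1 := isOddOp_inducedRep ρ hτ hτ2 (Perm.sign_swap hac)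
  have h2 := isOddOp_inducedRep ρ hτ hτ2 (Perm.sign_swap had)
  have h3 := isOddOp_inducedRep ρ hτ hτ2 (Perm.sign_swap hbc)
  have h4 := isOddOp_inducedRep ρ hτ hτ2 (Perm.sign_swap hbd)
  exact ⟨fun v => by simp [quadOp, h1.1 v, h2.1 v, h3.1 v, h4.1 v],
    fun v => by simp [quadOp, h1.2 v, h2.2 v, h3.2 v, h4.2 v]⟩

theorem sq_eq_smul_one_of_isOddOp [IsAlgClosed F] {X : Subgroup (alternatingGroup Ω)}
    (hirr : RepIrreducible (ρ.comp X.subtype)) {u : Module.End F (V × V)} (hu : IsOddOp u)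
    (hX : ∀ g ∈ X, Commute (inducedRep ρ hτ hτ2 ((g : alternatingGroup Ω) : Perm Ω)) u) :
    ∃ k : F, u * u = k • 1 := by
  have := finiteDimensional_of_repIrreducible hirr
  have hnt := hirr.1
  let B : Module.End F V := LinearMap.snd F V V ∘ₗ u ∘ₗ LinearMap.inl F V V
  let A : Module.End F V := LinearMap.fst F V V ∘ₗ u ∘ₗ LinearMap.inr F V V
  have hB : ∀ v, u (v, 0) = (0, B v) := fun v => Prod.ext (hu.1 v) rfl
  have hA : ∀ v, u (0, v) = (A v, 0) := fun v => Prod.ext rfl (hu.2 v)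
  have hcomm : ∀ g : X, ∀ x, u (inducedRep ρ hτ hτ2 ((g : alternatingGroup Ω) : Perm Ω) x) =
      inducedRep ρ hτ hτ2 ((g : alternatingGroup Ω) : Perm Ω) (u x) := fun g x => by
    rw [← Module.End.mul_apply, ← (hX g g.2).eq, Module.End.mul_apply]
  obtain ⟨k, hk⟩ := exists_eq_smul_one_of_commute hirr (T := A * B) (by
    intro g
    ext v
    have h1 := hcomm g (u (v, 0))
    rw [← hcomm g (v, 0), inducedRep_even_inl, hB, hA, hB, hA, inducedRep_even_inl] at h1
    exact (congrArg Prod.fst h1).symm)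
  have hAB : ∀ v, A (B v) = k • v := fun v => by
    simpa using LinearMap.congr_fun hk v
  have hBA : ∀ v, B (A v) = k • v := by
    rcases hirr.2 (LinearMap.ker B) (by
      intro g v hv
      rw [LinearMap.mem_ker] at hv ⊢
      have h1 := hcomm g (v, 0)
      rw [inducedRep_even_inl, hB, hB, hv, Prod.mk_zero_zero, map_zero] at h1
      simpa using congrArg Prod.snd h1) with h | h
    · have hinj : Function.Injective B := LinearMap.ker_eq_bot.1 h
      have hsurj := LinearMap.injective_iff_surjective.1 hinj
      intro v
      obtain ⟨v, rfl⟩ := hsurj v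
      rw [hAB, map_smul]
    · have hB0 : B = 0 := LinearMap.ker_eq_top.1 h
      obtain ⟨v, hv⟩ := exists_ne (0 : V)
      have h0 := hAB v
      rw [hB0, LinearMap.zero_apply, map_zero] at h0
      have hk0 : k = 0 := (smul_eq_zero.1 h0.symm).resolve_right hv
      intro v
      rw [hk0, hB0]; simp
  refine ⟨k, ?_⟩
  ext v <;> simp [hB, hA, hAB, hBA]

theorem exists_ne_not_mem (S : Finset Ω) (hS : S.card + 2 ≤ Fintype.card Ω) :
    ∃ a b, a ≠ b ∧ a ∉ S ∧ b ∉ S := by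
  have : 1 < Sᶜ.card := by rw [Finset.card_compl]; omega
  obtain ⟨a, ha, b, hb, hab⟩ := Finset.one_lt_card.1 this
  exact ⟨a, b, hab, by simpa using ha, by simpa using hb⟩

theorem not_repIrreducible_of_config [IsAlgClosed F] (h2 : (2 : F) ≠ 0)
    (hΩ : 18 ≤ Fintype.card Ω) {X : Subgroup (alternatingGroup Ω)}
    (hdim : 1 < Module.rank F V)
    {w : Ω → Ω → F} (hw : ∀ a b, w a b = w b a) (hw0 : ∀ a, w a a = 0)
    (hX : ∀ g ∈ X, ∀ a b, w ((g : Perm Ω) a) ((g : Perm Ω) b) = w a b) 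
    {f : Fin 8 → Ω} (hf : Function.Injective f)
    (h12 : secondDiff w (f 0) (f 1) (f 2) (f 3) ≠ 0)
    (h34 : secondDiff w (f 4) (f 5) (f 6) (f 7) ≠ 0)
    (h13 : secondDiff w (f 0) (f 1) (f 4) (f 5) = 0)
    (h14 : secondDiff w (f 0) (f 1) (f 6) (f 7) = 0) :
    ¬ RepIrreducible (ρ.comp X.subtype) := by
  intro hirr
  have hnt := hirr.1
  have ne : ∀ i j : Fin 8, i ≠ j → f i ≠ f j := fun i j h => hf.ne h
  have h01 := ne 0 1 (by decide)
  have h02 := ne 0 2 (by decide)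
  have h03 := ne 0 3 (by decide)
  have h12' := ne 1 2 (by decide)
  have h13' := ne 1 3 (by decide)
  have h23 := ne 2 3 (by decide)
  have hτ := Perm.sign_swap h01
  have hτ2 := swap_mul_self (f 0) (f 1)
  by_cases hirrW : ∀ p : Submodule F (V × V), RepInvariant (inducedRep ρ hτ hτ2) p →
      p = ⊥ ∨ p = ⊤
  swap
  · push Not at hirrW
    obtain ⟨p, hp, hbot, htop⟩ := hirrW
    exact false_of_invariant_submodule ρ hτ hτ2 h2 (by omega) hirr hdim hw hX h01 h02 h03 h12' h13'
      h23 h12 hp hbot htop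
  set σ := inducedRep ρ hτ hτ2 with hσ
  obtain ⟨k, hk⟩ := sq_eq_smul_one_of_isOddOp ρ hτ hτ2 hirr (isOddOp_transpSum ρ hτ hτ2 hw0)
    (fun g hg => commute_transpSum σ (hX g hg))
  have hyy := quadOp_mul_eq_zero σ h2 hw hf h12 h34 h13 h14 k hk
  have hYodd := isOddOp_quadOp ρ hτ hτ2 h02 h03 h12' h13'
  rw [← hσ] at hYodd
  by_cases hY0 : quadOp σ (f 0) (f 1) (f 2) (f 3) = 0
  · refine false_of_apply_eq_one ρ (by omega) hirr hdim (g := ⟨_, swap_mul_swap_mem h01 h23⟩) ?_ ?_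
    · intro h
      exact swap_mul_swap_ne_one h01 h02 h03 (congrArg Subtype.val h)
    · ext v
      have h1 := double_swap_eq_one σ h2 h01 h02 h03 h12' h13' h23 hY0
      have h3 := inducedRep_even_inl ρ hτ hτ2 ⟨_, swap_mul_swap_mem h01 h23⟩ v
      rw [← hσ, h1] at h3
      exact (congrArg Prod.fst h3).symm
  let Δ : Finset Ω := {f 0, f 1, f 2, f 3}
  have hΔ : Δ.card ≤ 4 := Finset.card_le_four
  have hΔmem : ∀ {c}, c ∉ Δ → c ≠ f 0 ∧ c ≠ f 1 ∧ c ≠ f 2 ∧ c ≠ f 3 := fun hc => by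
    simpa [Δ] using hc
  have hcommY : ∀ c d, c ∉ Δ → d ∉ Δ →
      Commute (σ (swap c d)) (quadOp σ (f 0) (f 1) (f 2) (f 3)) := fun c d hc hd => by
    obtain ⟨c0, c1, c2, c3⟩ := hΔmem hc
    obtain ⟨d0, d1, d2, d3⟩ := hΔmem hd
    exact commute_swap_quadOp σ c0 c1 c2 c3 d0 d1 d2 d3
  have hfix : ∀ a b c d, a ∉ Δ → b ∉ Δ → c ∉ Δ → d ∉ Δ → a ≠ b → a ≠ c → a ≠ d → b ≠ c → b ≠ d →
      c ≠ d → σ (swap a b * swap c d) * quadOp σ (f 0) (f 1) (f 2) (f 3) =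
        quadOp σ (f 0) (f 1) (f 2) (f 3) := by
    intro a b c d ha hb hc hd hab hac had hbc hbd hcd
    refine double_swap_mul_eq σ h2 hab hac had hbc hbd hcd (hcommY _ _ ha hc) (hcommY _ _ hb hd)
      (hcommY _ _ ha hd) (hcommY _ _ hb hc) ?_
    have hf' : Function.Injective ![f 0, f 1, f 2, f 3, a, b, c, d] := by
      obtain ⟨a0, a1, a2, a3⟩ := hΔmem ha
      obtain ⟨b0, b1, b2, b3⟩ := hΔmem hb
      obtain ⟨c0, c1, c2, c3⟩ := hΔmem hc
      obtain ⟨d0, d1, d2, d3⟩ := hΔmem hd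
      rw [← List.nodup_ofFn]
      simp [List.ofFn_succ]
      simp only [a0.symm, a1.symm, a2.symm, a3.symm, b0.symm, b1.symm, b2.symm, b3.symm,
        c0.symm, c1.symm, c2.symm, c3.symm, d0.symm, d1.symm, d2.symm, d3.symm, hab, hac, had,
        hbc, hbd, hcd, h01, h02, h03, h12', h13', h23, not_false_eq_true, and_self]
    obtain ⟨g, hg⟩ := exists_perm_map_injective hf hf'
    have e1 := conj_quadOp σ g (f 0) (f 1) (f 2) (f 3)
    have e2 := conj_quadOp σ g (f 4) (f 5) (f 6) (f 7)
    rw [hg, hg, hg, hg] at e1 e2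
    have hgg : σ g⁻¹ * σ g = 1 := by rw [← map_mul]; simp
    have hprod : quadOp σ (f 0) (f 1) (f 2) (f 3) * quadOp σ a b c d = 0 := by
      calc quadOp σ (f 0) (f 1) (f 2) (f 3) * quadOp σ a b c d
          = (σ g * quadOp σ (f 0) (f 1) (f 2) (f 3) * σ g⁻¹) *
            (σ g * quadOp σ (f 4) (f 5) (f 6) (f 7) * σ g⁻¹) := by rw [e1, e2]; rfl
        _ = σ g * quadOp σ (f 0) (f 1) (f 2) (f 3) * (σ g⁻¹ * σ g) *
            quadOp σ (f 4) (f 5) (f 6) (f 7) * σ g⁻¹ := by noncomm_ring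
        _ = σ g * (quadOp σ (f 0) (f 1) (f 2) (f 3) *
            quadOp σ (f 4) (f 5) (f 6) (f 7)) * σ g⁻¹ := by rw [hgg]; noncomm_ring
        _ = 0 := by rw [hyy, mul_zero, zero_mul]
    have hc : Commute (quadOp σ a b c d) (quadOp σ (f 0) (f 1) (f 2) (f 3)) :=
      (((hcommY a c ha hc).sub_left (hcommY a d ha hd)).sub_left (hcommY b c hb hc)).add_left
        (hcommY b d hb hd)
    rw [hc.eq, hprod]
  have hexv : ∃ v, v ≠ 0 ∧ (v.1 = 0 ∨ v.2 = 0) ∧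
      ∃ x, quadOp σ (f 0) (f 1) (f 2) (f 3) x = v := by
    by_contra! hcon
    apply hY0
    ext x
    · exact hYodd.1 x
    · by_contra hne
      exact hcon (quadOp σ (f 0) (f 1) (f 2) (f 3) (x, 0)) (fun h => hne (congrArg Prod.snd h))
        (Or.inl (hYodd.1 x)) (x, 0) rfl
    · by_contra hne
      exact hcon (quadOp σ (f 0) (f 1) (f 2) (f 3) (0, x)) (fun h => hne (congrArg Prod.fst h))
        (Or.inr (hYodd.2 x)) (0, x) rfl
    · exact hYodd.2 x
  obtain ⟨v, hv0, hvhom, x, hxv⟩ := hexv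
  have hinv : ∀ a b (y : V × V), σ (swap a b) (σ (swap a b) y) = y := fun a b y => by
    rw [← Module.End.mul_apply, ← map_mul, swap_mul_self, map_one, Module.End.one_apply]
  have hswap : ∀ a b c d, a ∉ Δ → b ∉ Δ → c ∉ Δ → d ∉ Δ → a ≠ b → a ≠ c → a ≠ d → b ≠ c →
      b ≠ d → c ≠ d → σ (swap c d) v = σ (swap a b) v := by
    intro a b c d ha hb hc hd hab hac had hbc hbd hcd
    have := LinearMap.congr_fun (hfix a b c d ha hb hc hd hab hac had hbc hbd hcd) x
    rw [Module.End.mul_apply, map_mul, Module.End.mul_apply, hxv] at this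
    rw [← hinv a b (σ (swap c d) v), this]
  obtain ⟨r, s, hrs, hr, hs⟩ := exists_ne_not_mem Δ (by omega)
  have hall : ∀ c d, c ≠ d → c ∉ Δ → d ∉ Δ → σ (swap c d) v = σ (swap r s) v := by
    intro c d hcd hc hd
    obtain ⟨a, b, hab, ha, hb⟩ := exists_ne_not_mem (Δ ∪ {c, d, r, s}) (by
      have h1 := Finset.card_union_le Δ {c, d, r, s}
      have h2 : ({c, d, r, s} : Finset Ω).card ≤ 4 := Finset.card_le_four
      omega)
    simp only [Finset.mem_union, Finset.mem_insert, Finset.mem_singleton, not_or] at ha hb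
    obtain ⟨ha, ha1, ha2, ha3, ha4⟩ := ha
    obtain ⟨hb, hb1, hb2, hb3, hb4⟩ := hb
    rw [hswap a b c d ha hb hc hd hab ha1 ha2 hb1 hb2 hcd,
      hswap a b r s ha hb hr hs hab ha3 ha4 hb3 hb4 hrs]
  have hodd := isOddOp_inducedRep ρ hτ hτ2 (Perm.sign_swap hrs)
  rw [← hσ] at hodd
  have hindep : ∀ ε : F, v + ε • σ (swap r s) v ≠ 0 := by
    intro ε h
    apply hv0
    obtain ⟨v1, v2⟩ := v
    rcases hvhom with h0 | h0 <;> dsimp only at h0 <;> subst h0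
    · have := congrArg Prod.snd h
      rw [Prod.snd_add, Prod.smul_snd, hodd.2 v2, smul_zero, add_zero] at this
      exact Prod.ext rfl this
    · have := congrArg Prod.fst h
      rw [Prod.fst_add, Prod.smul_fst, hodd.1 v1, smul_zero, add_zero] at this
      exact Prod.ext this rfl
  refine false_of_local_sign σ h2 hirrW hΩ hΔ (hindep 1) (hindep (-1)) ?_ ?_
  · intro c d hcd hc hd
    have h1 := hall c d hcd hc hd
    rw [map_add, map_smul, ← h1, hinv, one_smul, one_smul, add_comm]
  · intro c d hcd hc hd
    have h1 := hall c d hcd hc hd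
    rw [map_add, map_smul, ← h1, hinv, neg_smul, neg_smul, one_smul, one_smul]
    abel

end RepMain

end

section GraphConfig

variable {Ω : Type*} [Fintype Ω] [DecidableEq Ω]

theorem sum_compl_pair_sub_eq_zero {w : Ω → Ω → ℤ} (hsym : ∀ a b, w a b = w b a)
    (hdiag : ∀ a, w a a = 0) (hreg : ∀ a b, ∑ c, w a c = ∑ c, w b c) {a b : Ω} (hab : a ≠ b) :
    ∑ c ∈ ({a, b} : Finset Ω)ᶜ, (w a c - w b c) = 0 := by
  have h1 : ∑ c, (w a c - w b c) = 0 := by rw [Finset.sum_sub_distrib, hreg a b, sub_self]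
  rw [← Finset.sum_add_sum_compl {a, b}, Finset.sum_pair hab, hdiag, hdiag, hsym b a] at h1
  linarith

theorem exists_one_zero_of_no_twins {w : Ω → Ω → ℤ} (h01 : ∀ a b, w a b = 0 ∨ w a b = 1)
    (hsym : ∀ a b, w a b = w b a)
    (hdiag : ∀ a, w a a = 0) (hreg : ∀ a b, ∑ c, w a c = ∑ c, w b c)
    (htw : ∀ a b, a ≠ b → ∃ c, c ≠ a ∧ c ≠ b ∧ w a c ≠ w b c) {a b : Ω} (hab : a ≠ b) :
    ∃ c, c ≠ a ∧ c ≠ b ∧ w a c = 1 ∧ w b c = 0 := by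
  by_contra! hcon
  have hle : ∀ c ∈ ({a, b} : Finset Ω)ᶜ, w a c - w b c ≤ 0 := by
    intro c hc
    simp only [Finset.mem_compl, Finset.mem_insert, Finset.mem_singleton, not_or] at hc
    have := hcon c hc.1 hc.2
    rcases h01 a c with h | h <;> rcases h01 b c with h' | h' <;> simp_all
  obtain ⟨c, hca, hcb, hc⟩ := htw a b hab
  have := (Finset.sum_eq_zero_iff_of_nonpos hle).1
    (sum_compl_pair_sub_eq_zero hsym hdiag hreg hab) c (by simp [hca, hcb])
  exact hc (by linarith)

theorem exists_ne_and_subset_of_seven {ι : Type*} (S : Finset ι) (hS : 7 ≤ S.card)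
    (t : ι → Finset (Fin 4)) : ∃ e ∈ S, ∃ e' ∈ S, e ≠ e' ∧ t e ⊆ t e' := by
  classical
  by_contra! hcon
  have hinj : Set.InjOn t S := by
    intro e he e' he' h
    by_contra hne
    exact hcon e he e' he' hne h.subset
  have hanti : IsAntichain (· ⊆ ·) (SetLike.coe (S.image t)) := by
    intro x hx y hy hxy
    simp only [Finset.coe_image, Set.mem_image, SetLike.mem_coe, Finset.mem_image] at hx hy
    obtain ⟨e, he, rfl⟩ := hx
    obtain ⟨e', he', rfl⟩ := hy
    exact hcon e he e' he' fun h => hxy (by rw [h])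
  have h1 := IsAntichain.sperner hanti
  rw [Finset.card_image_of_injOn hinj] at h1
  have h2 : (Fintype.card (Fin 4)).choose (Fintype.card (Fin 4) / 2) = 6 := by decide
  omega

theorem exists_config_of_no_twins {w : Ω → Ω → ℤ} (h01 : ∀ a b, w a b = 0 ∨ w a b = 1)
    (hsym : ∀ a b, w a b = w b a)
    (hdiag : ∀ a, w a a = 0) (hreg : ∀ a b, ∑ c, w a c = ∑ c, w b c)
    (htw : ∀ a b, a ≠ b → ∃ c, c ≠ a ∧ c ≠ b ∧ w a c ≠ w b c) (hn : 24 ≤ Fintype.card Ω) :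
    ∃ f : Fin 8 → Ω, Function.Injective f ∧ secondDiff w (f 0) (f 1) (f 2) (f 3) ≠ 0 ∧
      secondDiff w (f 4) (f 5) (f 6) (f 7) ≠ 0 ∧ secondDiff w (f 0) (f 1) (f 4) (f 5) = 0 ∧
      secondDiff w (f 0) (f 1) (f 6) (f 7) = 0 := by
  by_contra! hcon
  obtain ⟨a, b, hab⟩ : ∃ a b : Ω, a ≠ b := by
    have : 1 < Fintype.card Ω := by omega
    exact Fintype.exists_pair_of_one_lt_card this
  set u : Ω → ℤ := fun c => w a c - w b c with hu
  have hsum : ∑ c ∈ ({a, b} : Finset Ω)ᶜ, u c = 0 :=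
    sum_compl_pair_sub_eq_zero hsym hdiag hreg hab
  have hND := fun {a b : Ω} (h : a ≠ b) =>
    exists_one_zero_of_no_twins h01 hsym hdiag hreg htw h
  have hu3 : ∀ c, u c = -1 ∨ u c = 0 ∨ u c = 1 := by
    intro c
    simp only [hu]
    rcases h01 a c with h | h <;> rcases h01 b c with h' | h' <;> simp [h, h']
  set cls : ℤ → Finset Ω := fun v => ({a, b} : Finset Ω)ᶜ.filter fun c => u c = v with hcls
  have hmem : ∀ v c, c ∈ cls v ↔ (c ≠ a ∧ c ≠ b) ∧ u c = v := by
    intro v c; simp [hcls]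
  obtain ⟨cp, hcp⟩ : (cls 1).Nonempty := by
    obtain ⟨c, h1, h2, h3, h4⟩ := hND hab
    exact ⟨c, (hmem _ _).2 ⟨⟨h1, h2⟩, by simp [hu, h3, h4]⟩⟩
  obtain ⟨cn, hcn⟩ : (cls (-1)).Nonempty := by
    obtain ⟨c, h1, h2, h3, h4⟩ := hND hab.symm
    exact ⟨c, (hmem _ _).2 ⟨⟨h2, h1⟩, by simp [hu, h3, h4]⟩⟩
  have hcard : (cls 1).card = (cls (-1)).card := by
    have h1 : ∀ c, u c = (if u c = 1 then 1 else 0) - (if u c = -1 then 1 else 0) := by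
      intro c
      rcases hu3 c with h | h | h <;> simp [h]
    rw [Finset.sum_congr rfl fun c _ => h1 c, Finset.sum_sub_distrib, Finset.sum_boole,
      Finset.sum_boole, sub_eq_zero] at hsum
    exact_mod_cast hsum
  obtain ⟨q, hq, hQ⟩ : ∃ q ∈ ({-1, 0, 1} : Finset ℤ), 7 < (cls q).card := by
    refine Finset.exists_lt_card_fiber_of_mul_lt_card_of_maps_to (f := u) ?_ ?_
    · intro c _
      simpa using hu3 c
    · have h1 : ({a, b} : Finset Ω).card ≤ 2 := Finset.card_le_two
      rw [Finset.card_compl]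
      have : ({-1, 0, 1} : Finset ℤ).card = 3 := by decide
      omega
  have hrep : ∀ v, ∃ c, (cls v).Nonempty → c ∈ cls v := by
    intro v
    by_cases h : (cls v).Nonempty
    · exact ⟨h.choose, fun _ => h.choose_spec⟩
    · exact ⟨a, fun h' => absurd h' h⟩
  choose rep hrep using hrep
  obtain ⟨e, he, e', he', hee, hsub⟩ := exists_ne_and_subset_of_seven ((cls q).erase (rep q))
    (by have := Finset.pred_card_le_card_erase (s := cls q) (a := rep q); omega)
    (fun e => Finset.univ.filter fun i : Fin 4 => w e (![rep (-1), rep 0, rep 1, a] i) = 1)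
  have hle : ∀ i : Fin 4, w e (![rep (-1), rep 0, rep 1, a] i) ≤
      w e' (![rep (-1), rep 0, rep 1, a] i) := by
    intro i
    have := @hsub i
    simp only [Finset.mem_filter, Finset.mem_univ, true_and] at this
    rcases h01 e (![rep (-1), rep 0, rep 1, a] i) with h | h
    · rw [h]
      rcases h01 e' (![rep (-1), rep 0, rep 1, a] i) with h' | h' <;> simp [h']
    · rw [h, this h]
  have hle_rep : ∀ c, w e (rep (u c)) ≤ w e' (rep (u c)) := by
    intro c
    rcases hu3 c with h | h | h <;> rw [h]
    · exact hle 0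
    · exact hle 1
    · exact hle 2
  have hle_a : w e a ≤ w e' a := hle 3
  rw [Finset.mem_erase, hmem] at he he'
  obtain ⟨he1, ⟨hea, heb⟩, heq⟩ := he
  obtain ⟨he1', ⟨hea', heb'⟩, heq'⟩ := he'
  have hle_b : w e b ≤ w e' b := by
    have : u e = u e' := by rw [heq, heq']
    simp only [hu] at this
    rw [hsym a e, hsym b e, hsym a e', hsym b e'] at this
    linarith
  obtain ⟨x, hxe, hxe', hx1, hx0⟩ := hND hee
  have hxa : x ≠ a := by rintro rfl; rw [hx1, hx0] at hle_a; omega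
  have hxb : x ≠ b := by rintro rfl; rw [hx1, hx0] at hle_b; omega
  have hgx := hrep (u x) ⟨x, (hmem _ _).2 ⟨⟨hxa, hxb⟩, rfl⟩⟩
  have hgle := hle_rep x
  rw [hmem] at hgx
  have hge : ∀ y, y ≠ rep q → u y = q → y ≠ rep (u x) := by
    intro y hy hyq h
    have : u x = q := by rw [← hgx.2, ← h, hyq]
    rw [this] at h
    exact hy h
  have hge1 := hge e he1 heq
  have hge2 := hge e' he1' heq'
  set g := rep (u x) with hg
  have hxg : x ≠ g := by
    intro h
    rw [← h, hx1, hx0] at hgle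
    omega
  -- two further points with different values
  have hc : ∃ c, c ∈ cls q ∧ c ∉ ({e, e', x, g} : Finset Ω) := by
    have h4 : ({e, e', x, g} : Finset Ω).card ≤ 4 := Finset.card_le_four
    by_contra! h
    have := Finset.card_le_card (s := cls q) h
    omega
  have hc' : ∃ c, (c ≠ a ∧ c ≠ b) ∧ u c ≠ q ∧ c ≠ x ∧ c ≠ g := by
    have h2 : ({x, g} : Finset Ω).card ≤ 2 := Finset.card_le_two
    have hbig : ∀ v, v ≠ q → 7 < (cls v).card →
        ∃ c, (c ≠ a ∧ c ≠ b) ∧ u c ≠ q ∧ c ≠ x ∧ c ≠ g := by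
      intro v hv hcv
      have : ∃ c, c ∈ cls v ∧ c ∉ ({x, g} : Finset Ω) := by
        by_contra! h
        have := Finset.card_le_card (s := cls v) h
        omega
      obtain ⟨c, hc, hcx⟩ := this
      rw [hmem] at hc
      simp only [Finset.mem_insert, Finset.mem_singleton, not_or] at hcx
      exact ⟨c, hc.1, by rw [hc.2]; exact hv, hcx.1, hcx.2⟩
    have hsm : ∀ c v, c ∈ cls v → v ≠ q → u x ≠ v →
        ∃ c, (c ≠ a ∧ c ≠ b) ∧ u c ≠ q ∧ c ≠ x ∧ c ≠ g := by
      intro c v hc hv hxv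
      rw [hmem] at hc
      refine ⟨c, hc.1, by rw [hc.2]; exact hv, ?_, ?_⟩
      · intro h
        exact hxv (by rw [← h]; exact hc.2)
      · rintro h
        rw [h, hgx.2] at hc
        exact hxv hc.2
    simp only [Finset.mem_insert, Finset.mem_singleton] at hq
    rcases hq with rfl | rfl | rfl
    · exact hbig 1 (by decide) (by omega)
    · by_cases h : u x = 1
      · exact hsm cn (-1) hcn (by decide) (by rw [h]; decide)
      · exact hsm cp 1 hcp (by decide) h
    · exact hbig (-1) (by decide) (by omega)
  obtain ⟨c, hc, hcn'⟩ := hc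
  obtain ⟨c', ⟨hca', hcb'⟩, hcq', hcx', hcg'⟩ := hc'
  rw [hmem] at hc
  obtain ⟨⟨hca, hcb⟩, hcq⟩ := hc
  simp only [Finset.mem_insert, Finset.mem_singleton, not_or] at hcn'
  obtain ⟨hce, hce', hcx, hcg⟩ := hcn'
  have hcc : c ≠ c' := by rintro rfl; exact hcq' hcq
  have hce1 : c' ≠ e := by rintro rfl; exact hcq' heq
  have hce2 : c' ≠ e' := by rintro rfl; exact hcq' heq'
  obtain ⟨⟨hga, hgb⟩, hgu⟩ := hgx
  refine hcon ![a, b, c, c', e, e', x, g] ?_ ?_ ?_ ?_ ?_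
  · rw [← List.nodup_ofFn]
    simp [List.ofFn_succ]
    simp only [hab, hca.symm, hca'.symm, hea.symm, hea'.symm, hxa.symm, hga.symm, hcb.symm,
      hcb'.symm, heb.symm, heb'.symm, hxb.symm, hgb.symm, hcc, hce, hce', hcx, hcg, hce1, hce2,
      hcx', hcg', hee, hxe.symm, hxe'.symm, hge1, hge2, hxg, not_false_eq_true, and_self]
  · have h : u c - u c' ≠ 0 := sub_ne_zero.2 (by rw [hcq]; exact hcq'.symm)
    intro h0
    apply h
    simp [secondDiff] at h0
    simp only [hu]
    linarith
  · intro h0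
    simp [secondDiff] at h0
    omega
  · have h : u e = u e' := by rw [heq, heq']
    simp only [hu] at h
    simp [secondDiff]
    linarith
  · simp only [hu] at hgu
    simp [secondDiff]
    linarith

end GraphConfig

section GraphConfig

theorem four_le_index_of_isSimpleGroup {G : Type*} [Group G] [Finite G] [IsSimpleGroup G]
    (hG : 6 < Nat.card G) {H : Subgroup G} (hH : H ≠ ⊤) : 4 ≤ Nat.card (G ⧸ H) := by
  by_contra! hlt
  rcases Subgroup.Normal.eq_bot_or_eq_top H.normalCore_normal with h | h
  · rw [Subgroup.normalCore_eq_ker, MonoidHom.ker_eq_bot_iff] at h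
    have h1 := Nat.card_le_card_of_injective _ h
    rw [Nat.card_perm] at h1
    have h2 : (Nat.card (G ⧸ H)).factorial ≤ Nat.factorial 3 :=
      Nat.factorial_le (by omega)
    have : Nat.factorial 3 = 6 := rfl
    omega
  · exact hH (top_le_iff.1 (h ▸ H.normalCore_le))

theorem exists_config {Ω : Type*} [Fintype Ω] [DecidableEq Ω] {G : Type*} [Group G] [Finite G]
    [IsSimpleGroup G] (hG : 6 < Nat.card G) [MulAction G Ω] [MulAction.IsPretransitive G Ω]
    (hn : 24 ≤ Fintype.card Ω) {w : Ω → Ω → ℤ} (h01 : ∀ a b, w a b = 0 ∨ w a b = 1)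
    (hsym : ∀ a b, w a b = w b a) (hdiag : ∀ a, w a a = 0)
    (hinv : ∀ (g : G) a b, w (g • a) (g • b) = w a b) (h0 : ∃ a b, a ≠ b ∧ w a b = 0)
    (h1 : ∃ a b, w a b = 1) :
    ∃ w : Ω → Ω → ℤ, (∀ a b, w a b = w b a) ∧ (∀ a, w a a = 0) ∧
      (∀ a b, w a b = 0 ∨ w a b = 1) ∧ (∀ (g : G) a b, w (g • a) (g • b) = w a b) ∧
      ∃ f : Fin 8 → Ω, Function.Injective f ∧ secondDiff w (f 0) (f 1) (f 2) (f 3) ≠ 0 ∧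
        secondDiff w (f 4) (f 5) (f 6) (f 7) ≠ 0 ∧ secondDiff w (f 0) (f 1) (f 4) (f 5) = 0 ∧
        secondDiff w (f 0) (f 1) (f 6) (f 7) = 0 := by
  by_cases htw : ∀ a b, a ≠ b → ∃ c, c ≠ a ∧ c ≠ b ∧ w a c ≠ w b c
  · refine ⟨w, hsym, hdiag, h01, hinv, exists_config_of_no_twins h01 hsym hdiag ?_ htw hn⟩
    intro a b
    obtain ⟨g, rfl⟩ := MulAction.exists_smul_eq G a b
    rw [← Equiv.sum_comp (MulAction.toPerm g) (fun c => w (g • a) c)]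
    simp [hinv]
  · classical
    push Not at htw
    obtain ⟨x, y, hxy, htwin⟩ := htw
    let tw : Ω → Ω → Prop := fun a b => ∀ c, c ≠ a → c ≠ b → w a c = w b c
    have htw_symm : ∀ {a b}, tw a b → tw b a := fun h c hc hc' => (h c hc' hc).symm
    have htw_trans : ∀ {a b c}, tw a b → tw b c → tw a c := by
      intro a b c hab hbc z hza hzc
      by_cases hzb : z = b
      · subst hzb
        by_cases hac : a = c
        · rw [hac]
        · calc w a z = w z a := hsym a z
            _ = w c a := hbc a (Ne.symm hza) hac
            _ = w a c := hsym c a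
            _ = w z c := hab c (Ne.symm hac) (Ne.symm hzc)
            _ = w c z := hsym z c
      · rw [hab z hza hzb, hbc z hzb hzc]
    have htw_refl : ∀ a, tw a a := fun a c _ _ => rfl
    have htw_inv : ∀ (g : G) a b, tw (g • a) (g • b) ↔ tw a b := by
      have key : ∀ (g : G) a b, tw a b → tw (g • a) (g • b) := by
        intro g a b h c hca hcb
        obtain ⟨c, rfl⟩ : ∃ c', g • c' = c := ⟨g⁻¹ • c, by simp⟩
        rw [hinv, hinv]
        exact h c (fun h => hca (by rw [h])) (fun h => hcb (by rw [h]))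
      intro g a b
      refine ⟨fun h => ?_, key g a b⟩
      simpa using key g⁻¹ _ _ h
    let H : Subgroup G :=
      { carrier := {g | tw x (g • x)}
        mul_mem' := fun {g h} hg hh => by
          simp only [Set.mem_ofPred_eq] at hg hh ⊢
          rw [mul_smul]
          exact htw_trans hg ((htw_inv g _ _).2 hh)
        one_mem' := by simp [htw_refl]
        inv_mem' := fun {g} hg => by
          simp only [Set.mem_ofPred_eq] at hg ⊢
          rw [← htw_inv g]
          simpa using htw_symm hg }
    have hH : H ≠ ⊤ := by
      intro h
      have hall : ∀ a b, tw a b := by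
        have : ∀ a, tw x a := fun a => by
          obtain ⟨g, rfl⟩ := MulAction.exists_smul_eq G x a
          have : g ∈ H := h ▸ Subgroup.mem_top g
          exact this
        exact fun a b => htw_trans (htw_symm (this a)) (this b)
      obtain ⟨a, b, hab, h0⟩ := h0
      obtain ⟨c, d, h1⟩ := h1
      have hcd : c ≠ d := by rintro rfl; rw [hdiag] at h1; exact absurd h1 (by decide)
      have e1 : ∀ a b c, a ≠ c → b ≠ c → w a c = w b c := fun a b c h h' =>
        hall a b c h.symm h'.symm
      have : w a b = w c d := by
        by_cases hbc : b = c
        · subst hbc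
          rw [e1 a d b hab hcd.symm, hsym]
        · rw [e1 a c b hab (Ne.symm hbc), hsym c b, hsym c d, e1 b d c hbc hcd.symm]
      omega
    have hcard := four_le_index_of_isSimpleGroup hG hH
    have := Fintype.ofFinite (G ⧸ H)
    obtain ⟨q⟩ : Nonempty (Fin 4 ↪ G ⧸ H) :=
      Function.Embedding.nonempty_of_card_le (by simpa [Nat.card_eq_fintype_card] using hcard)
    let a : Fin 4 → Ω := fun i => (q i).out • x
    let b : Fin 4 → Ω := fun i => (q i).out • y
    have hab : ∀ i, a i ≠ b i := fun i h => hxy (smul_left_cancel _ h)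
    have htab : ∀ i, tw (a i) (b i) := fun i => (htw_inv _ _ _).2 htwin
    have hta : ∀ i j, i ≠ j → ¬ tw (a i) (a j) := by
      intro i j hij h
      apply hij
      apply q.injective
      rw [← QuotientGroup.out_eq' (q i), ← QuotientGroup.out_eq' (q j)]
      rw [QuotientGroup.eq]
      change tw x (((q i).out⁻¹ * (q j).out) • x)
      rw [← htw_inv (q i).out, mul_smul, smul_inv_smul]
      exact h
    have htab' : ∀ i j, i ≠ j → ¬ tw (a i) (b j) := fun i j hij h =>
      hta i j hij (htw_trans h (htw_symm (htab j)))
    have htba : ∀ i j, i ≠ j → ¬ tw (b i) (a j) := fun i j hij h =>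
      hta i j hij (htw_trans (htab i) h)
    have htbb : ∀ i j, i ≠ j → ¬ tw (b i) (b j) := fun i j hij h =>
      htab' i j hij (htw_trans (htab i) h)
    have hne : ∀ {c d}, ¬ tw c d → c ≠ d := fun {c d} h h' => h (h' ▸ htw_refl c)
    refine ⟨fun c d => if tw c d ∧ c ≠ d then 1 else 0, ?_, ?_, ?_, ?_,
      ![a 0, a 1, b 0, b 1, a 2, a 3, b 2, b 3], ?_, ?_, ?_, ?_, ?_⟩
    · intro c d
      simp only [ne_comm (a := c) (b := d), show tw c d ↔ tw d c from ⟨htw_symm, htw_symm⟩]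
    · simp
    · intro c d
      by_cases h : tw c d ∧ c ≠ d
      · right; exact if_pos h
      · left; exact if_neg h
    · intro g c d
      simp only [htw_inv, ne_eq, smul_left_cancel_iff]
    · rw [← List.nodup_ofFn]
      simp [List.ofFn_succ]
      have n1 := fun i j (h : i ≠ j) => hne (hta i j h)
      have n2 := fun i j (h : i ≠ j) => hne (htab' i j h)
      have n3 := fun i j (h : i ≠ j) => hne (htba i j h)
      have n4 := fun i j (h : i ≠ j) => hne (htbb i j h)
      simp [n1, n2, n3, n4, hab]
    · simp [secondDiff, htab, hab, htab', hta, htba]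
    · simp [secondDiff, htab, hab, htab', hta, htba]
    · simp [secondDiff, htab, hab, htab', hta, htba]
    · simp [secondDiff, htab, hab, htab', hta, htba, htbb]

end GraphConfig

section ThreeCycles

open Equiv

variable {α : Type*} [DecidableEq α]

/-- The permutation `a ↦ b ↦ c ↦ a`. -/
def cyc3 (a b c : α) : Perm α := swap a b * swap b c

theorem cyc3_conj (g : Perm α) (a b c : α) :
    g * cyc3 a b c * g⁻¹ = cyc3 (g a) (g b) (g c) := by
  simp only [cyc3, Equiv.swap_apply_apply]
  group

theorem cyc3_apply_left {a b c : α} (hab : a ≠ b) (hac : a ≠ c) : cyc3 a b c a = b := by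
  simp [cyc3, swap_apply_of_ne_of_ne hab hac]

theorem cyc3_apply_mid {a b c : α} (hac : a ≠ c) (hbc : b ≠ c) : cyc3 a b c b = c := by
  simp [cyc3, swap_apply_of_ne_of_ne hac.symm hbc.symm]

theorem cyc3_apply_right (a b c : α) : cyc3 a b c c = a := by
  simp [cyc3]

theorem cyc3_apply_of_ne {a b c z : α} (ha : z ≠ a) (hb : z ≠ b) (hc : z ≠ c) :
    cyc3 a b c z = z := by
  simp [cyc3, swap_apply_of_ne_of_ne hb hc, swap_apply_of_ne_of_ne ha hb]

theorem cyc3_rotate {a b c : α} (hab : a ≠ b) (hac : a ≠ c) (hbc : b ≠ c) :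
    cyc3 b c a = cyc3 a b c := by
  ext z
  by_cases hza : z = a
  · rw [hza, cyc3_apply_right, cyc3_apply_left hab hac]
  by_cases hzb : z = b
  · rw [hzb, cyc3_apply_left hbc hab.symm, cyc3_apply_mid hac hbc]
  by_cases hzc : z = c
  · rw [hzc, cyc3_apply_mid hab.symm hac.symm, cyc3_apply_right]
  rw [cyc3_apply_of_ne hza hzb hzc, cyc3_apply_of_ne hzb hzc hza]

theorem cyc3_inv {a b c : α} (hab : a ≠ b) (hac : a ≠ c) (hbc : b ≠ c) :
    (cyc3 a b c)⁻¹ = cyc3 b a c := by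
  rw [cyc3_rotate hbc.symm hac.symm hab.symm, cyc3, cyc3, mul_inv_rev, swap_inv, swap_inv,
    swap_comm b c, swap_comm a b]

theorem cyc3_mem_alternatingGroup [Fintype α] {a b c : α} (hab : a ≠ b) (hbc : b ≠ c) :
    cyc3 a b c ∈ alternatingGroup α := by
  simp [cyc3, Perm.mem_alternatingGroup, hab, hbc]

theorem commutator_eq_cyc3 {f g : Perm α} {x : α} (hf : f x ≠ x) (hg : g x ≠ x)
    (h : ∀ y, y ≠ x → f y = y ∨ g y = y) :
    f * g * f⁻¹ * g⁻¹ = cyc3 x (f x) (g x) ∧ f x ≠ g x := by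
  have hfg : f (g x) = g x := (h _ hg).resolve_right fun h => hg (g.injective h)
  have hgf : g (f x) = f x := (h _ hf).resolve_left fun h => hf (f.injective h)
  have hne : f x ≠ g x := fun h => hf (g.injective (hgf.trans h))
  refine ⟨?_, hne⟩
  suffices f * g = cyc3 x (f x) (g x) * (g * f) by rw [this]; group
  ext z
  simp only [Perm.mul_apply]
  by_cases hzx : z = x
  · rw [hzx, hfg, hgf, cyc3_apply_mid hg.symm hne]
  rcases h z hzx with hz | hz
  · rw [hz]
    by_cases hgz : g z = x
    · rw [hgz, cyc3_apply_left hf.symm hg.symm]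
    · rw [cyc3_apply_of_ne hgz ?_ (fun h => hzx (g.injective h))]
      · rcases h _ hgz with h1 | h1
        · exact h1
        · rw [g.injective h1, hz]
      · intro h1
        have : z = f x := g.injective (h1.trans hgf.symm)
        rw [this] at hz
        exact hf (f.injective hz)
  · rw [hz]
    by_cases hfz : f z = x
    · rw [hfz, cyc3_apply_right]
    · have h1 : g (f z) = f z := by
        rcases h _ hfz with h1 | h1
        · rw [f.injective h1, hz]
        · exact h1
      rw [h1, cyc3_apply_of_ne hfz (fun h => hzx (f.injective h))]
      intro h2
      have : z = g x := f.injective (h2.trans hfg.symm)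
      rw [this] at hz
      exact hg (g.injective hz)

theorem exists_large_trivial_of_no_cyc3 [Fintype α] (K : Subgroup (Perm α))
    (hK : ∀ a b c, a ≠ b → a ≠ c → b ≠ c → cyc3 a b c ∉ K) :
    ∃ Δ : Finset α, Fintype.card α ≤ 2 * Δ.card ∧
      ∀ g ∈ K, (∀ y, y ∉ Δ → g y = y) → g = 1 := by
  classical
  obtain ⟨Δ, hΔ, hmax⟩ := Finset.exists_max_image
    (Finset.univ.filter fun Δ : Finset α => ∀ g ∈ K, (∀ y, y ∉ Δ → g y = y) → g = 1)
    Finset.card ⟨∅, by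
      simp only [Finset.mem_filter, Finset.mem_univ, true_and]
      exact fun g _ h => Perm.ext fun y => h y (Finset.notMem_empty y)⟩
  simp only [Finset.mem_filter, Finset.mem_univ, true_and] at hΔ hmax
  refine ⟨Δ, ?_, hΔ⟩
  by_contra! hlt
  have h1 : Δ.card < Δᶜ.card := by rw [Finset.card_compl]; omega
  have h2 : ∃ g ∈ K, (∀ y, y ∉ Δᶜ → g y = y) ∧ g ≠ 1 := by
    by_contra! h
    exact absurd (hmax Δᶜ h) (by omega)
  obtain ⟨f, hfK, hf, hf1⟩ := h2
  obtain ⟨x, hx⟩ : ∃ x, f x ≠ x := by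
    by_contra! h
    exact hf1 (Perm.ext h)
  have hxΔ : x ∉ Δ := fun h => hx (hf x (by simpa using h))
  have h3 : ∃ g ∈ K, (∀ y, y ∉ insert x Δ → g y = y) ∧ g ≠ 1 := by
    by_contra! h
    have := hmax (insert x Δ) h
    rw [Finset.card_insert_of_notMem hxΔ] at this
    omega
  obtain ⟨g, hgK, hg, hg1⟩ := h3
  have hgx : g x ≠ x := by
    intro h
    refine hg1 (hΔ g hgK fun y hy => ?_)
    by_cases hyx : y = x
    · rw [hyx, h]
    · exact hg y (by simp [hyx, hy])
  obtain ⟨h4, h5⟩ := commutator_eq_cyc3 hx hgx fun y hy => by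
    by_cases hyΔ : y ∈ Δ
    · exact Or.inl (hf y (by simpa using hyΔ))
    · exact Or.inr (hg y (by simp [hy, hyΔ]))
  refine hK x (f x) (g x) hx.symm hgx.symm h5 ?_
  rw [← h4]
  exact K.mul_mem (K.mul_mem (K.mul_mem hfK hgK) (K.inv_mem hfK)) (K.inv_mem hgK)

/-- Two points are linked by `K` if they are equal or lie on a common three-cycle in `K`. -/
def Cyc3Rel (K : Subgroup (Perm α)) (a b : α) : Prop :=
  a = b ∨ ∃ c, a ≠ b ∧ a ≠ c ∧ b ≠ c ∧ cyc3 a b c ∈ K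

variable {K : Subgroup (Perm α)}

theorem Cyc3Rel.refl (a : α) : Cyc3Rel K a a := Or.inl rfl

theorem Cyc3Rel.symm {a b : α} (h : Cyc3Rel K a b) : Cyc3Rel K b a := by
  rcases h with rfl | ⟨c, hab, hac, hbc, h⟩
  · exact Cyc3Rel.refl _
  · refine Or.inr ⟨c, hab.symm, hbc, hac, ?_⟩
    rw [← cyc3_inv hab hac hbc]
    exact K.inv_mem h

theorem Cyc3Rel.trans {a b d : α} (h : Cyc3Rel K a b) (h' : Cyc3Rel K b d) :
    Cyc3Rel K a d := by
  rcases h with rfl | ⟨c, hab, hac, hbc, h⟩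
  · exact h'
  rcases h' with rfl | ⟨e, hbd, hbe, hde, h'⟩
  · exact Or.inr ⟨c, hab, hac, hbc, h⟩
  by_cases had : a = d
  · exact Or.inl had
  by_cases hae : a = e
  · subst hae
    refine Or.inr ⟨b, had, hab, hbd.symm, ?_⟩
    rw [← cyc3_rotate had hab hbd.symm, ← cyc3_inv hbd hbe hde]
    exact K.inv_mem h'
  · refine Or.inr ⟨cyc3 b d e c, had, ?_, ?_, ?_⟩
    · intro h1
      have : cyc3 b d e a = cyc3 b d e c := by rw [cyc3_apply_of_ne hab had hae, ← h1]
      exact hac ((cyc3 b d e).injective this)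
    · intro h1
      have : cyc3 b d e b = cyc3 b d e c := by rw [cyc3_apply_left hbd hbe, ← h1]
      exact hbc ((cyc3 b d e).injective this)
    · have := K.mul_mem (K.mul_mem h' h) (K.inv_mem h')
      rwa [cyc3_conj, cyc3_apply_of_ne hab had hae, cyc3_apply_left hbd hbe] at this

theorem Cyc3Rel.map {a b : α} (h : Cyc3Rel K a b) {g : Perm α} (hg : g ∈ K) :
    Cyc3Rel K (g a) (g b) := by
  rcases h with rfl | ⟨c, hab, hac, hbc, h⟩
  · exact Cyc3Rel.refl _
  · refine Or.inr ⟨g c, g.injective.ne hab, g.injective.ne hac, g.injective.ne hbc, ?_⟩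
    rw [← cyc3_conj]
    exact K.mul_mem (K.mul_mem hg h) (K.inv_mem hg)

theorem Cyc3Rel.map_iff {a b : α} {g : Perm α} (hg : g ∈ K) :
    Cyc3Rel K (g a) (g b) ↔ Cyc3Rel K a b := by
  refine ⟨fun h => ?_, fun h => h.map hg⟩
  simpa using h.map (K.inv_mem hg)

theorem cyc3_mem_of_rel {a b c : α} (hab : a ≠ b) (hac : a ≠ c) (hbc : b ≠ c)
    (h : Cyc3Rel K a b) (h' : Cyc3Rel K b c) : cyc3 a b c ∈ K := by
  rcases id h with rfl | ⟨x, -, hax, hbx, hx⟩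
  · exact absurd rfl hab
  by_cases hxc : x = c
  · rwa [← hxc]
  have hbx' : Cyc3Rel K b x := Or.inr ⟨a, hbx, hab.symm, hax.symm, by
    rwa [cyc3_rotate hab hax hbx]⟩
  rcases (hbx'.symm.trans h') with rfl | ⟨y, -, hxy, hcy, hy⟩
  · exact absurd rfl hxc
  by_cases hya : y = a
  · subst hya
    have := K.mul_mem (K.mul_mem (K.inv_mem hy) hx) (K.inv_mem (K.inv_mem hy))
    rw [cyc3_conj, cyc3_inv hxc hxy hcy, cyc3_apply_right,
      cyc3_apply_of_ne hbc hbx hab.symm, cyc3_apply_mid hcy hxy] at this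
    rw [← inv_mem_iff, cyc3_inv hab hac hbc, cyc3_rotate hbc.symm hac.symm hab.symm]
    exact this
  by_cases hyb : y = b
  · subst hyb
    have := K.mul_mem (K.mul_mem (K.inv_mem hy) hx) (K.inv_mem (K.inv_mem hy))
    rw [cyc3_conj, cyc3_inv hxc hxy hcy, cyc3_apply_right,
      cyc3_apply_of_ne hac hax hab, cyc3_apply_mid hcy hxy] at this
    rw [← inv_mem_iff, cyc3_inv hab hac hbc, ← cyc3_rotate hab.symm hbc hac]
    exact this
  · have := K.mul_mem (K.mul_mem hy hx) (K.inv_mem hy)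
    rwa [cyc3_conj, cyc3_apply_left hxc hxy, cyc3_apply_of_ne hax hac (Ne.symm hya),
      cyc3_apply_of_ne hbx hbc (Ne.symm hyb)] at this

end ThreeCycles

section PermStabilizer

open Equiv

variable {α Ω : Type*} [Fintype α] [DecidableEq α] [Fintype Ω]
  [MulAction (alternatingGroup α) Ω]

/-- The stabilizer of a point, as a group of permutations. -/
def permStabilizer (α : Type*) {Ω : Type*} [Fintype α] [DecidableEq α]
    [MulAction (alternatingGroup α) Ω] (x : Ω) : Subgroup (Perm α) :=
  (MulAction.stabilizer (alternatingGroup α) x).map (alternatingGroup α).subtype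

theorem mem_permStabilizer {x : Ω} {g : Perm α} :
    g ∈ permStabilizer α x ↔
      ∃ h : g ∈ alternatingGroup α, (⟨g, h⟩ : alternatingGroup α) • x = x := by
  simp only [permStabilizer, Subgroup.mem_map, MulAction.mem_stabilizer_iff]
  constructor
  · rintro ⟨g, hg, rfl⟩
    exact ⟨g.2, hg⟩
  · rintro ⟨h, hg⟩
    exact ⟨⟨g, h⟩, hg, rfl⟩

theorem coe_mem_permStabilizer {x : Ω} {g : alternatingGroup α} :
    (g : Perm α) ∈ permStabilizer α x ↔ g • x = x := by
  rw [mem_permStabilizer]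
  exact ⟨fun ⟨_, h⟩ => h, fun h => ⟨g.2, h⟩⟩

theorem card_mul_card_permStabilizer [MulAction.IsPretransitive (alternatingGroup α) Ω] (x : Ω) :
    Fintype.card Ω * Nat.card (permStabilizer α x) = Nat.card (alternatingGroup α) := by
  rw [permStabilizer, Subgroup.card_map_of_injective (Subgroup.subtype_injective _),
    ← Nat.card_eq_fintype_card, ← MulAction.index_stabilizer_of_transitive (alternatingGroup α) x]
  exact Subgroup.index_mul_card _

theorem two_mul_card_alternatingGroup_finset {Δ : Finset α} (h : 2 ≤ Δ.card) :
    2 * Nat.card (alternatingGroup Δ) = Δ.card.factorial := by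
  have : Nontrivial Δ := by
    rw [← Fintype.one_lt_card_iff_nontrivial, Fintype.card_coe]
    omega
  rw [Nat.card_eq_fintype_card, two_mul_card_alternatingGroup, Fintype.card_perm,
    Fintype.card_coe]

theorem exists_factorial_le_of_no_cyc3 (h4 : 4 ≤ Fintype.card α) {x : Ω}
    (hK : ∀ a b c, a ≠ b → a ≠ c → b ≠ c → cyc3 a b c ∉ permStabilizer α x) :
    ∃ k, Fintype.card α ≤ 2 * k ∧ k.factorial ≤ 2 * Fintype.card Ω := by
  obtain ⟨Δ, hΔ, htriv⟩ := exists_large_trivial_of_no_cyc3 _ hK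
  refine ⟨Δ.card, hΔ, ?_⟩
  rw [← two_mul_card_alternatingGroup_finset (by omega), ← Nat.card_eq_fintype_card]
  refine Nat.mul_le_mul_left 2 (Nat.card_le_card_of_injective
    (fun g : alternatingGroup Δ => alternatingGroup.ofSubtype Δ g • x) ?_)
  intro g g' h
  simp only at h
  have h1 : (((alternatingGroup.ofSubtype Δ (g⁻¹ * g')) : alternatingGroup α) : Perm α) ∈
      permStabilizer α x := by
    rw [coe_mem_permStabilizer, map_mul, map_inv, mul_smul, ← h, inv_smul_smul]
  have h2 := htriv _ h1 fun y hy => by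
    rw [alternatingGroup.coe_ofSubtype]
    exact Perm.ofSubtype_apply_of_not_mem _ hy
  have h3 : alternatingGroup.ofSubtype Δ (g⁻¹ * g') = 1 := Subtype.ext h2
  rw [← map_one (alternatingGroup.ofSubtype Δ)] at h3
  have h4 := alternatingGroup.ofSubtype_injective h3
  exact inv_mul_eq_one.1 h4

open Classical in
/-- The set of points linked to a given one. -/
noncomputable def cyc3Class (K : Subgroup (Perm α)) (a : α) : Finset α :=
  Finset.univ.filter (Cyc3Rel K a)

theorem mem_cyc3Class {K : Subgroup (Perm α)} {a b : α} : b ∈ cyc3Class K a ↔ Cyc3Rel K a b := by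
  simp [cyc3Class]

theorem cyc3Class_eq_of_mem {K : Subgroup (Perm α)} {a b c : α} (h : c ∈ cyc3Class K a)
    (h' : c ∈ cyc3Class K b) : cyc3Class K a = cyc3Class K b := by
  rw [mem_cyc3Class] at h h'
  ext d
  rw [mem_cyc3Class, mem_cyc3Class]
  exact ⟨fun hd => h'.trans (h.symm.trans hd), fun hd => h.trans (h'.symm.trans hd)⟩

theorem map_cyc3Class {K : Subgroup (Perm α)} {g : Perm α} (hg : g ∈ K) (a : α) :
    (cyc3Class K a).map g.toEmbedding = cyc3Class K (g a) := by
  ext b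
  rw [Finset.mem_map_equiv, mem_cyc3Class, mem_cyc3Class, ← Cyc3Rel.map_iff hg]
  simp

theorem ofSubtype_mem_of_cyc3_mem {K : Subgroup (Perm α)} {Γ : Finset α}
    (h : ∀ a ∈ Γ, ∀ b ∈ Γ, ∀ c ∈ Γ, a ≠ b → a ≠ c → b ≠ c → cyc3 a b c ∈ K)
    (g : alternatingGroup Γ) : Perm.ofSubtype (g : Perm Γ) ∈ K := by
  have : alternatingGroup Γ ≤ K.comap Perm.ofSubtype := by
    rw [← Perm.closure_three_cycles_eq_alternating, Subgroup.closure_le]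
    intro σ hσ
    rw [Set.mem_ofPred_eq] at hσ
    obtain ⟨a, ha⟩ : ∃ a, a ∈ σ.support := by
      by_contra! h0
      exact hσ.ne_one (Perm.support_eq_empty_iff.1 (Finset.eq_empty_of_forall_notMem h0))
    have h1 := hσ.eq_swap_mul_swap_iff_mem_support.2 ha
    have h2 := hσ.nodup_iff_mem_support.2 ha
    simp only [List.nodup_cons, List.mem_cons, List.not_mem_nil, or_false, not_or,
      List.nodup_nil, and_true, not_false_eq_true] at h2
    obtain ⟨⟨hab, hac⟩, hbc⟩ := h2
    have := h a a.2 (σ a) (σ a).2 (σ (σ a)) (σ (σ a)).2 (Subtype.coe_ne_coe.2 hab)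
      (Subtype.coe_ne_coe.2 hac) (Subtype.coe_ne_coe.2 hbc)
    rw [SetLike.mem_coe, Subgroup.mem_comap, h1, map_mul, Perm.ofSubtype_swap_eq,
      Perm.ofSubtype_swap_eq]
    exact this
  exact this g.2

theorem card_cyc3Class_add_two_le [MulAction.IsPretransitive (alternatingGroup α) Ω]
    (h4 : 4 ≤ Fintype.card α) (hn : Fintype.card α < Fintype.card Ω) (x : Ω) (a : α) :
    (cyc3Class (permStabilizer α x) a).card + 2 ≤ Fintype.card α := by
  by_contra! hlt
  set K := permStabilizer α x
  set Γ := cyc3Class K a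
  have h1 : Nat.card (alternatingGroup Γ) ≤ Nat.card K := by
    refine Nat.card_le_card_of_injective
      (fun g => (⟨Perm.ofSubtype (g : Perm Γ), ofSubtype_mem_of_cyc3_mem ?_ g⟩ : K)) ?_
    · intro b hb c hc d hd hbc hbd hcd
      rw [mem_cyc3Class] at hb hc hd
      exact cyc3_mem_of_rel hbc hbd hcd (hb.symm.trans hc) (hc.symm.trans hd)
    · intro g g' h
      exact Subtype.ext (Perm.ofSubtype_injective (congrArg Subtype.val h))
  have h2 := two_mul_card_alternatingGroup_finset (Δ := Γ) (by omega)
  have h3 := card_mul_card_permStabilizer (α := α) x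
  have : Nontrivial α := by
    rw [← Fintype.one_lt_card_iff_nontrivial]
    omega
  have h5 : 2 * Nat.card (alternatingGroup α) = (Fintype.card α).factorial := by
    rw [Nat.card_eq_fintype_card, two_mul_card_alternatingGroup, Fintype.card_perm]
  obtain ⟨m, hm⟩ : ∃ m, Fintype.card α = m + 1 := ⟨Fintype.card α - 1, by omega⟩
  have h6 : m.factorial ≤ 2 * Nat.card K := by
    refine le_trans (Nat.factorial_le (by omega)) (h2.symm.le.trans ?_)
    omega
  rw [hm, Nat.factorial_succ, ← h3] at h5
  have h7 : 0 < Nat.card K := Nat.card_pos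
  have : (m + 1) * m.factorial ≤ (m + 1) * (2 * Nat.card K) := Nat.mul_le_mul_left _ h6
  have h8 : (m + 1 + 1) * Nat.card K ≤ Fintype.card Ω * Nat.card K :=
    Nat.mul_le_mul_right _ (by omega)
  nlinarith

theorem exists_even_map_eq {Γ S : Finset α} (h : Γ.card = S.card) (h2 : 2 ≤ Γ.card) :
    ∃ g : alternatingGroup α, Γ.map (g : Perm α).toEmbedding = S := by
  obtain ⟨g, hg⟩ := exists_perm_map_injective (Ω := α) (f := fun i : Γ => (i : α))
    (f' := fun i => ((Finset.equivOfCardEq h i : S) : α)) Subtype.val_injective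
    (Subtype.val_injective.comp (Equiv.injective _))
  have hgΓ : Γ.map g.toEmbedding = S := by
    refine Finset.eq_of_subset_of_card_le ?_ (by rw [Finset.card_map, h])
    intro y hy
    obtain ⟨z, hz, rfl⟩ := Finset.mem_map.1 hy
    change g z ∈ S
    rw [hg ⟨z, hz⟩]
    exact Subtype.property _
  rcases Int.units_eq_one_or (Perm.sign g) with hs | hs
  · exact ⟨⟨g, hs⟩, hgΓ⟩
  · obtain ⟨a, ha, b, hb, hab⟩ := Finset.one_lt_card.1 h2
    refine ⟨⟨g * swap a b, ?_⟩, ?_⟩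
    · rw [Perm.mem_alternatingGroup, map_mul, hs, Perm.sign_swap hab]
      rfl
    · rw [← hgΓ]
      ext z
      simp only [Finset.mem_map_equiv]
      change (g * swap a b)⁻¹ z ∈ Γ ↔ g⁻¹ z ∈ Γ
      rw [mul_inv_rev, swap_inv, Perm.mul_apply]
      generalize g⁻¹ z = u
      by_cases hua : u = a
      · simp [hua, ha, hb]
      by_cases hub : u = b
      · simp [hub, ha, hb]
      rw [swap_apply_of_ne_of_ne hua hub]

theorem smul_eq_smul_iff_mem_permStabilizer {x : Ω} {g g' : alternatingGroup α} :
    g • x = g' • x ↔ ((g⁻¹ * g' : alternatingGroup α) : Perm α) ∈ permStabilizer α x := by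
  rw [coe_mem_permStabilizer, mul_smul, inv_smul_eq_iff, eq_comm]

theorem twentyEight_le_choose {N j : ℕ} (hN : 8 ≤ N) (hj : 2 ≤ j) (hjN : j + 2 ≤ N) :
    28 ≤ N.choose j := by
  induction N, hN using Nat.le_induction generalizing j with
  | base =>
    have : j ≤ 6 := by omega
    interval_cases j <;> decide
  | succ N hN ih =>
    obtain ⟨i, rfl⟩ : ∃ i, j = i + 1 := ⟨j - 1, by omega⟩
    rw [Nat.choose_succ_succ]
    by_cases h : i + 1 + 2 ≤ N
    · exact (ih hj h).trans (Nat.le_add_left _ _)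
    · exact (ih (j := i) (by omega) (by omega)).trans (Nat.le_add_right _ _)

theorem twentyEight_le_card_of_cyc3Class [MulAction.IsPretransitive (alternatingGroup α) Ω]
    (h9 : 9 ≤ Fintype.card α) (hn : Fintype.card α < Fintype.card Ω) (x : Ω) (a : α)
    (h3 : 3 ≤ (cyc3Class (permStabilizer α x) a).card) : 28 ≤ Fintype.card Ω := by
  have hle := card_cyc3Class_add_two_le (by omega) hn x a
  set Γ := cyc3Class (permStabilizer α x) a with hΓ
  have hcard : ∀ T : Finset {y // y ≠ a}, T.card = Γ.card - 1 →
      Γ.card = (insert a (T.map (Function.Embedding.subtype _))).card := by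
    intro T hT
    rw [Finset.card_insert_of_notMem (by simp), Finset.card_map, hT]
    omega
  have hex : ∀ T : {T : Finset {y // y ≠ a} // T.card = Γ.card - 1},
      ∃ g : alternatingGroup α, Γ.map (g : Perm α).toEmbedding =
        insert a (T.1.map (Function.Embedding.subtype _)) :=
    fun T => exists_even_map_eq (hcard T.1 T.2) (by omega)
  choose g hg using hex
  have hinj : Function.Injective (fun T => g T • x) := by
    intro T T' h
    simp only at h
    rw [smul_eq_smul_iff_mem_permStabilizer] at h
    have key : ∀ z, (((g T)⁻¹ * g T' : alternatingGroup α) : Perm α) ((g T' : Perm α)⁻¹ z) =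
        (g T : Perm α)⁻¹ z := by
      intro z
      simp
    have hmem : ∀ T z, (g T : Perm α)⁻¹ z ∈ Γ ↔
        z ∈ insert a (T.1.map (Function.Embedding.subtype _)) := by
      intro T z
      rw [← hg T, Finset.mem_map_equiv]
      rfl
    have h1 := map_cyc3Class h a
    have hu : (g T : Perm α)⁻¹ a ∈ Γ := (hmem T a).2 (Finset.mem_insert_self _ _)
    have hv : (g T' : Perm α)⁻¹ a ∈ Γ := (hmem T' a).2 (Finset.mem_insert_self _ _)
    have h2 := Finset.mem_map_of_mem
      (((g T)⁻¹ * g T' : alternatingGroup α) : Perm α).toEmbedding hv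
    rw [Equiv.coe_toEmbedding, key, h1] at h2
    rw [← cyc3Class_eq_of_mem hu h2] at h1
    have h5 : ∀ z, z ∈ insert a (T.1.map (Function.Embedding.subtype _)) ↔
        z ∈ insert a (T'.1.map (Function.Embedding.subtype _)) := by
      intro z
      rw [← hmem, ← hmem, ← key]
      change _ ∈ cyc3Class (permStabilizer α x) a ↔ _
      rw [← h1, Finset.mem_map_equiv, Equiv.symm_apply_apply]
    refine Subtype.ext (Finset.ext fun y => ?_)
    simpa [y.2] using h5 y
  have h4 := Fintype.card_le_of_injective _ hinj
  rw [Fintype.card_finset_len] at h4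
  refine (twentyEight_le_choose ?_ ?_ ?_).trans h4
  · simp
    omega
  · omega
  · simp
    omega

end PermStabilizer

section NotTwoTransitive

open Equiv

variable {α Ω : Type*} [Fintype α] [DecidableEq α] [Fintype Ω]
  [MulAction (alternatingGroup α) Ω]

theorem card_map_cyc3_sdiff_le_one {a b c : α} (hab : a ≠ b) (hac : a ≠ c) (hbc : b ≠ c)
    (Γ : Finset α) : (Γ.map (cyc3 a b c).toEmbedding \ Γ).card ≤ 1 := by
  rw [Finset.card_le_one]
  intro y hy y' hy'
  simp only [Finset.mem_sdiff, Finset.mem_map, Equiv.coe_toEmbedding] at hy hy'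
  obtain ⟨⟨z, hz, rfl⟩, hy⟩ := hy
  obtain ⟨⟨z', hz', rfl⟩, hy'⟩ := hy'
  have key : ∀ z ∈ Γ, cyc3 a b c z ∉ Γ → z = a ∧ b ∉ Γ ∨ z = b ∧ c ∉ Γ ∨ z = c ∧ a ∉ Γ := by
    intro z hz hy
    by_cases hza : z = a
    · rw [hza, cyc3_apply_left hab hac] at hy
      exact Or.inl ⟨hza, hy⟩
    by_cases hzb : z = b
    · rw [hzb, cyc3_apply_mid hac hbc] at hy
      exact Or.inr (Or.inl ⟨hzb, hy⟩)
    by_cases hzc : z = c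
    · rw [hzc, cyc3_apply_right] at hy
      exact Or.inr (Or.inr ⟨hzc, hy⟩)
    · rw [cyc3_apply_of_ne hza hzb hzc] at hy
      exact absurd hz hy
  rcases key z hz hy with ⟨rfl, h⟩ | ⟨rfl, h⟩ | ⟨rfl, h⟩ <;>
    rcases key z' hz' hy' with ⟨rfl, h'⟩ | ⟨rfl, h'⟩ | ⟨rfl, h'⟩ <;>
    first | rfl | exact absurd ‹_› h | exact absurd ‹_› h'

theorem mem_cyc3Class_self (K : Subgroup (Perm α)) (a : α) : a ∈ cyc3Class K a :=
  mem_cyc3Class.2 (Cyc3Rel.refl a)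

theorem exists_sparse_finset {K : Subgroup (Perm α)} (h9 : 9 ≤ Fintype.card α) {a : α}
    (h3 : 3 ≤ (cyc3Class K a).card) (hle : (cyc3Class K a).card + 2 ≤ Fintype.card α)
    (hmax : ∀ b, (cyc3Class K b).card ≤ (cyc3Class K a).card) :
    ∃ Y : Finset α, Y.card = (cyc3Class K a).card ∧
      ∀ b, (Y ∩ cyc3Class K b).card + 2 ≤ (cyc3Class K a).card := by
  set Γ := cyc3Class K a with hΓ
  have hdisj : ∀ b c, c ∉ cyc3Class K b → ∀ d, d ∈ cyc3Class K b → d ∉ cyc3Class K c := by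
    intro b c hc d hd hd'
    rw [cyc3Class_eq_of_mem hd hd'] at hc
    exact hc (mem_cyc3Class_self K c)
  by_cases h4 : 4 ≤ Γ.card
  · obtain ⟨S, hS, hScard⟩ := Finset.exists_subset_card_eq (show Γ.card - 2 ≤ Γ.card by omega)
    obtain ⟨T, hT, hTcard⟩ := Finset.exists_subset_card_eq
      (show 2 ≤ Γᶜ.card by rw [Finset.card_compl]; omega)
    have hST : Disjoint S T := by
      rw [Finset.disjoint_left]
      intro z hz hz'
      exact Finset.mem_compl.1 (hT hz') (hS hz)
    refine ⟨S ∪ T, ?_, fun b => ?_⟩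
    · rw [Finset.card_union_of_disjoint hST, hScard, hTcard]
      omega
    · by_cases hb : b ∈ Γ
      · rw [← cyc3Class_eq_of_mem hb (mem_cyc3Class_self K b), ← hΓ]
        have : (S ∪ T) ∩ Γ ⊆ S := by
          intro z hz
          rw [Finset.mem_inter, Finset.mem_union] at hz
          exact hz.1.resolve_right fun h => Finset.mem_compl.1 (hT h) hz.2
        have := Finset.card_le_card this
        omega
      · have : (S ∪ T) ∩ cyc3Class K b ⊆ T := by
          intro z hz
          rw [Finset.mem_inter, Finset.mem_union] at hz
          exact hz.1.resolve_left fun h => hdisj a b hb z (hS h) hz.2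
        have := Finset.card_le_card this
        omega
  · have hΓ3 : Γ.card = 3 := by omega
    obtain ⟨y, -, hy⟩ : ∃ y ∈ (Finset.univ : Finset α), y ∉ Γ :=
      Finset.exists_mem_notMem_of_card_lt_card (by rw [Finset.card_univ]; omega)
    obtain ⟨z, -, hz⟩ : ∃ z ∈ (Finset.univ : Finset α), z ∉ Γ ∪ cyc3Class K y := by
      refine Finset.exists_mem_notMem_of_card_lt_card ?_
      rw [Finset.card_univ]
      have := Finset.card_union_le Γ (cyc3Class K y)
      have := hmax y
      omega
    rw [Finset.mem_union, not_or] at hz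
    have hay : a ≠ y := fun h => hy (h ▸ mem_cyc3Class_self K a)
    have haz : a ≠ z := fun h => hz.1 (h ▸ mem_cyc3Class_self K a)
    have hyz : y ≠ z := fun h => hz.2 (h ▸ mem_cyc3Class_self K y)
    refine ⟨{a, y, z}, ?_, fun b => ?_⟩
    · rw [hΓ3, Finset.card_eq_three]
      exact ⟨a, y, z, hay, haz, hyz, rfl⟩
    · suffices ({a, y, z} ∩ cyc3Class K b).card ≤ 1 by omega
      rw [mem_cyc3Class] at hy
      rw [mem_cyc3Class, mem_cyc3Class] at hz
      rw [Finset.card_le_one]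
      intro u hu v hv
      rw [Finset.mem_inter, mem_cyc3Class] at hu hv
      have huv : Cyc3Rel K u v := hu.2.symm.trans hv.2
      have hvu := huv.symm
      simp only [Finset.mem_insert, Finset.mem_singleton] at hu hv
      rcases hu.1 with rfl | rfl | rfl <;> rcases hv.1 with rfl | rfl | rfl <;>
        first | rfl | exact absurd huv hy | exact absurd hvu hy | exact absurd huv hz.1 |
          exact absurd hvu hz.1 | exact absurd huv hz.2 | exact absurd hvu hz.2

theorem three_le_card_cyc3Class {K : Subgroup (Perm α)} {a b c : α} (hab : a ≠ b) (hac : a ≠ c)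
    (hbc : b ≠ c) (h : cyc3 a b c ∈ K) : 3 ≤ (cyc3Class K a).card := by
  have h1 : ({a, b, c} : Finset α).card = 3 := Finset.card_eq_three.2 ⟨a, b, c, hab, hac, hbc, rfl⟩
  rw [← h1]
  apply Finset.card_le_card
  intro z hz
  rw [mem_cyc3Class]
  simp only [Finset.mem_insert, Finset.mem_singleton] at hz
  rcases hz with rfl | rfl | rfl
  · exact Cyc3Rel.refl _
  · exact Or.inr ⟨c, hab, hac, hbc, h⟩
  · refine Or.inr ⟨b, hac, hab, hbc.symm, ?_⟩
    rw [← inv_mem_iff, cyc3_inv hac hab hbc.symm, ← cyc3_rotate hac.symm hbc.symm hab]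
    exact h

theorem not_two_transitive_of_cyc3_mem [MulAction.IsPretransitive (alternatingGroup α) Ω]
    (h9 : 9 ≤ Fintype.card α) (hn : Fintype.card α < Fintype.card Ω) (x : Ω) {a b c : α}
    (hab : a ≠ b) (hac : a ≠ c) (hbc : b ≠ c) (habc : cyc3 a b c ∈ permStabilizer α x)
    (h2 : ∀ z ≠ x, ∀ z' ≠ x, ∃ g : alternatingGroup α, g • x = x ∧ g • z = z') : False := by
  set K := permStabilizer α x with hK
  obtain ⟨d, -, hmax⟩ := Finset.exists_max_image Finset.univ (fun d => (cyc3Class K d).card)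
    ⟨a, Finset.mem_univ a⟩
  have h3 : 3 ≤ (cyc3Class K d).card :=
    (three_le_card_cyc3Class hab hac hbc habc).trans (hmax a (Finset.mem_univ a))
  have hle : (cyc3Class K d).card + 2 ≤ Fintype.card α :=
    card_cyc3Class_add_two_le (by omega) hn x d
  obtain ⟨Y, hY, hsparse⟩ := exists_sparse_finset h9 h3 hle fun b => hmax b (Finset.mem_univ b)
  obtain ⟨g, hg⟩ := exists_even_map_eq hY.symm (by omega)
  obtain ⟨e, -, he⟩ : ∃ e ∈ (Finset.univ : Finset α), e ∉ cyc3Class K d :=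
    Finset.exists_mem_notMem_of_card_lt_card (by rw [Finset.card_univ]; omega)
  have hde : d ≠ e := fun h => he (h ▸ mem_cyc3Class_self K d)
  obtain ⟨f, -, hf⟩ : ∃ f ∈ (Finset.univ : Finset α), f ∉ ({d, e} : Finset α) :=
    Finset.exists_mem_notMem_of_card_lt_card (by
      rw [Finset.card_univ]
      have := Finset.card_le_two (a := d) (b := e)
      omega)
  simp only [Finset.mem_insert, Finset.mem_singleton, not_or] at hf
  have hs : cyc3 d e f ∉ K := fun h =>
    he (mem_cyc3Class.2 (Or.inr ⟨f, hde, Ne.symm hf.1, Ne.symm hf.2, h⟩))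
  set s : alternatingGroup α := ⟨cyc3 d e f, cyc3_mem_alternatingGroup hde (Ne.symm hf.2)⟩
  have hsx : s • x ≠ x := fun h => hs (coe_mem_permStabilizer.2 h)
  have hgx : g • x ≠ x := by
    intro h
    have h1 := map_cyc3Class (coe_mem_permStabilizer.2 h) d
    rw [hg] at h1
    have := hsparse ((g : Perm α) d)
    rw [← h1, Finset.inter_self] at this
    omega
  obtain ⟨h, hhx, hh⟩ := h2 _ hsx _ hgx
  rw [← mul_smul, smul_eq_smul_iff_mem_permStabilizer] at hh
  have hhK : (h : Perm α) ∈ K := coe_mem_permStabilizer.2 hhx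
  set k := (((h * s)⁻¹ * g : alternatingGroup α) : Perm α) with hk
  have hgk : (g : Perm α) = cyc3 (h.1 d) (h.1 e) (h.1 f) * (h * k) := by
    rw [← cyc3_conj, hk]
    simp [s, mul_assoc]
  have hY' : Y = (cyc3Class K ((h * k : Perm α) d)).map
      (cyc3 (h.1 d) (h.1 e) (h.1 f)).toEmbedding := by
    rw [← map_cyc3Class (K.mul_mem hhK hh), ← hg, hgk, Finset.map_map]
    rfl
  have h5 := card_map_cyc3_sdiff_le_one (h.1.injective.ne hde) (h.1.injective.ne (Ne.symm hf.1))
    (h.1.injective.ne (Ne.symm hf.2)) (cyc3Class K ((h * k : Perm α) d))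
  rw [← hY'] at h5
  have h6 := hsparse ((h * k : Perm α) d)
  have h7 := Finset.card_sdiff_add_card_inter Y (cyc3Class K ((h * k : Perm α) d))
  omega

end NotTwoTransitive

section NoThreeCycle

open Equiv

variable {α Ω : Type*} [Fintype α] [DecidableEq α] [Fintype Ω]
  [MulAction (alternatingGroup α) Ω]

theorem card_sub_one_dvd_of_no_cyc3 (x : Ω)
    (hK : ∀ a b c, a ≠ b → a ≠ c → b ≠ c → cyc3 a b c ∉ permStabilizer α x)
    (h2 : ∀ z ≠ x, ∀ z' ≠ x, ∃ g : alternatingGroup α, g • x = x ∧ g • z = z')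
    (hn : 2 ≤ Fintype.card Ω) :
    (Fintype.card Ω - 1) ∣ (Fintype.card α).descFactorial 3 := by
  classical
  have hne : ∀ (t : Fin 3 ↪ α) {i j}, i ≠ j → t i ≠ t j := fun t _ _ h => t.injective.ne h
  let τ : (Fin 3 ↪ α) → alternatingGroup α := fun t =>
    ⟨cyc3 (t 0) (t 1) (t 2), cyc3_mem_alternatingGroup (hne t (by decide)) (hne t (by decide))⟩
  have hτ : ∀ t, τ t • x ≠ x := fun t h =>
    hK _ _ _ (hne t (by decide)) (hne t (by decide)) (hne t (by decide))
      (coe_mem_permStabilizer.2 h)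
  have hconj : ∀ (t : Fin 3 ↪ α) (h : alternatingGroup α), h • x = x →
      τ (t.trans (h : Perm α).toEmbedding) • x = h • τ t • x := by
    intro t h hx
    have : τ (t.trans (h : Perm α).toEmbedding) = h * τ t * h⁻¹ :=
      Subtype.ext (cyc3_conj (h : Perm α) (t 0) (t 1) (t 2)).symm
    rw [this, mul_smul, mul_smul]
    congr 2
    rw [inv_smul_eq_iff, hx]
  let N : Ω → ℕ := fun z => (Finset.univ.filter fun t => τ t • x = z).card
  have hNle : ∀ z ≠ x, ∀ z' ≠ x, N z ≤ N z' := by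
    intro z hz z' hz'
    obtain ⟨h, hx, rfl⟩ := h2 z hz z' hz'
    refine Finset.card_le_card_of_injOn (fun t => t.trans (h : Perm α).toEmbedding) ?_ ?_
    · intro t ht
      simp only [Finset.coe_filter, Finset.mem_univ, true_and, Set.mem_ofPred_eq] at ht ⊢
      rw [hconj t h hx, ht]
    · intro t _ t' _ htt
      ext i
      have := DFunLike.congr_fun htt i
      exact (h : Perm α).injective this
  obtain ⟨z₀, hz₀⟩ := Fintype.exists_ne_of_one_lt_card hn x
  have hsum : Fintype.card (Fin 3 ↪ α) = ∑ z : Ω, N z := by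
    rw [← Finset.card_univ]
    exact Finset.card_eq_sum_card_fiberwise fun t _ => Finset.mem_coe.2 (Finset.mem_univ _)
  have hNx : N x = 0 := by
    simp only [N, Finset.card_eq_zero, Finset.filter_eq_empty_iff]
    exact fun t _ => hτ t
  rw [← Finset.add_sum_erase _ _ (Finset.mem_univ x), hNx, zero_add,
    Finset.sum_congr rfl fun z hz => le_antisymm (hNle z (Finset.ne_of_mem_erase hz) z₀ hz₀)
      (hNle z₀ hz₀ z (Finset.ne_of_mem_erase hz)),
    Finset.sum_const, Finset.card_erase_of_mem (Finset.mem_univ x), Finset.card_univ,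
    Fintype.card_embedding_eq, Fintype.card_fin] at hsum
  exact ⟨N z₀, hsum⟩

theorem three_dvd_card_of_no_cyc3 [MulAction.IsPretransitive (alternatingGroup α) Ω]
    (h3 : 3 ≤ Fintype.card α) (x : Ω)
    (hK : ∀ a b c, a ≠ b → a ≠ c → b ≠ c → cyc3 a b c ∉ permStabilizer α x) :
    3 ∣ Fintype.card Ω := by
  classical
  obtain ⟨t⟩ : Nonempty (Fin 3 ↪ α) := Function.Embedding.nonempty_of_card_le (by simpa using h3)
  have h01 : t 0 ≠ t 1 := t.injective.ne (by decide)
  have h02 : t 0 ≠ t 2 := t.injective.ne (by decide)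
  have h12 : t 1 ≠ t 2 := t.injective.ne (by decide)
  let s : alternatingGroup α := ⟨cyc3 (t 0) (t 1) (t 2), cyc3_mem_alternatingGroup h01 h12⟩
  have hs : s ^ 3 = 1 := by
    have : cyc3 (t 0) (t 1) (t 2) * cyc3 (t 0) (t 1) (t 2) * cyc3 (t 0) (t 1) (t 2) = 1 := by
      rw [mul_eq_one_iff_eq_inv, cyc3_inv h01 h02 h12]
      ext z
      rw [Perm.mul_apply]
      by_cases hz0 : z = t 0
      · rw [hz0, cyc3_apply_left h01 h02, cyc3_apply_mid h02 h12, cyc3_apply_mid h12 h02]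
      by_cases hz1 : z = t 1
      · rw [hz1, cyc3_apply_mid h02 h12, cyc3_apply_right, cyc3_apply_left h01.symm h12]
      by_cases hz2 : z = t 2
      · rw [hz2, cyc3_apply_right, cyc3_apply_left h01 h02, cyc3_apply_right]
      rw [cyc3_apply_of_ne hz0 hz1 hz2, cyc3_apply_of_ne hz0 hz1 hz2,
        cyc3_apply_of_ne hz1 hz0 hz2]
    apply Subtype.ext
    rw [pow_succ, pow_two]
    exact this
  have := Fact.mk Nat.prime_three
  have h := Equiv.Perm.card_fixedPoints_modEq
    (f := (MulAction.toEndHom : alternatingGroup α →* Function.End Ω) s) (p := 3) (n := 1)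
    (by rw [pow_one, ← map_pow, hs, map_one])
  have he : IsEmpty (Function.fixedPoints
      ((MulAction.toEndHom : alternatingGroup α →* Function.End Ω) s)) := by
    refine ⟨fun ⟨y, hy⟩ => ?_⟩
    obtain ⟨g, rfl⟩ := MulAction.exists_smul_eq (alternatingGroup α) x y
    have hy' : s • g • x = g • x := hy
    have h1 : ((g⁻¹ * s * g : alternatingGroup α) : Perm α) ∈ permStabilizer α x := by
      rw [coe_mem_permStabilizer, mul_smul, mul_smul, hy', inv_smul_smul]
    have h2 := cyc3_conj ((g : Perm α)⁻¹) (t 0) (t 1) (t 2)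
    rw [inv_inv] at h2
    refine hK _ _ _ ((g : Perm α)⁻¹.injective.ne h01) ((g : Perm α)⁻¹.injective.ne h02)
      ((g : Perm α)⁻¹.injective.ne h12) ?_
    rw [← h2]
    exact h1
  refine Nat.modEq_zero_iff_dvd.1 (h.trans ?_)
  convert Nat.ModEq.refl 0
  exact Fintype.card_eq_zero_iff.2 he

end NoThreeCycle

section Fisher

theorem exists_smul_eq_of_two_transitive {G Ω Y : Type*} [Group G] [MulAction G Ω] [MulAction G Y]
    [Fintype Ω] [Fintype Y] [MulAction.IsPretransitive G Y] [MulAction.IsPretransitive G Ω]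
    (hcard : Fintype.card Y < Fintype.card Ω) (x : Ω)
    (h2 : ∀ z ≠ x, ∀ z' ≠ x, ∃ g : G, g • x = x ∧ g • z = z') (y y' : Y) :
    ∃ g : G, g • x = x ∧ g • y = y' := by
  classical
  let v : Ω → Y → ℚ := fun z u => if ∃ g : G, g • x = z ∧ g • y = u then 1 else 0
  by_contra hno
  have hvinv : ∀ (g : G) z u, v (g • z) (g • u) = v z u := by
    intro g z u
    have : (∃ k : G, k • x = g • z ∧ k • y = g • u) ↔ ∃ k : G, k • x = z ∧ k • y = u := by
      constructor
      · rintro ⟨k, h1, h2⟩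
        exact ⟨g⁻¹ * k, by rw [mul_smul, h1, inv_smul_smul], by rw [mul_smul, h2, inv_smul_smul]⟩
      · rintro ⟨k, h1, h2⟩
        exact ⟨g * k, by rw [mul_smul, h1], by rw [mul_smul, h2]⟩
    simp only [v, this]
  let D : Ω → Ω → ℚ := fun z z' => ∑ u, v z u * v z' u
  have hDinv : ∀ (g : G) z z', D (g • z) (g • z') = D z z' := by
    intro g z z'
    simp only [D]
    rw [← Equiv.sum_comp (MulAction.toPerm g)]
    simp [hvinv]
  have hvsq : ∀ z u, v z u * v z u = v z u := by
    intro z u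
    simp only [v]
    split_ifs <;> simp
  have hv0 : ∀ z u, 0 ≤ v z u := by
    intro z u
    simp only [v]
    split_ifs <;> simp
  have hv1 : ∀ z u, v z u ≤ 1 := by
    intro z u
    simp only [v]
    split_ifs <;> simp
  have hDdiag : ∀ z, D z z = D x x := by
    intro z
    obtain ⟨g, rfl⟩ := MulAction.exists_smul_eq G x z
    exact hDinv g x x
  have hvxy : v x y = 1 := if_pos ⟨1, one_smul _ _, one_smul _ _⟩
  have hvxy' : v x y' = 0 := if_neg hno
  obtain ⟨g₀, hg₀⟩ := MulAction.exists_smul_eq G y' y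
  have hlt : D x (g₀ • x) < D x x := by
    refine Finset.sum_lt_sum (fun u _ => ?_) ⟨y, Finset.mem_univ y, ?_⟩
    · rw [hvsq]
      exact mul_le_of_le_one_right (hv0 _ _) (hv1 _ _)
    · rw [← hg₀, hvinv, hvxy', mul_zero, hg₀, hvxy]
      norm_num
  have hg₀x : g₀ • x ≠ x := by
    intro h
    rw [h] at hlt
    exact lt_irrefl _ hlt
  set lam := D x (g₀ • x) with hlam
  have hDoff : ∀ z z', z ≠ z' → D z z' = lam := by
    intro z z' hzz
    obtain ⟨g, rfl⟩ := MulAction.exists_smul_eq G x z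
    have h1 : g⁻¹ • z' ≠ x := by
      intro h
      rw [inv_smul_eq_iff] at h
      exact hzz h.symm
    obtain ⟨h, hx, hh⟩ := h2 _ hg₀x _ h1
    rw [hlam, ← hDinv h x (g₀ • x), hx, hh, ← hDinv g x, smul_inv_smul]
  have hlam0 : 0 ≤ lam := Finset.sum_nonneg fun u _ => mul_nonneg (hv0 _ _) (hv0 _ _)
  have hli : LinearIndependent ℚ v := by
    rw [Fintype.linearIndependent_iff]
    intro c hc
    have h1 : ∀ z, c z * (D x x - lam) + lam * ∑ z', c z' = 0 := by
      intro z
      have h3 : ∑ z', c z' * D z' z = 0 := by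
        have : ∑ u, (∑ z', c z' • v z') u * v z u = 0 := by rw [hc]; simp
        rw [← this]
        simp only [D, Finset.sum_apply, Pi.smul_apply, smul_eq_mul, Finset.mul_sum,
          Finset.sum_mul]
        rw [Finset.sum_comm]
        simp only [mul_assoc]
      have h4 : ∑ z' ∈ Finset.univ.erase z, c z' * D z' z =
          (∑ z' ∈ Finset.univ.erase z, c z') * lam := by
        rw [Finset.sum_mul]
        exact Finset.sum_congr rfl fun z' hz' => by rw [hDoff z' z (Finset.ne_of_mem_erase hz')]
      have h5 := Finset.add_sum_erase _ c (Finset.mem_univ z)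
      have h6 := Finset.add_sum_erase _ (fun z' => c z' * D z' z) (Finset.mem_univ z)
      simp only [h4, h3, hDdiag] at h6
      linear_combination h6 - lam * h5
    have h3 : (∑ z, c z) * (D x x - lam + lam * Fintype.card Ω) = 0 := by
      have := Finset.sum_congr rfl fun z (_ : z ∈ Finset.univ) => h1 z
      rw [Finset.sum_add_distrib, ← Finset.sum_mul, Finset.sum_const, Finset.sum_const_zero,
        Finset.card_univ, nsmul_eq_mul] at this
      linear_combination this
    have h4 : ∑ z, c z = 0 := by
      refine (mul_eq_zero.1 h3).resolve_right (ne_of_gt ?_)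
      have : 0 ≤ lam * Fintype.card Ω := by positivity
      linarith
    intro z
    have h5 := h1 z
    rw [h4, mul_zero, add_zero] at h5
    exact (mul_eq_zero.1 h5).resolve_right (by linarith)
  have := hli.fintype_card_le_finrank
  rw [Module.finrank_fintype_fun_eq_card] at this
  omega

end Fisher

section AlternatingAction

open Equiv

theorem factorial_gt_of_seven_le {k : ℕ} (hk : 7 ≤ k) :
    2 * (2 * k * (2 * k - 1) * (2 * k - 2) + 1) < k.factorial := by
  induction k, hk using Nat.le_induction with
  | base => decide
  | succ k hk ih =>
    obtain ⟨j, rfl⟩ := Nat.exists_eq_add_of_le hk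
    rw [Nat.factorial_succ]
    have e1 : 2 * (7 + j) - 1 = 2 * j + 13 := by omega
    have e2 : 2 * (7 + j) - 2 = 2 * j + 12 := by omega
    have e3 : 2 * (7 + j + 1) - 1 = 2 * j + 15 := by omega
    have e4 : 2 * (7 + j + 1) - 2 = 2 * j + 14 := by omega
    rw [e1, e2] at ih
    rw [e3, e4]
    have : 8 * (7 + j).factorial ≤ (7 + j + 1) * (7 + j).factorial :=
      Nat.mul_le_mul_right _ (by omega)
    refine lt_of_lt_of_le ?_ this
    refine lt_of_lt_of_le ?_ (Nat.mul_le_mul_left 8 ih)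
    ring_nf
    nlinarith [Nat.zero_le j, Nat.zero_le (j ^ 2), Nat.zero_le (j ^ 3)]

theorem degree_cases {m n k : ℕ} (hm : 9 ≤ m) (hk : m ≤ 2 * k) (hkn : k.factorial ≤ 2 * n)
    (hdvd : n - 1 ∣ m.descFactorial 3) (h3 : 3 ∣ n) :
    m = 10 ∧ n = 81 ∨ m = 12 ∧ n = 441 := by
  have hk5 : 5 ≤ k := by omega
  have hdesc : m.descFactorial 3 = m * (m - 1) * (m - 2) := by
    simp [Nat.descFactorial_succ]
    ring
  rw [hdesc] at hdvd
  by_cases hm13 : 13 ≤ m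
  · exfalso
    have h1 := factorial_gt_of_seven_le (k := k) (by omega)
    have h2 : n - 1 ≤ m * (m - 1) * (m - 2) := by
      refine Nat.le_of_dvd ?_ hdvd
      have : 0 < m - 1 := by omega
      have : 0 < m - 2 := by omega
      positivity
    have h4 : m * (m - 1) * (m - 2) ≤ 2 * k * (2 * k - 1) * (2 * k - 2) := by
      gcongr
    omega
  have h60 : k ≤ 5 → k.factorial = 120 := fun h => by
    rw [show k = 5 by omega]
    rfl
  have h120 : Nat.factorial 5 ≤ k.factorial := Nat.factorial_le hk5
  have e5 : Nat.factorial 5 = 120 := rfl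
  have e6 : Nat.factorial 6 = 720 := rfl
  have h720 : 11 ≤ m → Nat.factorial 6 ≤ k.factorial := fun h => Nat.factorial_le (by omega)
  obtain ⟨q, hq⟩ := hdvd
  obtain ⟨c, rfl⟩ := h3
  interval_cases m
  · have hq8 : q ≤ 8 := by
      by_contra! h
      have : (3 * c - 1) * 9 ≤ (3 * c - 1) * q := Nat.mul_le_mul_left _ h
      omega
    interval_cases q <;> omega
  · have hq8 : q ≤ 12 := by
      by_contra! h
      have : (3 * c - 1) * 13 ≤ (3 * c - 1) * q := Nat.mul_le_mul_left _ h
      omega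
    interval_cases q <;> omega
  · have hq8 : q ≤ 2 := by
      by_contra! h
      have : (3 * c - 1) * 3 ≤ (3 * c - 1) * q := Nat.mul_le_mul_left _ h
      omega
    interval_cases q <;> omega
  · have hq8 : q ≤ 3 := by
      by_contra! h
      have : (3 * c - 1) * 4 ≤ (3 * c - 1) * q := Nat.mul_le_mul_left _ h
      omega
    interval_cases q <;> omega

variable {α Ω : Type*} [Fintype α] [DecidableEq α] [Fintype Ω]
  [MulAction (alternatingGroup α) Ω]

theorem choose_two_dvd_of_two_transitive [MulAction.IsPretransitive (alternatingGroup α) Ω]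
    (h3 : 3 ≤ Fintype.card α) (hlt : (Fintype.card α).choose 2 < Fintype.card Ω) (x : Ω)
    (h2 : ∀ z ≠ x, ∀ z' ≠ x, ∃ g : alternatingGroup α, g • x = x ∧ g • z = z') :
    (Fintype.card α).choose 2 ∣ Nat.card (permStabilizer α x) := by
  classical
  have : Fintype (Set.powersetCard α 2) := Fintype.ofFinite _
  have hcard : Nat.card (Set.powersetCard α 2) = (Fintype.card α).choose 2 := by
    rw [Set.powersetCard.card, Nat.card_eq_fintype_card]
  have : MulAction.IsPretransitive (alternatingGroup α) (Set.powersetCard α 2) :=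
    Set.powersetCard.isPretransitive_alternatingGroup (by rwa [Nat.card_eq_fintype_card])
  have htr : MulAction.IsPretransitive (MulAction.stabilizer (alternatingGroup α) x)
      (Set.powersetCard α 2) := by
    refine ⟨fun y y' => ?_⟩
    obtain ⟨g, hg, hgy⟩ := exists_smul_eq_of_two_transitive
      (by rwa [← Nat.card_eq_fintype_card, hcard]) x h2 y y'
    exact ⟨⟨g, hg⟩, hgy⟩
  obtain ⟨y⟩ : Nonempty (Set.powersetCard α 2) := by
    apply (Nat.card_pos_iff.1 _).1
    rw [hcard]
    exact Nat.choose_pos (by omega)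
  rw [← hcard, ← MulAction.index_stabilizer_of_transitive
    (MulAction.stabilizer (alternatingGroup α) x) y, permStabilizer,
    Subgroup.card_map_of_injective (Subgroup.subtype_injective _)]
  exact Subgroup.index_dvd_card _

theorem card_alternatingGroup_eq {m : ℕ} (hm : 2 ≤ m) (h : Fintype.card α = m) :
    2 * Nat.card (alternatingGroup α) = m.factorial := by
  have : Nontrivial α := by
    rw [← Fintype.one_lt_card_iff_nontrivial]
    omega
  rw [Nat.card_eq_fintype_card, two_mul_card_alternatingGroup, Fintype.card_perm, h]

theorem not_two_transitive_of_alternatingGroup [MulAction.IsPretransitive (alternatingGroup α) Ω]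
    (h9 : 9 ≤ Fintype.card α) (hn : Fintype.card α < Fintype.card Ω) (x : Ω) :
    ¬ ∀ z ≠ x, ∀ z' ≠ x, ∃ g : alternatingGroup α, g • x = x ∧ g • z = z' := by
  intro h2
  by_cases hK : ∀ a b c, a ≠ b → a ≠ c → b ≠ c → cyc3 a b c ∉ permStabilizer α x
  · obtain ⟨k, hk, hkn⟩ := exists_factorial_le_of_no_cyc3 (by omega) hK
    have h := card_mul_card_permStabilizer (α := α) x
    rcases degree_cases h9 hk hkn (card_sub_one_dvd_of_no_cyc3 x hK h2 (by omega))
      (three_dvd_card_of_no_cyc3 (by omega) x hK) with ⟨hm, hn81⟩ | ⟨hm, hn441⟩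
    · have hc := choose_two_dvd_of_two_transitive (by omega) (by rw [hm, hn81]; decide) x h2
      have h1 := card_alternatingGroup_eq (by omega) hm
      rw [hm, show Nat.choose 10 2 = 45 from rfl] at hc
      rw [← h, hn81, show Nat.factorial 10 = 3628800 from rfl] at h1
      omega
    · have h1 := card_alternatingGroup_eq (by omega) hm
      rw [← h, hn441, show Nat.factorial 12 = 479001600 from rfl] at h1
      omega
  · push Not at hK
    obtain ⟨a, b, c, hab, hac, hbc, habc⟩ := hK
    exact not_two_transitive_of_cyc3_mem h9 hn x hab hac hbc habc h2

theorem twentyFour_le_card_of_alternatingGroup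
    [MulAction.IsPretransitive (alternatingGroup α) Ω]
    (h9 : 9 ≤ Fintype.card α) (hn : Fintype.card α < Fintype.card Ω) :
    24 ≤ Fintype.card Ω := by
  obtain ⟨x⟩ : Nonempty Ω := Fintype.card_pos_iff.1 (by omega)
  by_cases hK : ∀ a b c, a ≠ b → a ≠ c → b ≠ c → cyc3 a b c ∉ permStabilizer α x
  · obtain ⟨k, hk, hkn⟩ := exists_factorial_le_of_no_cyc3 (by omega) hK
    have h120 : Nat.factorial 5 ≤ k.factorial := Nat.factorial_le (by omega)
    have e5 : Nat.factorial 5 = 120 := rfl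
    omega
  · push Not at hK
    obtain ⟨a, b, c, hab, hac, hbc, habc⟩ := hK
    have := twentyEight_le_card_of_cyc3Class h9 hn x a (three_le_card_cyc3Class hab hac hbc habc)
    omega

end AlternatingAction

section Assembly

theorem exists_invariant_weight {G Ω : Type*} [Group G] [MulAction G Ω] {g : G} {z x : Ω}
    (hg : g • z ≠ z) (hg2 : g * g = 1)
    (hnot : ¬ ∀ u ≠ x, ∀ u' ≠ x, ∃ h : G, h • x = x ∧ h • u = u') :
    ∃ w : Ω → Ω → ℤ, (∀ a b, w a b = 0 ∨ w a b = 1) ∧ (∀ a b, w a b = w b a) ∧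
      (∀ a, w a a = 0) ∧ (∀ (h : G) a b, w (h • a) (h • b) = w a b) ∧
      (∃ a b, a ≠ b ∧ w a b = 0) ∧ ∃ a b, w a b = 1 := by
  classical
  let R : Ω → Ω → Prop := fun a b => ∃ h : G, h • z = a ∧ h • g • z = b
  have hRsymm : ∀ a b, R a b → R b a := by
    rintro a b ⟨h, h1, h2⟩
    refine ⟨h * g, by rw [mul_smul, h2], ?_⟩
    rw [mul_smul, ← mul_smul g, hg2, one_smul, h1]
  have hRinv : ∀ (k : G) a b, R a b → R (k • a) (k • b) := by
    rintro k a b ⟨h, h1, h2⟩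
    exact ⟨k * h, by rw [mul_smul, h1], by rw [mul_smul, h2]⟩
  refine ⟨fun a b => if R a b then 1 else 0, ?_, ?_, ?_, ?_, ?_, ?_⟩
  · intro a b
    by_cases h : R a b
    · exact Or.inr (if_pos h)
    · exact Or.inl (if_neg h)
  · intro a b
    simp only [show R a b ↔ R b a from ⟨hRsymm a b, hRsymm b a⟩]
  · intro a
    refine if_neg ?_
    rintro ⟨h, h1, h2⟩
    exact hg (MulAction.injective h (h2.trans h1.symm))
  · intro k a b
    simp only [show R (k • a) (k • b) ↔ R a b from
      ⟨fun h => by simpa using hRinv k⁻¹ _ _ h, hRinv k a b⟩]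
  · by_contra! hall
    refine hnot fun u hu u' hu' => ?_
    have hR : ∀ u, u ≠ x → R x u := fun u hu => by
      by_contra h
      exact hall x u hu.symm (if_neg h)
    obtain ⟨h, h1, h2⟩ := hR u hu
    obtain ⟨k, k1, k2⟩ := hR u' hu'
    refine ⟨k * h⁻¹, ?_, ?_⟩
    · rw [mul_smul, ← h1, inv_smul_smul, k1, h1]
    · rw [mul_smul, ← h2, inv_smul_smul, k2]
  · exact ⟨z, g • z, if_pos ⟨1, one_smul _ _, one_smul _ _⟩⟩

theorem secondDiff_intCast {F Ω : Type*} [Ring F] (w : Ω → Ω → ℤ) (a b c d : Ω) :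
    secondDiff (fun a b => (w a b : F)) a b c d = (secondDiff w a b c d : ℤ) := by
  simp [secondDiff]

theorem secondDiff_intCast_ne_zero {F Ω : Type*} [Field F] (h2 : (2 : F) ≠ 0) {w : Ω → Ω → ℤ}
    (h01 : ∀ a b, w a b = 0 ∨ w a b = 1) {a b c d : Ω} (h : secondDiff w a b c d ≠ 0) :
    secondDiff (fun a b => (w a b : F)) a b c d ≠ 0 := by
  rw [secondDiff_intCast]
  have h3 : secondDiff w a b c d = 1 ∨ secondDiff w a b c d = -1 ∨ secondDiff w a b c d = 2 ∨
      secondDiff w a b c d = -2 := by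
    unfold secondDiff at h ⊢
    have h1 := h01 a c
    have h2 := h01 a d
    have h3 := h01 b c
    have h4 := h01 b d
    omega
  rcases h3 with h3 | h3 | h3 | h3 <;> simp [h3, h2]

theorem exists_config_of_mulEquiv {n m : ℕ} (hm : 9 ≤ m) (hmn : m < n)
    {X : Subgroup (alternatingGroup (Fin n))} (e : X ≃* alternatingGroup (Fin m))
    [MulAction.IsPretransitive X (Fin n)] :
    18 ≤ n ∧ ∃ w : Fin n → Fin n → ℤ, (∀ a b, w a b = w b a) ∧ (∀ a, w a a = 0) ∧
      (∀ a b, w a b = 0 ∨ w a b = 1) ∧ (∀ (g : X) a b, w (g • a) (g • b) = w a b) ∧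
      ∃ f : Fin 8 → Fin n, Function.Injective f ∧
        secondDiff w (f 0) (f 1) (f 2) (f 3) ≠ 0 ∧
        secondDiff w (f 4) (f 5) (f 6) (f 7) ≠ 0 ∧ secondDiff w (f 0) (f 1) (f 4) (f 5) = 0 ∧
        secondDiff w (f 0) (f 1) (f 6) (f 7) = 0 := by
  let _ : MulAction (alternatingGroup (Fin m)) (Fin n) :=
    MulAction.compHom (Fin n) (e.symm : alternatingGroup (Fin m) →* X)
  have hsmul : ∀ (g : alternatingGroup (Fin m)) (i : Fin n), g • i = e.symm g • i :=
    fun g i => rfl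
  have htr : MulAction.IsPretransitive (alternatingGroup (Fin m)) (Fin n) := by
    refine ⟨fun i j => ?_⟩
    obtain ⟨g, hg⟩ := MulAction.exists_smul_eq X i j
    exact ⟨e g, by rw [hsmul, e.symm_apply_apply, hg]⟩
  have h9 : 9 ≤ Fintype.card (Fin m) := by rwa [Fintype.card_fin]
  have hlt : Fintype.card (Fin m) < Fintype.card (Fin n) := by simpa using hmn
  have h24 := twentyFour_le_card_of_alternatingGroup h9 hlt
  have hcard : 2 * Nat.card X = m.factorial := by
    rw [Nat.card_congr e.toEquiv]
    exact card_alternatingGroup_eq (by omega) (Fintype.card_fin m)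
  have hdvd : Nat.factorial 4 ∣ m.factorial := Nat.factorial_dvd_factorial (by omega)
  have hle : Nat.factorial 4 ≤ m.factorial := Nat.factorial_le (by omega)
  rw [← hcard, show Nat.factorial 4 = 24 from rfl] at hdvd hle
  have hsimple : IsSimpleGroup X := by
    have := alternatingGroup.isSimpleGroup (α := Fin m) (by rw [Nat.card_eq_fintype_card]; omega)
    exact e.isSimpleGroup
  have := Fact.mk Nat.prime_two
  obtain ⟨g, hg⟩ := exists_prime_orderOf_dvd_card' (G := X) 2 (by omega)
  obtain ⟨hg2, hg1⟩ := orderOf_eq_prime_iff.1 hg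
  obtain ⟨z, hz⟩ : ∃ z : Fin n, g • z ≠ z := by
    by_contra! h
    exact hg1 (Subtype.ext (Subtype.ext (Equiv.ext h)))
  have hnot := not_two_transitive_of_alternatingGroup h9 hlt z
  obtain ⟨w, h01, hsym, hdiag, hinv, h0, h1⟩ := exists_invariant_weight (G := X) hz
    (by rw [← pow_two, hg2]) (x := z) fun h => hnot fun u hu u' hu' => by
      obtain ⟨k, k1, k2⟩ := h u hu u' hu'
      exact ⟨e k, by rw [hsmul, e.symm_apply_apply, k1], by rw [hsmul, e.symm_apply_apply, k2]⟩
  refine ⟨by simp at h24; omega, ?_⟩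
  exact exists_config (by omega) h24 h01 hsym hdiag hinv h0 h1

end Assembly

/-- if `F` is algebraically closed of characteristic `p ≠ 2` (`p` an odd
prime or `0`), and `X ≤ Aₙ` is a transitive subgroup isomorphic to `A_m` with
`n > m ≥ 9`, then every `F Aₙ`-module of dimension `> 1` is reducible over `X`. -/
theorem stmt17 {F : Type*} [Field F] [IsAlgClosed F] {p : ℕ} [CharP F p]
    (hp : p = 0 ∨ p.Prime) (hp2 : p ≠ 2)
    {n m : ℕ} (hm : 9 ≤ m) (hmn : m < n)
    (X : Subgroup (alternatingGroup (Fin n)))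
    (hiso : Nonempty (X ≃* alternatingGroup (Fin m)))
    (htrans : MulAction.IsPretransitive X (Fin n))
    (V : Type*) [AddCommGroup V] [Module F V]
    (ρ : Representation F (alternatingGroup (Fin n)) V)
    (hdim : 1 < Module.rank F V) :
    ¬ RepIrreducible (ρ.comp X.subtype) := by
  obtain ⟨e⟩ := hiso
  have h2 : (2 : F) ≠ 0 := Ring.two_ne_zero (by rwa [ringChar.eq F p] )
  obtain ⟨hn, w, hsym, hdiag, h01, hinv, f, hf, h12, h34, h13, h14⟩ :=
    exists_config_of_mulEquiv hm hmn e
  refine not_repIrreducible_of_config ρ h2 (by rwa [Fintype.card_fin]) hdim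
    (w := fun a b => (w a b : F)) (fun a b => by rw [hsym]) (fun a => by rw [hdiag, Int.cast_zero])
    (fun g hg a b => congrArg Int.cast (hinv ⟨g, hg⟩ a b)) hf
    (secondDiff_intCast_ne_zero h2 h01 h12) (secondDiff_intCast_ne_zero h2 h01 h34) ?_ ?_
  · rw [secondDiff_intCast, h13, Int.cast_zero]
  · rw [secondDiff_intCast, h14, Int.cast_zero]
end

section
/- Let F be an algebraically closed field, n ≥ 5, and fix the natural embedding of A_{n−1} into A_n (as the stabilizer of the point n). Let U be a finite-dimensional F-vector space and Ψ : A_{n−1} → GL(U) an irreducible representation. Then the set of representations Φ : A_n → GL(U) with Φ|_{A_{n−1}} = Ψ has at most three elements. -/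
/-- Burnside's theorem: a subalgebra of `End F U` without proper nonzero invariant subspaces
is everything. -/
theorem Subalgebra.eq_top_of_forall_invariant {F U : Type*} [Field F] [IsAlgClosed F]
    [AddCommGroup U] [Module F U] [FiniteDimensional F U] [Nontrivial U]
    (A : Subalgebra F (Module.End F U))
    (hA : ∀ p : Submodule F U, (∀ a ∈ A, ∀ v ∈ p, a v ∈ p) → p = ⊥ ∨ p = ⊤) : A = ⊤ := by
  have hsimple : IsSimpleModule A U := by
    rw [isSimpleModule_iff]
    refine { exists_pair_ne := ⟨⊥, ⊤, bot_ne_top⟩, eq_bot_or_eq_top := fun p ↦ ?_ }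
    rcases hA (p.restrictScalars F) (fun a ha v hv ↦ p.smul_mem (⟨a, ha⟩ : A) hv) with h | h
    · exact Or.inl ((Submodule.restrictScalars_eq_bot_iff F A U).1 h)
    · exact Or.inr ((Submodule.restrictScalars_eq_top_iff F A U).1 h)
  rw [eq_top_iff]
  intro f _
  let f' : Module.End (Module.End A U) U :=
    { toFun := f
      map_add' := f.map_add
      map_smul' := fun φ v ↦ by
        obtain ⟨c, rfl⟩ := (IsSimpleModule.algebraMap_end_bijective_of_isAlgClosed
          (A := A) (V := U) F).2 φ
        simp }
  obtain ⟨s, hs⟩ := Module.Finite.fg_top (R := F) (M := U)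
  obtain ⟨a, ha⟩ := jacobson_density f' s
  have : f = a := by
    refine LinearMap.ext_on hs fun v hv ↦ ?_
    exact ha v hv
  exact this ▸ a.2

/-- The image of an irreducible representation spans the full endomorphism algebra. -/
theorem RepIrreducible.span_range_eq_top {F G U : Type*} [Field F] [IsAlgClosed F] [Monoid G]
    [AddCommGroup U] [Module F U] [FiniteDimensional F U] {Ψ : Representation F G U}
    (hΨ : RepIrreducible Ψ) : Submodule.span F (Set.range Ψ) = ⊤ := by
  have := hΨ.1
  have htop : Algebra.adjoin F (Set.range Ψ) = ⊤ := by
    refine Subalgebra.eq_top_of_forall_invariant _ fun p hp ↦ hΨ.2 p fun g v hv ↦ ?_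
    exact hp _ (Algebra.subset_adjoin ⟨g, rfl⟩) v hv
  have hspan := Algebra.adjoin_eq_span F (Set.range Ψ)
  rw [← MonoidHom.coe_mrange, Submonoid.closure_eq, MonoidHom.coe_mrange, htop] at hspan
  simpa using hspan.symm

section InvolutionPairs

variable {F E : Type*} [Field F] [Ring E] [Algebra F E] {S S' L : E} {k : F}

theorem eq_smul_mul_self_sub (h : S * S' = 1) (hL : S' * L = k • S - 1) :
    L = k • (S * S) - S := by
  calc L = S * (S' * L) := by rw [← mul_assoc, h, one_mul]
    _ = _ := by rw [hL, mul_sub, mul_smul_comm, mul_one]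

theorem eq_smul_mul_self_sub' (h : S * S' = 1) (hL : L * S = k • S' - 1) :
    L = k • (S' * S') - S' := by
  calc L = L * S * S' := by rw [mul_assoc, h, mul_one]
    _ = _ := by rw [hL, sub_mul, smul_mul_assoc, one_mul]

theorem smul_add_eq (h : S * S' = 1) (h' : S' * S = 1)
    (hL : S' * L = k • S - 1) (hL' : L * S = k • S' - 1) :
    k • (S + S') = (k ^ 2 + 1) • (1 : E) - L * L := by
  have hcomm : L * S = S * L := by
    rw [eq_smul_mul_self_sub h hL, sub_mul, mul_sub, smul_mul_assoc, mul_smul_comm, mul_assoc]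
  have hLL : L * L = (S' * L) * (L * S) := by
    calc L * L = (S' * S) * (L * L) := by rw [h', one_mul]
      _ = S' * (S * L) * L := by noncomm_ring
      _ = S' * (L * S) * L := by rw [hcomm]
      _ = S' * L * (S * L) := by noncomm_ring
      _ = _ := by rw [← hcomm]
  rw [hLL, hL, hL', sub_mul, mul_sub, smul_mul_smul_comm, h, mul_one, one_mul]
  module

theorem smul_sub_mul_add (h : S * S' = 1) (h' : S' * S = 1)
    (hL : S' * L = k • S - 1) (hL' : L * S = k • S' - 1) :
    k • ((S - S') * (S + S')) = S - S' := by
  have h₁ := eq_smul_mul_self_sub h hL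
  rw [eq_smul_mul_self_sub' h hL'] at h₁
  have h₂ : (S - S') * (S + S') = S * S - S' * S' := by
    rw [sub_mul, mul_add, mul_add, h, h']; abel
  rw [h₂, smul_sub]
  rw [sub_eq_sub_iff_add_eq_add] at h₁
  rw [sub_eq_sub_iff_add_eq_add, add_comm S, h₁]

theorem add_eq_add_of_ne {S₁ S₁' S₂ S₂' : E} (h₁ : S₁ * S₁' = 1) (h₁' : S₁' * S₁ = 1)
    (h₂ : S₂ * S₂' = 1) (h₂' : S₂' * S₂ = 1)
    (hL₁ : S₁' * L = k • S₁ - 1) (hL₁' : L * S₁ = k • S₁' - 1)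
    (hL₂ : S₂' * L = k • S₂ - 1) (hL₂' : L * S₂ = k • S₂' - 1)
    (hne : S₁ ≠ S₁') : S₁ + S₁' = S₂ + S₂' := by
  have hk : k ≠ 0 := by
    rintro rfl
    have := smul_sub_mul_add h₁ h₁' hL₁ hL₁'
    rw [zero_smul] at this
    exact sub_ne_zero.2 hne this.symm
  have := (smul_add_eq h₁ h₁' hL₁ hL₁').trans (smul_add_eq h₂ h₂' hL₂ hL₂').symm
  simpa [smul_smul, hk] using congrArg (k⁻¹ • ·) this

theorem eq_of_smul_one {ρ : E} {c : F} (hS : S = c • 1) (hSS : S * S = 1) (hρ : ρ * ρ = 1)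
    (hbraid : S * ρ * S = ρ * S * ρ) : ρ = S := by
  have h : S * ρ * S = ρ := by
    have : ρ * S = S * ρ := by simp [hS]
    rw [mul_assoc, this, ← mul_assoc, hSS, one_mul]
  rw [h] at hbraid
  have : ρ * S = S * ρ := by simp [hS]
  rw [hbraid, this, mul_assoc, hρ, mul_one]

/-- Two involutions of the form `k - L` satisfying the same braid relation coincide. -/
theorem involution_unique [Nontrivial E] {S₁ S₂ ρ : E} {k₁ k₂ : F} (h₁ : S₁ * S₁ = 1)
    (h₂ : S₂ * S₂ = 1) (hL₁ : L = k₁ • 1 - S₁) (hL₂ : L = k₂ • 1 - S₂) (hρ : ρ * ρ = 1)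
    (hb₁ : S₁ * ρ * S₁ = ρ * S₁ * ρ) (hb₂ : S₂ * ρ * S₂ = ρ * S₂ * ρ) : S₁ = S₂ := by
  obtain ⟨d, hd⟩ : ∃ d : F, S₂ = S₁ + d • 1 := by
    refine ⟨k₂ - k₁, ?_⟩
    have : S₂ = k₂ • 1 - L := by rw [hL₂]; abel
    rw [this, hL₁]; module
  rcases eq_or_ne d 0 with rfl | hd0
  · simp [hd]
  have hlin : d • ((2 : F) • S₁ + d • 1) = 0 := by
    have h := h₂
    rw [hd, mul_add, add_mul, h₁, add_assoc, add_eq_left] at h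
    rw [← h]
    simp only [mul_smul_comm, mul_one, smul_mul_assoc, one_mul]
    module
  have hlin' := (smul_eq_zero.1 hlin).resolve_left hd0
  rcases eq_or_ne (2 : F) 0 with htwo | htwo
  · rw [htwo, zero_smul, zero_add] at hlin'
    exact absurd ((smul_eq_zero.1 hlin').resolve_left hd0) one_ne_zero
  · have hS₁ : S₁ = (-(2 : F)⁻¹ * d) • 1 := by
      have : (2 : F) • S₁ = -(d • 1) := eq_neg_of_add_eq_zero_left hlin'
      rw [← inv_smul_smul₀ htwo S₁, this]
      module
    have hS₂ : S₂ = (-(2 : F)⁻¹ * d + d) • 1 := by rw [hd, hS₁]; module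
    rw [← eq_of_smul_one hS₁ h₁ hρ hb₁, ← eq_of_smul_one hS₂ h₂ hρ hb₂]

end InvolutionPairs

theorem exists_smul_of_quadratic {F U : Type*} [Field F] [AddCommGroup U] [Module F U]
    {D N : Module.End F U} (hN : N ≠ 0)
    (h : ∀ Y, (2 : F) • (D * Y * D) + D * Y * N + N * Y * D = 0) :
    ∃ c : F, D = c • N := by
  obtain ⟨v, hv⟩ : ∃ v, N v ≠ 0 := by
    by_contra! hcon
    exact hN (LinearMap.ext hcon)
  obtain ⟨f, hf⟩ := Module.Projective.exists_dual_ne_zero F hv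
  have key : ∀ u, (2 * f (D v) + f (N v)) • D u = -(f (D v) • N u) := by
    intro u
    have := LinearMap.congr_fun (h (f.smulRight u)) v
    simp only [LinearMap.add_apply, LinearMap.smul_apply, Module.End.mul_apply,
      LinearMap.smulRight_apply, map_smul, LinearMap.zero_apply] at this
    rw [eq_neg_iff_add_eq_zero, ← this]
    module
  rcases eq_or_ne (2 * f (D v) + f (N v)) 0 with h0 | h0
  · exfalso
    have hk := key v
    rw [h0, zero_smul, eq_comm, neg_eq_zero, smul_eq_zero] at hk
    rcases hk with hk | hk
    · rw [hk] at h0; simp at h0; exact hf h0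
    · exact hv hk
  · refine ⟨-((2 * f (D v) + f (N v))⁻¹ * f (D v)), LinearMap.ext fun u ↦ ?_⟩
    rw [← inv_smul_smul₀ h0 (D u), key u, LinearMap.smul_apply]
    module

theorem smul_mul_add_one_eq_zero {F U : Type*} [Field F] [AddCommGroup U] [Module F U]
    {N : Module.End F U} (hN : N ≠ 0) {c : F}
    (h : ∀ Y, (2 : F) • ((c • N) * Y * (c • N)) + (c • N) * Y * N + N * Y * (c • N) = 0) :
    2 * (c * (c + 1)) = 0 := by
  obtain ⟨v, hv⟩ : ∃ v, N v ≠ 0 := by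
    by_contra! hcon
    exact hN (LinearMap.ext hcon)
  obtain ⟨f, hf⟩ := Module.Projective.exists_dual_ne_zero F hv
  have := LinearMap.congr_fun (h (f.smulRight v)) v
  simp only [LinearMap.add_apply, LinearMap.smul_apply, Module.End.mul_apply,
    LinearMap.smulRight_apply, map_smul, LinearMap.zero_apply] at this
  have h2 : (2 * (c * (c + 1)) * f (N v)) • N v = 0 := by rw [← this]; module
  simpa [hv, hf] using h2

/-- Over `End F U`, a pair of mutually inverse operators `S`, `S'` with `S ≠ S'` and a given linear
relation to `L` is determined up to exchange by `Y ↦ S * Y * S + S' * Y * S'`. -/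
theorem eq_or_eq_of_forall_conj {F U : Type*} [Field F] [AddCommGroup U] [Module F U]
    {S₁ S₁' S₂ S₂' L : Module.End F U} {k : F}
    (h₁ : S₁ * S₁' = 1) (h₁' : S₁' * S₁ = 1) (h₂ : S₂ * S₂' = 1) (h₂' : S₂' * S₂ = 1)
    (hL₁ : S₁' * L = k • S₁ - 1) (hL₁' : L * S₁ = k • S₁' - 1)
    (hL₂ : S₂' * L = k • S₂ - 1) (hL₂' : L * S₂ = k • S₂' - 1)
    (hne : S₁ ≠ S₁')
    (h : ∀ Y, S₁ * Y * S₁ + S₁' * Y * S₁' = S₂ * Y * S₂ + S₂' * Y * S₂') :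
    S₂ = S₁ ∨ S₂ = S₁' := by
  have hN : S₁ - S₁' ≠ 0 := sub_ne_zero.2 hne
  have hp := add_eq_add_of_ne h₁ h₁' h₂ h₂' hL₁ hL₁' hL₂ hL₂' hne
  obtain ⟨D, hD⟩ : ∃ D, S₂ = S₁ + D := ⟨S₂ - S₁, by abel⟩
  have hD' : S₂' = S₁' - D := by
    rw [hD, add_assoc, add_right_inj] at hp
    rw [hp]; abel
  have hquad : ∀ Y, (2 : F) • (D * Y * D) + D * Y * (S₁ - S₁') + (S₁ - S₁') * Y * D = 0 := by
    intro Y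
    have hY := h Y
    rw [hD, hD', ← sub_eq_zero] at hY
    rw [← neg_eq_zero, ← hY, two_smul]
    noncomm_ring
  obtain ⟨c, rfl⟩ := exists_smul_of_quadratic hN hquad
  have hc₁ := smul_mul_add_one_eq_zero hN hquad
  have hc₂ : (c * (c + 1)) • ((S₁ - S₁') * (S₁ - S₁')) = 0 := by
    have h := h₂
    have e : (S₁ + c • (S₁ - S₁')) * (S₁' - c • (S₁ - S₁')) =
        S₁ * S₁' - (c • (S₁ * S₁ - S₁ * S₁') - c • (S₁ * S₁' - S₁' * S₁'))
          - (c * c) • ((S₁ - S₁') * (S₁ - S₁')) := by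
      simp only [add_mul, mul_sub, sub_mul, smul_mul_assoc, mul_smul_comm]
      module
    rw [hD, hD', e, h₁, sub_sub, sub_eq_self] at h
    rw [← h]
    simp only [mul_sub, sub_mul, h₁, h₁']
    module
  have hc : c * (c + 1) = 0 := by
    by_contra hc
    have htwo : (2 : F) = 0 := (mul_eq_zero.1 hc₁).resolve_right hc
    have hsq := (smul_eq_zero.1 hc₂).resolve_left hc
    have hsum : S₁ + S₁' = S₁ - S₁' := by
      have : (2 : F) • S₁' = 0 := by rw [htwo, zero_smul]
      rw [two_smul] at this
      rw [eq_sub_iff_add_eq, add_assoc, this, add_zero]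
    have := smul_sub_mul_add h₁ h₁' hL₁ hL₁'
    rw [hsum, hsq, smul_zero] at this
    exact hN this.symm
  rcases mul_eq_zero.1 hc with rfl | hc
  · left; simpa using hD
  · right
    rw [hD, eq_neg_of_add_eq_zero_left hc]
    module

section EvenRepresentations

open Equiv Equiv.Perm

/-- Five distinct points of a type; `l` is the point whose stabilizer we consider. -/
structure FivePoints (X : Type*) where
  (l m q x y : X)
  ml : m ≠ l
  ql : q ≠ l
  xl : x ≠ l
  yl : y ≠ l
  qm : q ≠ m
  xm : x ≠ m
  ym : y ≠ m
  xq : x ≠ q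
  yq : y ≠ q
  xy : x ≠ y

namespace FivePoints

variable {X : Type*} [DecidableEq X] (c : FivePoints X)

/-- The auxiliary transposition of the two spare points. -/
def a : Perm X := swap c.x c.y

/-- The transposition moving the point `l`. -/
def s : Perm X := swap c.m c.l

/-- The transposition moving `m` but not `l`. -/
def r : Perm X := swap c.q c.m

@[simp] theorem a_mul_a : c.a * c.a = 1 := swap_mul_self _ _

@[simp] theorem s_mul_s : c.s * c.s = 1 := swap_mul_self _ _

@[simp] theorem r_mul_r : c.r * c.r = 1 := swap_mul_self _ _

@[simp] theorem a_inv : c.a⁻¹ = c.a := swap_inv _ _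

@[simp] theorem s_inv : c.s⁻¹ = c.s := swap_inv _ _

@[simp] theorem a_l : c.a c.l = c.l := swap_apply_of_ne_of_ne c.xl.symm c.yl.symm

@[simp] theorem a_m : c.a c.m = c.m := swap_apply_of_ne_of_ne c.xm.symm c.ym.symm

@[simp] theorem a_q : c.a c.q = c.q := swap_apply_of_ne_of_ne c.xq.symm c.yq.symm

@[simp] theorem s_l : c.s c.l = c.m := swap_apply_right _ _

@[simp] theorem s_m : c.s c.m = c.l := swap_apply_left _ _

@[simp] theorem r_l : c.r c.l = c.l := swap_apply_of_ne_of_ne c.ql.symm c.ml.symm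

@[simp] theorem r_m : c.r c.m = c.q := swap_apply_right _ _

theorem mul_s_of_fix {h : Perm X} (hl : h c.l = c.l) (hm : h c.m = c.m) :
    h * c.s = c.s * h := by
  have := swap_apply_apply h c.m c.l
  rw [hl, hm, eq_mul_inv_iff_mul_eq] at this
  exact this.symm

theorem a_mul_s : c.a * c.s = c.s * c.a := c.mul_s_of_fix c.a_l c.a_m

theorem a_mul_as_mul_a : c.a * (c.a * c.s) * c.a = c.a * c.s := by
  rw [c.a_mul_s]
  simp only [mul_assoc, a_mul_a, mul_one]
  exact c.a_mul_s

theorem as_mul_as : c.a * c.s * (c.a * c.s) = 1 := by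
  nth_rewrite 1 [c.a_mul_s]
  rw [mul_assoc, ← mul_assoc c.a, a_mul_a, one_mul, s_mul_s]

theorem a_mul_r : c.a * c.r = c.r * c.a := by
  have := swap_apply_apply c.a c.q c.m
  rw [c.a_q, c.a_m, eq_mul_inv_iff_mul_eq] at this
  exact this.symm

theorem braid : c.s * c.r * c.s = c.r * c.s * c.r := by
  have h₁ := swap_mul_swap_mul_swap c.qm c.ql
  have h₂ := swap_mul_swap_mul_swap c.ml.symm c.ql.symm
  rw [swap_comm c.l c.m, swap_comm c.m c.q] at h₂
  exact h₁.trans ((swap_comm _ _).trans h₂.symm)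

theorem a_mul_mul_a (h : Perm X) : c.a * (c.a * h * c.a) * c.a = h := by
  calc c.a * (c.a * h * c.a) * c.a = (c.a * c.a) * h * (c.a * c.a) := by group
    _ = h := by simp

variable [Fintype X]

@[simp] theorem sign_a : sign c.a = -1 := sign_swap c.xy

@[simp] theorem sign_s : sign c.s = -1 := sign_swap c.ml

@[simp] theorem sign_r : sign c.r = -1 := sign_swap c.qm

theorem exists_even_apply_eq {F : Finset X} (hF : F ⊆ {c.l, c.m}) {u v : X} (hu : u ∉ F)
    (hv : v ∉ F) : ∃ h : Perm X, sign h = 1 ∧ (∀ w ∈ F, h w = w) ∧ h u = v := by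
  rcases eq_or_ne u v with rfl | huv
  · exact ⟨1, by simp⟩
  obtain ⟨z, -, hz⟩ : ∃ z ∈ ({c.l, c.m, c.q, c.x, c.y} : Finset X),
      z ∉ ({c.l, c.m, u, v} : Finset X) := by
    apply Finset.exists_mem_notMem_of_card_lt_card
    have h5 : ({c.l, c.m, c.q, c.x, c.y} : Finset X).card = 5 := by
      simp [Finset.card_insert_of_notMem, c.ml.symm, c.ql.symm, c.xl.symm, c.yl.symm, c.qm.symm,
        c.xm.symm, c.ym.symm, c.xq.symm, c.yq.symm, c.xy]
    rw [h5]
    exact Nat.lt_succ_of_le Finset.card_le_four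
  simp only [Finset.mem_insert, Finset.mem_singleton, not_or] at hz
  obtain ⟨hzl, hzm, hzu, hzv⟩ := hz
  refine ⟨swap v z * swap u z, ?_, fun w hw ↦ ?_, ?_⟩
  · simp [sign_swap (Ne.symm hzv), sign_swap (Ne.symm hzu)]
  · have hwz : w ≠ z := by
      have := hF hw
      simp only [Finset.mem_insert, Finset.mem_singleton] at this
      rintro rfl
      tauto
    have hwu : w ≠ u := by rintro rfl; exact hu hw
    have hwv : w ≠ v := by rintro rfl; exact hv hw
    simp [swap_apply_of_ne_of_ne, hwz, hwu, hwv]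
  · simp

theorem exists_eq_mul_a_r_mul {h : Perm X} (hs : sign h = 1) (hl : h c.l = c.l)
    (hm : h c.m ≠ c.m) : ∃ h₁ h₂ : Perm X, (sign h₁ = 1 ∧ h₁ c.l = c.l ∧ h₁ c.m = c.m) ∧
      (sign h₂ = 1 ∧ h₂ c.l = c.l ∧ h₂ c.m = c.m) ∧ h = h₁ * (c.a * c.r) * h₂ := by
  have hml : h c.m ≠ c.l := fun e ↦ c.ml (h.injective (e.trans hl.symm))
  obtain ⟨h₁, hs₁, hfix, hq⟩ := c.exists_even_apply_eq (F := {c.l, c.m}) subset_rfl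
    (u := c.q) (v := h c.m) (by simp [c.ql, c.qm]) (by simp [hm, hml])
  have hl₁ : h₁ c.l = c.l := hfix _ (by simp)
  have hm₁ : h₁ c.m = c.m := hfix _ (by simp)
  refine ⟨h₁, (c.a * c.r)⁻¹ * h₁⁻¹ * h, ⟨hs₁, hl₁, hm₁⟩, ⟨?_, ?_, ?_⟩, by group⟩
  · simp [hs₁, hs]
  · rw [Perm.mul_apply, Perm.mul_apply, hl, Perm.inv_eq_iff_eq, Perm.inv_eq_iff_eq]
    simp [hl₁]
  · rw [Perm.mul_apply, Perm.mul_apply, Perm.inv_eq_iff_eq, Perm.inv_eq_iff_eq]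
    simp [hq]

theorem exists_eq_mul_a_s_mul {g : Perm X} (hs : sign g = 1) (hl : g c.l ≠ c.l) :
    ∃ h₁ h₂ : Perm X, (sign h₁ = 1 ∧ h₁ c.l = c.l) ∧ (sign h₂ = 1 ∧ h₂ c.l = c.l) ∧
      g = h₁ * (c.a * c.s) * h₂ := by
  obtain ⟨h₁, hs₁, hfix, hm⟩ := c.exists_even_apply_eq (F := {c.l}) (by simp)
    (u := c.m) (v := g c.l) (by simp [c.ml]) (by simp [hl])
  have hl₁ : h₁ c.l = c.l := hfix _ (by simp)
  refine ⟨h₁, (c.a * c.s)⁻¹ * h₁⁻¹ * g, ⟨hs₁, hl₁⟩, ⟨?_, ?_⟩, by group⟩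
  · simp [hs₁, hs]
  · rw [Perm.mul_apply, Perm.mul_apply, Perm.inv_eq_iff_eq, Perm.inv_eq_iff_eq]
    simp [hm]

end FivePoints

/-- A function on permutations which is multiplicative on even permutations. -/
structure IsEvenRep {X E : Type*} [DecidableEq X] [Fintype X] [Monoid E] (P : Perm X → E) :
    Prop where
  one : P 1 = 1
  mul : ∀ {g h : Perm X}, sign g = 1 → sign h = 1 → P (g * h) = P g * P h

open scoped Classical in
/-- The transpositions satisfying a given condition. -/
noncomputable def swapsWith {X : Type*} [DecidableEq X] [Fintype X] (p : Perm X → Prop) :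
    Finset (Perm X) :=
  {g | g.IsSwap ∧ p g}

@[simp] theorem mem_swapsWith {X : Type*} [DecidableEq X] [Fintype X] {p : Perm X → Prop}
    {g : Perm X} : g ∈ swapsWith p ↔ g.IsSwap ∧ p g := by
  simp [swapsWith]

theorem Equiv.Perm.IsSwap.eq_swap {X : Type*} [DecidableEq X] {g : Perm X} (hg : g.IsSwap)
    {u v : X} (huv : u ≠ v) (hu : g u ≠ u) (hv : g v ≠ v) : g = swap u v := by
  obtain ⟨w, z, hwz, rfl⟩ := hg
  have h : ∀ {t}, swap w z t ≠ t → t = w ∨ t = z := fun {t} ht ↦ by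
    by_contra! hcon
    exact ht (swap_apply_of_ne_of_ne hcon.1 hcon.2)
  rcases h hu with rfl | rfl <;> rcases h hv with rfl | rfl
  · exact absurd rfl huv
  · rfl
  · exact swap_comm _ _
  · exact absurd rfl huv

theorem isSwap_conj_iff {X : Type*} [DecidableEq X] [Fintype X] {g h : Perm X} :
    (h * g * h⁻¹).IsSwap ↔ g.IsSwap := by
  rw [isSwap_iff_cycleType, isSwap_iff_cycleType, cycleType_conj]

theorem conj_apply_eq_self_iff {X : Type*} {g h : Perm X} {u : X} :
    (h * g * h⁻¹) u = u ↔ g (h⁻¹ u) = h⁻¹ u := by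
  simp only [Perm.mul_apply]
  exact Perm.eq_inv_iff_eq.symm

namespace FivePoints

variable {X : Type*} [DecidableEq X] [Fintype X] (c : FivePoints X)

/-- The sum of the elements `a * g` for `g` in a set of permutations. -/
def twistSum {E : Type*} [Ring E] (P : Perm X → E) (C : Finset (Perm X)) : E :=
  ∑ g ∈ C, P (c.a * g)

/-- Two functions on permutations agree on the even permutations fixing `l`. -/
def Agree {E : Type*} (P P₀ : Perm X → E) : Prop :=
  ∀ h, sign h = 1 → h c.l = c.l → P h = P₀ h

/-- An element intertwining `P` with its conjugate by `a`, on the even permutations fixing `l`. -/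
def IsTwist {E : Type*} [Mul E] (P : Perm X → E) (α : E) : Prop :=
  ∀ h, sign h = 1 → h c.l = c.l → α * P h = P (c.a * h * c.a) * α

section Ring

variable {E : Type*} [Ring E] {P P₀ : Perm X → E}

theorem twistSum_mul (hP : IsEvenRep P) {p p' : Perm X → Prop} {h : Perm X}
    (hs : sign h = 1) (hp : ∀ g, p' g ↔ p (h * g * h⁻¹)) :
    c.twistSum P (swapsWith p) * P h = P (c.a * h * c.a) * c.twistSum P (swapsWith p') := by
  unfold twistSum
  rw [Finset.sum_mul, Finset.mul_sum]
  refine Finset.sum_nbij' (fun g ↦ h⁻¹ * g * h) (fun g ↦ h * g * h⁻¹) ?_ ?_ ?_ ?_ ?_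
  · intro g hg
    have e : h * (h⁻¹ * g * h) * h⁻¹ = g := by group
    rw [mem_swapsWith] at hg ⊢
    rw [hp, ← isSwap_conj_iff (h := h), e]
    exact hg
  · intro g hg
    rw [mem_swapsWith, hp] at hg
    rw [mem_swapsWith, isSwap_conj_iff]
    exact hg
  · intro g _; group
  · intro g _; group
  · intro g hg
    have hsg := (mem_swapsWith.1 hg).1.sign_eq
    rw [← hP.mul (by simp [hsg]) hs, ← hP.mul (by simp [hs]) (by simp [hs, hsg])]
    congr 1
    calc c.a * g * h = c.a * h * 1 * (h⁻¹ * g * h) := by group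
      _ = _ := by rw [← c.a_mul_a]; group

theorem twistSum_congr (h : c.Agree P P₀) {p : Perm X → Prop} (hp : ∀ g, p g → g c.l = c.l) :
    c.twistSum P (swapsWith p) = c.twistSum P₀ (swapsWith p) := by
  refine Finset.sum_congr rfl fun g hg ↦ ?_
  rw [mem_swapsWith] at hg
  exact h _ (by simp [hg.1.sign_eq]) (by simp [hp g hg.2])

theorem twistSum_move_m :
    c.twistSum P (swapsWith fun g ↦ g c.m ≠ c.m) =
      c.twistSum P (swapsWith fun g ↦ g c.l = c.l ∧ g c.m ≠ c.m) + P (c.a * c.s) := by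
  have h : (swapsWith fun g ↦ g c.m ≠ c.m) =
      insert c.s (swapsWith fun g : Perm X ↦ g c.l = c.l ∧ g c.m ≠ c.m) := by
    ext g
    simp only [mem_swapsWith, Finset.mem_insert]
    constructor
    · rintro ⟨hg, hm⟩
      by_cases hl : g c.l = c.l
      · exact Or.inr ⟨hg, hl, hm⟩
      · exact Or.inl (hg.eq_swap c.ml hm hl)
    · rintro (rfl | ⟨hg, -, hm⟩)
      · exact ⟨⟨_, _, c.ml, rfl⟩, by simp [c.ml.symm]⟩
      · exact ⟨hg, hm⟩
  unfold twistSum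
  rw [h, Finset.sum_insert (by simp [c.ml]), add_comm]

theorem twistSum_all :
    c.twistSum P (swapsWith fun _ ↦ True) =
      c.twistSum P (swapsWith fun g ↦ g c.l = c.l) +
        c.twistSum P (swapsWith fun g ↦ g c.l ≠ c.l) := by
  unfold twistSum
  rw [← Finset.sum_union]
  · congr 1
    ext g
    simp only [mem_swapsWith, Finset.mem_union]
    tauto
  · rw [Finset.disjoint_left]
    intro g
    simp only [mem_swapsWith]
    tauto

theorem T_mul_T (hP : IsEvenRep P) : P (c.a * c.s) * P (c.a * c.s) = 1 := by
  rw [← hP.mul (by simp) (by simp), as_mul_as, hP.one]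

theorem move_l_mul_T (hP : IsEvenRep P) :
    c.twistSum P (swapsWith fun g ↦ g c.l ≠ c.l) * P (c.a * c.s) =
      P (c.a * c.s) * c.twistSum P (swapsWith fun g ↦ g c.m ≠ c.m) := by
  rw [c.twistSum_mul hP (p' := fun g ↦ g c.m ≠ c.m) (by simp), a_mul_as_mul_a]
  intro g
  rw [not_iff_not, conj_apply_eq_self_iff, mul_inv_rev, Perm.mul_apply, a_inv, s_inv, a_l, s_l]

theorem move_m_mul_T (hP : IsEvenRep P) :
    c.twistSum P (swapsWith fun g ↦ g c.m ≠ c.m) * P (c.a * c.s) =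
      P (c.a * c.s) * c.twistSum P (swapsWith fun g ↦ g c.l ≠ c.l) := by
  rw [c.twistSum_mul hP (p' := fun g ↦ g c.l ≠ c.l) (by simp), a_mul_as_mul_a]
  intro g
  rw [not_iff_not, conj_apply_eq_self_iff, mul_inv_rev, Perm.mul_apply, a_inv, s_inv, a_m, s_m]

theorem all_mul_T (hP : IsEvenRep P) :
    c.twistSum P (swapsWith fun _ ↦ True) * P (c.a * c.s) =
      P (c.a * c.s) * c.twistSum P (swapsWith fun _ ↦ True) := by
  rw [c.twistSum_mul hP (p' := fun _ ↦ True) (by simp) (by simp), a_mul_as_mul_a]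

theorem isTwist_move_l (hP : IsEvenRep P) :
    c.IsTwist P (c.twistSum P (swapsWith fun g ↦ g c.l ≠ c.l)) := by
  intro h hs hl
  refine c.twistSum_mul hP hs fun g ↦ ?_
  rw [not_iff_not, conj_apply_eq_self_iff, Perm.inv_eq_iff_eq.2 hl.symm]

theorem isTwist_fix_l (hP : IsEvenRep P) :
    c.IsTwist P (c.twistSum P (swapsWith fun g ↦ g c.l = c.l)) := by
  intro h hs hl
  refine c.twistSum_mul hP hs fun g ↦ ?_
  rw [conj_apply_eq_self_iff, Perm.inv_eq_iff_eq.2 hl.symm]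

theorem IsTwist.congr {c : FivePoints X} {α : E} (h : c.IsTwist P α) (hPP : c.Agree P P₀) :
    c.IsTwist P₀ α := by
  intro g hs hl
  rw [← hPP _ hs hl, ← hPP _ (by simp [hs]) (by simp [hl])]
  exact h g hs hl

theorem IsTwist.mul_twistSum {c : FivePoints X} {α : E} (h : c.IsTwist P α) :
    α * c.twistSum P (swapsWith fun g ↦ g c.l = c.l ∧ g c.m ≠ c.m) =
      c.twistSum P (swapsWith fun g ↦ g c.l = c.l ∧ g c.m ≠ c.m) * α := by
  unfold twistSum
  rw [Finset.sum_mul, Finset.mul_sum]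
  have haa : ∀ g, c.a * (c.a * g * c.a) * c.a = g := fun g ↦ by
    calc c.a * (c.a * g * c.a) * c.a = (c.a * c.a) * g * (c.a * c.a) := by group
      _ = g := by simp
  have hmem : ∀ g ∈ swapsWith (fun g : Perm X ↦ g c.l = c.l ∧ g c.m ≠ c.m),
      c.a * g * c.a ∈ swapsWith (fun g : Perm X ↦ g c.l = c.l ∧ g c.m ≠ c.m) := by
    intro g hg
    rw [mem_swapsWith] at hg ⊢
    refine ⟨?_, by simp [hg.2.1], ?_⟩
    · have := (isSwap_conj_iff (h := c.a)).2 hg.1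
      rwa [a_inv] at this
    · intro e
      rw [Perm.mul_apply, Perm.mul_apply, a_m, ← Perm.eq_inv_iff_eq, a_inv, a_m] at e
      exact hg.2.2 e
  refine Finset.sum_nbij' (fun g ↦ c.a * g * c.a) (fun g ↦ c.a * g * c.a) hmem hmem
    (fun g _ ↦ haa g) (fun g _ ↦ haa g) fun g hg ↦ ?_
  rw [mem_swapsWith] at hg
  rw [h _ (by simp [hg.1.sign_eq]) (by simp [hg.2.1])]
  simp only [mul_assoc]

theorem IsTwist.mul_R {c : FivePoints X} {α : E} (h : c.IsTwist P α) :
    α * P (c.a * c.r) = P (c.a * c.r) * α := by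
  rw [h _ (by simp) (by simp)]
  congr 2
  rw [c.a_mul_r]
  simp only [mul_assoc, a_mul_a, mul_one]
  exact c.a_mul_r

theorem R_mul_R (hP : IsEvenRep P) : P (c.a * c.r) * P (c.a * c.r) = 1 := by
  have : c.a * c.r * (c.a * c.r) = 1 := by
    nth_rewrite 1 [c.a_mul_r]
    rw [mul_assoc, ← mul_assoc c.a, a_mul_a, one_mul, r_mul_r]
  rw [← hP.mul (by simp) (by simp), this, hP.one]

theorem T_mul_R_mul_T (hP : IsEvenRep P) :
    P (c.a * c.s) * P (c.a * c.r) * P (c.a * c.s) =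
      P (c.a * c.r) * P (c.a * c.s) * P (c.a * c.r) := by
  rw [← hP.mul (by simp) (by simp), ← hP.mul (by simp) (by simp), ← hP.mul (by simp) (by simp),
    ← hP.mul (by simp) (by simp)]
  congr 1
  have h₁ : c.a * c.s * (c.a * c.r) * (c.a * c.s) = c.a * (c.s * c.r * c.s) := by
    rw [c.a_mul_s]
    calc c.s * c.a * (c.a * c.r) * (c.s * c.a) = c.s * (c.a * c.a) * c.r * c.s * c.a := by group
      _ = c.s * c.r * (c.s * c.a) := by simp [mul_assoc]
      _ = c.s * (c.r * c.a) * c.s := by rw [← c.a_mul_s]; group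
      _ = c.s * c.a * c.r * c.s := by rw [← c.a_mul_r]; group
      _ = _ := by rw [← c.a_mul_s]; group
  have h₂ : c.a * c.r * (c.a * c.s) * (c.a * c.r) = c.a * (c.r * c.s * c.r) := by
    rw [c.a_mul_r]
    calc c.r * c.a * (c.a * c.s) * (c.r * c.a) = c.r * (c.a * c.a) * c.s * c.r * c.a := by group
      _ = c.r * c.s * (c.r * c.a) := by simp [mul_assoc]
      _ = c.r * (c.s * c.a) * c.r := by rw [← c.a_mul_r]; group
      _ = c.r * c.a * c.s * c.r := by rw [← c.a_mul_s]; group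
      _ = _ := by rw [← c.a_mul_r]; group
  rw [h₁, h₂, c.braid]

theorem T_mul_of_fix (hP : IsEvenRep P) {h : Perm X} (hs : sign h = 1) (hl : h c.l = c.l)
    (hm : h c.m = c.m) : P (c.a * c.s) * P h = P (c.a * h * c.a) * P (c.a * c.s) := by
  rw [← hP.mul (by simp) hs, ← hP.mul (by simp [hs]) (by simp)]
  congr 1
  calc c.a * c.s * h = c.a * (c.s * h) := mul_assoc _ _ _
    _ = c.a * h * 1 * c.s := by rw [← c.mul_s_of_fix hl hm]; group
    _ = _ := by rw [← c.a_mul_a]; group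

theorem eq_of_T_eq {P' : Perm X → E} (hP : IsEvenRep P) (hP' : IsEvenRep P')
    (hPP : c.Agree P P') (hT : P (c.a * c.s) = P' (c.a * c.s)) {g : Perm X} (hg : sign g = 1) :
    P g = P' g := by
  by_cases hl : g c.l = c.l
  · exact hPP g hg hl
  · obtain ⟨h₁, h₂, ⟨hs₁, hl₁⟩, ⟨hs₂, hl₂⟩, rfl⟩ := c.exists_eq_mul_a_s_mul hg hl
    rw [hP.mul (by simp [hs₁]) hs₂, hP.mul hs₁ (by simp), hP'.mul (by simp [hs₁]) hs₂,
      hP'.mul hs₁ (by simp), hT, hPP _ hs₁ hl₁, hPP _ hs₂ hl₂]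

end Ring

section Field

variable {F U : Type*} [Field F] [AddCommGroup U] [Module F U]
variable {P P₁ P₂ P₀ : Perm X → Module.End F U} {α : Module.End F U}

/-- The values on the even permutations fixing `l` span the endomorphism algebra. -/
def Spans (P : Perm X → Module.End F U) : Prop :=
  Submodule.span F (P '' {h | sign h = 1 ∧ h c.l = c.l}) = ⊤

theorem Spans.induction {c : FivePoints X} (hP : c.Spans P)
    {f₁ f₂ : Module.End F U →ₗ[F] Module.End F U}
    (h : ∀ g, sign g = 1 → g c.l = c.l → f₁ (P g) = f₂ (P g)) : f₁ = f₂ := by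
  refine LinearMap.ext_on hP ?_
  rintro _ ⟨g, ⟨hs, hl⟩, rfl⟩
  exact h g hs hl

theorem Spans.exists_eq_smul_one [Nontrivial U] {c : FivePoints X} (hP : c.Spans P)
    {B : Module.End F U} (hB : ∀ g, sign g = 1 → g c.l = c.l → B * P g = P g * B) :
    ∃ k : F, B = k • 1 := by
  have h : LinearMap.mulLeft F B = LinearMap.mulRight F B := hP.induction hB
  obtain ⟨w, hw⟩ := exists_ne (0 : U)
  obtain ⟨f, hf⟩ := Module.Projective.exists_dual_ne_zero F hw
  refine ⟨(f w)⁻¹ * f (B w), LinearMap.ext fun u ↦ ?_⟩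
  have hu : f w • B u = f (B w) • u := by
    simpa using LinearMap.congr_fun (LinearMap.congr_fun h (f.smulRight u)) w
  rw [← inv_smul_smul₀ hf (B u), hu, smul_smul]
  rfl

theorem IsTwist.mul_mul {c : FivePoints X} {β : Module.End F U} (hα : c.IsTwist P α)
    (hβ : c.IsTwist P β) {h : Perm X} (hs : sign h = 1) (hl : h c.l = c.l) :
    α * β * P h = P h * (α * β) := by
  rw [mul_assoc, hβ h hs hl, ← mul_assoc, hα _ (by simp [hs]) (by simp [hl]), a_mul_mul_a,
    mul_assoc]

theorem IsTwist.exists_involution [IsAlgClosed F] [Nontrivial U] {c : FivePoints X}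
    (hP : c.Spans P) (hα : c.IsTwist P α) (hα0 : α ≠ 0) :
    ∃ β, c.IsTwist P β ∧ β * β = 1 := by
  obtain ⟨k, hk⟩ := hP.exists_eq_smul_one fun h hs hl ↦ hα.mul_mul hα hs hl
  have hk0 : k ≠ 0 := by
    rintro rfl
    rw [zero_smul] at hk
    have h : LinearMap.mulLeft F α ∘ₗ LinearMap.mulRight F α = 0 := by
      refine hP.induction fun g hs hl ↦ ?_
      simp only [LinearMap.comp_apply, LinearMap.mulLeft_apply, LinearMap.mulRight_apply,
        LinearMap.zero_apply]
      rw [← mul_assoc, hα g hs hl, mul_assoc, hk, mul_zero]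
    obtain ⟨v, hv⟩ : ∃ v, α v ≠ 0 := by
      by_contra! hcon
      exact hα0 (LinearMap.ext hcon)
    obtain ⟨f, hf⟩ := Module.Projective.exists_dual_ne_zero F hv
    have := LinearMap.congr_fun (LinearMap.congr_fun h (f.smulRight v)) v
    simp [hf, hv] at this
  obtain ⟨z, rfl⟩ := IsAlgClosed.exists_eq_mul_self k
  have hz : z ≠ 0 := left_ne_zero_of_mul hk0
  refine ⟨z⁻¹ • α, fun h hs hl ↦ ?_, ?_⟩
  · rw [smul_mul_assoc, hα h hs hl, mul_smul_comm]
  · rw [smul_mul_smul_comm, hk, smul_smul]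
    field_simp
    simp

theorem IsTwist.exists_eq_smul [Nontrivial U] {c : FivePoints X} {β : Module.End F U}
    (hP : c.Spans P) (hα : c.IsTwist P α) (hαα : α * α = 1) (hβ : c.IsTwist P β) :
    ∃ k : F, β = k • α := by
  obtain ⟨k, hk⟩ := hP.exists_eq_smul_one fun h hs hl ↦ hα.mul_mul hβ hs hl
  refine ⟨k, ?_⟩
  rw [← one_mul β, ← hαα, mul_assoc, hk, mul_smul_comm, mul_one]

/-- If there is no twist, then an extension is determined. -/
theorem T_eq_of_twist_eq_zero (hP : IsEvenRep P) (hPP : c.Agree P P₀)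
    (h0 : ∀ β, c.IsTwist P₀ β → β = 0) :
    P (c.a * c.s) =
      -c.twistSum P₀ (swapsWith fun g ↦ g c.l = c.l ∧ g c.m ≠ c.m) := by
  have hX := h0 _ ((c.isTwist_move_l hP).congr hPP)
  have h := c.move_m_mul_T hP
  rw [hX, mul_zero, twistSum_move_m, c.twistSum_congr hPP fun g hg ↦ hg.1] at h
  have h' := congrArg (· * P (c.a * c.s)) h
  rw [zero_mul, mul_assoc, c.T_mul_T hP, mul_one] at h'
  exact eq_neg_of_add_eq_zero_right h'

section Twisted

theorem exists_relations [Nontrivial U] (hP₀ : c.Spans P₀) (hP : IsEvenRep P)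
    (hPP : c.Agree P P₀) (hα : c.IsTwist P₀ α) (hαα : α * α = 1) {κ : F}
    (hκ : c.twistSum P₀ (swapsWith fun g ↦ g c.l = c.l) = κ • α) :
    ∃ k : F,
      P (c.a * c.s) * α *
          (α * c.twistSum P₀ (swapsWith fun g ↦ g c.l = c.l ∧ g c.m ≠ c.m)) =
        k • (α * P (c.a * c.s)) - 1 ∧
      α * c.twistSum P₀ (swapsWith fun g ↦ g c.l = c.l ∧ g c.m ≠ c.m) * (α * P (c.a * c.s)) =
        k • (P (c.a * c.s) * α) - 1 ∧
      (α * P (c.a * c.s) ≠ P (c.a * c.s) * α → k = -κ) := by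
  obtain ⟨k, hk⟩ := hα.exists_eq_smul hP₀ hαα ((c.isTwist_move_l hP).congr hPP)
  have hT := c.T_mul_T hP
  have h₁ := c.move_l_mul_T hP
  have h₂ := c.move_m_mul_T hP
  have h₃ := c.all_mul_T hP
  rw [twistSum_move_m,
    c.twistSum_congr (p := fun g ↦ g c.l = c.l ∧ g c.m ≠ c.m) hPP fun g hg ↦ hg.1, hk] at h₁ h₂
  rw [twistSum_all, c.twistSum_congr (p := fun g ↦ g c.l = c.l) hPP fun g hg ↦ hg, hk, hκ, ← add_smul,
    smul_mul_assoc, mul_smul_comm] at h₃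
  rw [mul_add, hT, smul_mul_assoc] at h₁
  rw [add_mul, hT, mul_smul_comm] at h₂
  refine ⟨k, ?_, ?_, fun hne ↦ ?_⟩
  · rw [h₁, mul_assoc, ← mul_assoc α α, hαα, one_mul, add_sub_cancel_right]
  · rw [← h₂, hα.mul_twistSum, mul_assoc, ← mul_assoc α α, hαα, one_mul, add_sub_cancel_right]
  · by_contra hk0
    have : κ + k ≠ 0 := fun e ↦ hk0 (eq_neg_of_add_eq_zero_right e)
    exact hne (smul_right_injective _ this h₃)

theorem mul_T_mul (hP : IsEvenRep P) (hαα : α * α = 1) :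
    α * P (c.a * c.s) * (P (c.a * c.s) * α) = 1 := by
  rw [mul_assoc, ← mul_assoc (P _) (P _), c.T_mul_T hP, one_mul, hαα]

theorem T_mul_mul (hP : IsEvenRep P) (hαα : α * α = 1) :
    P (c.a * c.s) * α * (α * P (c.a * c.s)) = 1 := by
  rw [mul_assoc, ← mul_assoc α α, hαα, one_mul, c.T_mul_T hP]

theorem braid_left (hP : IsEvenRep P) (hPP : c.Agree P P₀)
    (hα : c.IsTwist P₀ α) (hαα : α * α = 1) :
    α * P (c.a * c.s) * (α * P₀ (c.a * c.r)) * (α * P (c.a * c.s)) =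
      α * P₀ (c.a * c.r) * (P (c.a * c.s) * α) * (α * P₀ (c.a * c.r)) := by
  have h := c.T_mul_R_mul_T hP
  rw [hPP (c.a * c.r) (by simp) (by simp)] at h
  have hR : α * P₀ (c.a * c.r) * α = P₀ (c.a * c.r) := by
    rw [hα.mul_R, mul_assoc, hαα, mul_one]
  calc _ = α * (P (c.a * c.s) * (α * P₀ (c.a * c.r) * α) * P (c.a * c.s)) := by noncomm_ring
    _ = α * (P₀ (c.a * c.r) * P (c.a * c.s) * (α * α) * P₀ (c.a * c.r)) := by
      rw [hR, h, hαα, mul_one]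
    _ = _ := by noncomm_ring

theorem braid_right (hP : IsEvenRep P) (hPP : c.Agree P P₀)
    (hα : c.IsTwist P₀ α) (hαα : α * α = 1) :
    P (c.a * c.s) * α * (α * P₀ (c.a * c.r)) * (P (c.a * c.s) * α) =
      α * P₀ (c.a * c.r) * (α * P (c.a * c.s)) * (α * P₀ (c.a * c.r)) := by
  have h := c.T_mul_R_mul_T hP
  rw [hPP (c.a * c.r) (by simp) (by simp)] at h
  rw [hα.mul_R]
  calc _ = P (c.a * c.s) * (α * P₀ (c.a * c.r)) * α * P (c.a * c.s) * α := by
        noncomm_ring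
    _ = P (c.a * c.s) * P₀ (c.a * c.r) * (α * α) * P (c.a * c.s) * α := by
        rw [hα.mul_R]; noncomm_ring
    _ = P₀ (c.a * c.r) * (α * α) * P (c.a * c.s) * (P₀ (c.a * c.r) * α) := by
        rw [hαα, mul_one, mul_one, h]; noncomm_ring
    _ = _ := by noncomm_ring

theorem mul_T_comm (hP : IsEvenRep P) (hPP : c.Agree P P₀) (hα : c.IsTwist P₀ α) {h : Perm X}
    (hs : sign h = 1) (hl : h c.l = c.l) (hm : h c.m = c.m) :
    α * P (c.a * c.s) * P₀ h = P₀ h * (α * P (c.a * c.s)) := by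
  rw [← hPP h hs hl, mul_assoc, c.T_mul_of_fix hP hs hl hm, ← mul_assoc,
    hPP (c.a * h * c.a) (by simp [hs]) (by simp [hl]), hα _ (by simp [hs]) (by simp [hl]),
    a_mul_mul_a, hPP h hs hl, mul_assoc]

theorem T_mul_comm (hP : IsEvenRep P) (hPP : c.Agree P P₀) (hα : c.IsTwist P₀ α) {h : Perm X}
    (hs : sign h = 1) (hl : h c.l = c.l) (hm : h c.m = c.m) :
    P (c.a * c.s) * α * P₀ h = P₀ h * (P (c.a * c.s) * α) := by
  rw [mul_assoc, hα h hs hl, ← hPP (c.a * h * c.a) (by simp [hs]) (by simp [hl]), ← mul_assoc,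
    c.T_mul_of_fix hP (by simp [hs]) (by simp [hl]) (by simp [hm]), a_mul_mul_a, hPP h hs hl,
    mul_assoc]

theorem conj_add_conj_of_fix (hP : IsEvenRep P) (hPP : c.Agree P P₀) (hα : c.IsTwist P₀ α)
    (hαα : α * α = 1) {h : Perm X}
    (hs : sign h = 1) (hl : h c.l = c.l) (hm : h c.m = c.m) :
    α * P (c.a * c.s) * (α * P₀ h) * (α * P (c.a * c.s)) +
      P (c.a * c.s) * α * (α * P₀ h) * (P (c.a * c.s) * α) = α * P₀ h + α * P₀ h := by
  have hT := c.T_mul_T hP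
  congr 1
  · rw [mul_assoc, mul_assoc α (P₀ h), ← c.mul_T_comm hP hPP hα hs hl hm]
    calc _ = α * (P (c.a * c.s) * (α * α) * P (c.a * c.s)) * P₀ h := by noncomm_ring
      _ = _ := by rw [hαα, mul_one, hT, mul_one]
  · rw [mul_assoc, mul_assoc α (P₀ h), ← c.T_mul_comm hP hPP hα hs hl hm]
    calc _ = P (c.a * c.s) * (α * α) * P (c.a * c.s) * α * P₀ h := by noncomm_ring
      _ = _ := by rw [hαα, mul_one, hT, one_mul]

theorem conj_add_conj_of_move (hP : IsEvenRep P) (hP₀ : IsEvenRep P₀) (hPP : c.Agree P P₀)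
    (hα : c.IsTwist P₀ α) (hαα : α * α = 1) {h₁ h₂ : Perm X}
    (h1 : sign h₁ = 1 ∧ h₁ c.l = c.l ∧ h₁ c.m = c.m)
    (h2 : sign h₂ = 1 ∧ h₂ c.l = c.l ∧ h₂ c.m = c.m) :
    α * P (c.a * c.s) * (α * P₀ (h₁ * (c.a * c.r) * h₂)) * (α * P (c.a * c.s)) +
      P (c.a * c.s) * α * (α * P₀ (h₁ * (c.a * c.r) * h₂)) * (P (c.a * c.s) * α) =
    P₀ (c.a * h₁ * c.a) * (α * P₀ (c.a * c.r) * (α * P (c.a * c.s) + P (c.a * c.s) * α) *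
      (α * P₀ (c.a * c.r))) * P₀ h₂ := by
  obtain ⟨hs₁, hl₁, hm₁⟩ := h1
  obtain ⟨hs₂, hl₂, hm₂⟩ := h2
  have e : α * P₀ (h₁ * (c.a * c.r) * h₂) =
      P₀ (c.a * h₁ * c.a) * (α * P₀ (c.a * c.r)) * P₀ h₂ := by
    rw [hP₀.mul (by simp [hs₁]) hs₂, hP₀.mul hs₁ (by simp), ← mul_assoc, ← mul_assoc,
      hα _ hs₁ hl₁]
    noncomm_ring
  have hs₁' : sign (c.a * h₁ * c.a) = 1 := by simp [hs₁]
  have hl₁' : (c.a * h₁ * c.a) c.l = c.l := by simp [hl₁]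
  have hm₁' : (c.a * h₁ * c.a) c.m = c.m := by simp [hm₁]
  have conj : ∀ {S A B C : Module.End F U}, S * A = A * S → S * C = C * S →
      S * (A * B * C) * S = A * (S * B * S) * C := by
    intro S A B C hA hC
    calc S * (A * B * C) * S = (S * A) * B * (C * S) := by noncomm_ring
      _ = A * (S * B * S) * C := by rw [hA, ← hC]; noncomm_ring
  rw [e, conj (c.mul_T_comm hP hPP hα hs₁' hl₁' hm₁') (c.mul_T_comm hP hPP hα hs₂ hl₂ hm₂),
    conj (c.T_mul_comm hP hPP hα hs₁' hl₁' hm₁') (c.T_mul_comm hP hPP hα hs₂ hl₂ hm₂),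
    c.braid_left hP hPP hα hαα, c.braid_right hP hPP hα hαα]
  noncomm_ring

/-- Two extensions commuting with the twist coincide. -/
theorem T_eq_of_comm [Nontrivial U] (hP₀ : IsEvenRep P₀) (hspan : c.Spans P₀)
    (hα : c.IsTwist P₀ α) (hαα : α * α = 1)
    (h₁ : IsEvenRep P₁) (hP₁ : c.Agree P₁ P₀) (h₂ : IsEvenRep P₂) (hP₂ : c.Agree P₂ P₀)
    (hc₁ : α * P₁ (c.a * c.s) = P₁ (c.a * c.s) * α)
    (hc₂ : α * P₂ (c.a * c.s) = P₂ (c.a * c.s) * α) :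
    P₁ (c.a * c.s) = P₂ (c.a * c.s) := by
  obtain ⟨κ, hκ⟩ := hα.exists_eq_smul hspan hαα (c.isTwist_fix_l hP₀)
  obtain ⟨k₁, hL₁, -⟩ := c.exists_relations hspan h₁ hP₁ hα hαα hκ
  obtain ⟨k₂, hL₂, -⟩ := c.exists_relations hspan h₂ hP₂ hα hαα hκ
  have hS₁ := c.mul_T_mul h₁ hαα
  have hS₂ := c.mul_T_mul h₂ hαα
  have hb₁ := c.braid_left h₁ hP₁ hα hαα
  have hb₂ := c.braid_left h₂ hP₂ hα hαα
  rw [← hc₁] at hL₁ hb₁ hS₁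
  rw [← hc₂] at hL₂ hb₂ hS₂
  have hρ : α * P₀ (c.a * c.r) * (α * P₀ (c.a * c.r)) = 1 := by
    nth_rewrite 1 [hα.mul_R]
    rw [mul_assoc, ← mul_assoc α α, hαα, one_mul, c.R_mul_R hP₀]
  have hL₁' := eq_smul_mul_self_sub hS₁ hL₁
  have hL₂' := eq_smul_mul_self_sub hS₂ hL₂
  rw [hS₁] at hL₁'
  rw [hS₂] at hL₂'
  have h := involution_unique hS₁ hS₂ hL₁' hL₂' hρ hb₁ hb₂
  have := congrArg (α * ·) h
  rwa [← mul_assoc, ← mul_assoc, hαα, one_mul, one_mul] at this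

/-- Two extensions not commuting with the twist are equal or conjugate under the twist. -/
theorem T_eq_or_of_not_comm [Nontrivial U] (hP₀ : IsEvenRep P₀) (hspan : c.Spans P₀)
    (hα : c.IsTwist P₀ α) (hαα : α * α = 1)
    (h₁ : IsEvenRep P₁) (hP₁ : c.Agree P₁ P₀) (h₂ : IsEvenRep P₂) (hP₂ : c.Agree P₂ P₀)
    (hc₁ : α * P₁ (c.a * c.s) ≠ P₁ (c.a * c.s) * α)
    (hc₂ : α * P₂ (c.a * c.s) ≠ P₂ (c.a * c.s) * α) :
    P₂ (c.a * c.s) = P₁ (c.a * c.s) ∨ P₂ (c.a * c.s) = α * P₁ (c.a * c.s) * α := by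
  obtain ⟨κ, hκ⟩ := hα.exists_eq_smul hspan hαα (c.isTwist_fix_l hP₀)
  obtain ⟨k₁, hL₁, hL₁', hk₁⟩ := c.exists_relations hspan h₁ hP₁ hα hαα hκ
  obtain ⟨k₂, hL₂, hL₂', hk₂⟩ := c.exists_relations hspan h₂ hP₂ hα hαα hκ
  obtain rfl := hk₁ hc₁
  obtain rfl := hk₂ hc₂
  have hp := add_eq_add_of_ne (c.mul_T_mul h₁ hαα) (c.T_mul_mul h₁ hαα) (c.mul_T_mul h₂ hαα)
    (c.T_mul_mul h₂ hαα) hL₁ hL₁' hL₂ hL₂' hc₁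
  let f (P : Perm X → Module.End F U) : Module.End F U →ₗ[F] Module.End F U :=
    LinearMap.mulRight F (α * P (c.a * c.s)) ∘ₗ LinearMap.mulLeft F (α * P (c.a * c.s)) ∘ₗ
        LinearMap.mulLeft F α +
      LinearMap.mulRight F (P (c.a * c.s) * α) ∘ₗ LinearMap.mulLeft F (P (c.a * c.s) * α) ∘ₗ
        LinearMap.mulLeft F α
  have hf : f P₁ = f P₂ := by
    refine hspan.induction fun g hs hl ↦ ?_
    simp only [f, LinearMap.add_apply, LinearMap.comp_apply, LinearMap.mulLeft_apply,
      LinearMap.mulRight_apply]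
    by_cases hm : g c.m = c.m
    · rw [c.conj_add_conj_of_fix h₁ hP₁ hα hαα hs hl hm,
        c.conj_add_conj_of_fix h₂ hP₂ hα hαα hs hl hm]
    · obtain ⟨g₁, g₂, hg₁, hg₂, rfl⟩ := c.exists_eq_mul_a_r_mul hs hl hm
      rw [c.conj_add_conj_of_move h₁ hP₀ hP₁ hα hαα hg₁ hg₂,
        c.conj_add_conj_of_move h₂ hP₀ hP₂ hα hαα hg₁ hg₂, hp]
  have hconj : ∀ Y, α * P₁ (c.a * c.s) * Y * (α * P₁ (c.a * c.s)) +
      P₁ (c.a * c.s) * α * Y * (P₁ (c.a * c.s) * α) =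
      α * P₂ (c.a * c.s) * Y * (α * P₂ (c.a * c.s)) +
      P₂ (c.a * c.s) * α * Y * (P₂ (c.a * c.s) * α) := by
    intro Y
    have := LinearMap.congr_fun hf (α * Y)
    simp only [f, LinearMap.add_apply, LinearMap.comp_apply, LinearMap.mulLeft_apply,
      LinearMap.mulRight_apply] at this
    rwa [← mul_assoc α α Y, hαα, one_mul] at this
  have hcancel : ∀ {B C : Module.End F U}, α * B = C → B = α * C := by
    rintro B _ rfl
    rw [← mul_assoc, hαα, one_mul]
  rcases eq_or_eq_of_forall_conj (c.mul_T_mul h₁ hαα) (c.T_mul_mul h₁ hαα) (c.mul_T_mul h₂ hαα)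
    (c.T_mul_mul h₂ hαα) hL₁ hL₁' hL₂ hL₂' hc₁ hconj with h | h
  · left
    rw [hcancel h, ← mul_assoc, hαα, one_mul]
  · right
    rw [hcancel h, mul_assoc]

end Twisted

/-- The values at `a * s` of the extensions of `P₀` form a set of at most three elements. -/
theorem exists_finset_T_mem [IsAlgClosed F] [Nontrivial U] (hP₀ : IsEvenRep P₀)
    (hspan : c.Spans P₀) :
    ∃ S : Finset (Module.End F U), S.card ≤ 3 ∧
      ∀ P, IsEvenRep P → c.Agree P P₀ → P (c.a * c.s) ∈ S := by
  classical
  by_cases htwist : ∀ β, c.IsTwist P₀ β → β = 0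
  · refine ⟨{-c.twistSum P₀ (swapsWith fun g ↦ g c.l = c.l ∧ g c.m ≠ c.m)}, by simp,
      fun P hP hPP ↦ ?_⟩
    exact Finset.mem_singleton.2 (c.T_eq_of_twist_eq_zero hP hPP htwist)
  push Not at htwist
  obtain ⟨β, hβ, hβ0⟩ := htwist
  obtain ⟨α, hα, hαα⟩ := hβ.exists_involution hspan hβ0
  obtain ⟨T₀, hT₀⟩ : ∃ T₀, ∀ P, IsEvenRep P → c.Agree P P₀ →
      α * P (c.a * c.s) = P (c.a * c.s) * α → P (c.a * c.s) = T₀ := by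
    by_cases hex : ∃ P, IsEvenRep P ∧ c.Agree P P₀ ∧ α * P (c.a * c.s) = P (c.a * c.s) * α
    · obtain ⟨P₁, h₁, hP₁, hc₁⟩ := hex
      exact ⟨_, fun P hP hPP hc ↦ c.T_eq_of_comm hP₀ hspan hα hαα hP hPP h₁ hP₁ hc hc₁⟩
    · exact ⟨0, fun P hP hPP hc ↦ absurd ⟨P, hP, hPP, hc⟩ hex⟩
  obtain ⟨T₁, hT₁⟩ : ∃ T₁, ∀ P, IsEvenRep P → c.Agree P P₀ →
      α * P (c.a * c.s) ≠ P (c.a * c.s) * α →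
        P (c.a * c.s) = T₁ ∨ P (c.a * c.s) = α * T₁ * α := by
    by_cases hex : ∃ P, IsEvenRep P ∧ c.Agree P P₀ ∧ α * P (c.a * c.s) ≠ P (c.a * c.s) * α
    · obtain ⟨P₁, h₁, hP₁, hc₁⟩ := hex
      exact ⟨_, fun P hP hPP hc ↦
        c.T_eq_or_of_not_comm hP₀ hspan hα hαα h₁ hP₁ hP hPP hc₁ hc⟩
    · exact ⟨0, fun P hP hPP hc ↦ absurd ⟨P, hP, hPP, hc⟩ hex⟩
  refine ⟨{T₀, T₁, α * T₁ * α}, Finset.card_le_three, fun P hP hPP ↦ ?_⟩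
  simp only [Finset.mem_insert, Finset.mem_singleton]
  by_cases hc : α * P (c.a * c.s) = P (c.a * c.s) * α
  · exact Or.inl (hT₀ P hP hPP hc)
  · exact Or.inr (hT₁ P hP hPP hc)

end Field

end FivePoints

/-- A representation of the alternating group, as a function on all permutations that vanishes
on the odd ones. -/
noncomputable def evenExtend {X F U : Type*} [DecidableEq X] [Fintype X] [Field F]
    [AddCommGroup U] [Module F U] (Φ : Representation F (alternatingGroup X) U) (g : Perm X) :
    Module.End F U :=
  if h : sign g = 1 then Φ ⟨g, mem_alternatingGroup.2 h⟩ else 0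

section evenExtend

variable {X F U : Type*} [DecidableEq X] [Fintype X] [Field F] [AddCommGroup U] [Module F U]
  (Φ : Representation F (alternatingGroup X) U)

theorem evenExtend_of_sign {g : Perm X} (h : sign g = 1) :
    evenExtend Φ g = Φ ⟨g, mem_alternatingGroup.2 h⟩ :=
  dif_pos h

theorem isEvenRep_evenExtend : IsEvenRep (evenExtend Φ) where
  one := by
    rw [evenExtend_of_sign Φ (map_one _)]
    exact map_one Φ
  mul {g h} hg hh := by
    rw [evenExtend_of_sign Φ hg, evenExtend_of_sign Φ hh,
      evenExtend_of_sign Φ (by rw [map_mul, hg, hh, one_mul])]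
    exact map_mul Φ ⟨g, _⟩ ⟨h, _⟩

/-- An irreducible representation of the stabilizer of a point in an alternating group of degree
at least five has at most three extensions. -/
theorem FivePoints.ncard_extensions_le [IsAlgClosed F] [FiniteDimensional F U]
    (c : FivePoints X) (Ψ : Representation F (MulAction.stabilizer (alternatingGroup X) c.l) U)
    (hΨ : RepIrreducible Ψ) :
    {Φ : Representation F (alternatingGroup X) U |
        Φ.comp (MulAction.stabilizer (alternatingGroup X) c.l).subtype = Ψ}.Finite ∧
      {Φ : Representation F (alternatingGroup X) U |
        Φ.comp (MulAction.stabilizer (alternatingGroup X) c.l).subtype = Ψ}.ncard ≤ 3 := by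
  set A := {Φ : Representation F (alternatingGroup X) U |
        Φ.comp (MulAction.stabilizer (alternatingGroup X) c.l).subtype = Ψ}
  rcases A.eq_empty_or_nonempty with h | ⟨Φ₀, hΦ₀⟩
  · simp [h]
  have := hΨ.1
  have apply_eq : ∀ Φ ∈ A, ∀ (h : Perm X) (hs : sign h = 1) (hl : h c.l = c.l),
      evenExtend Φ h = Ψ ⟨⟨h, mem_alternatingGroup.2 hs⟩, hl⟩ := by
    intro Φ hΦ h hs hl
    rw [evenExtend_of_sign Φ hs, ← show _ = Ψ from hΦ]
    rfl
  have agree : ∀ Φ ∈ A, ∀ Φ' ∈ A, c.Agree (evenExtend Φ) (evenExtend Φ') :=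
    fun Φ hΦ Φ' hΦ' h hs hl ↦ (apply_eq Φ hΦ h hs hl).trans (apply_eq Φ' hΦ' h hs hl).symm
  have hspan : c.Spans (evenExtend Φ₀) := by
    refine top_le_iff.1 (hΨ.span_range_eq_top.ge.trans (Submodule.span_mono ?_))
    rintro _ ⟨g, rfl⟩
    have hs := mem_alternatingGroup.1 g.1.2
    exact ⟨g, ⟨hs, g.2⟩, apply_eq Φ₀ hΦ₀ g hs g.2⟩
  obtain ⟨S, hS, hmem⟩ := c.exists_finset_T_mem (isEvenRep_evenExtend Φ₀) hspan
  have hmaps : Set.MapsTo (fun Φ ↦ evenExtend Φ (c.a * c.s)) A S := fun Φ hΦ ↦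
    hmem _ (isEvenRep_evenExtend Φ) (agree Φ hΦ Φ₀ hΦ₀)
  have hinj : Set.InjOn (fun Φ : Representation F (alternatingGroup X) U ↦
      evenExtend Φ (c.a * c.s)) A := by
    intro Φ hΦ Φ' hΦ' hT
    refine MonoidHom.ext fun g ↦ ?_
    have hg := mem_alternatingGroup.1 g.2
    have := c.eq_of_T_eq (isEvenRep_evenExtend Φ) (isEvenRep_evenExtend Φ')
      (agree Φ hΦ Φ' hΦ') hT hg
    rwa [evenExtend_of_sign Φ hg, evenExtend_of_sign Φ' hg] at this
  refine ⟨S.finite_toSet.of_injOn hmaps hinj, ?_⟩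
  refine (Set.ncard_le_ncard_of_injOn _ hmaps hinj S.finite_toSet).trans ?_
  rwa [Set.ncard_coe_finset]

end evenExtend

end EvenRepresentations

/-- let `F` be algebraically closed, `n ≥ 5`, and embed `A_{n-1}` into
`Aₙ` as the stabilizer of the last point. If `Ψ` is an irreducible representation of
`A_{n-1}` on a finite-dimensional space `U`, then the set of representations of `Aₙ`
on `U` restricting to `Ψ` on `A_{n-1}` has at most three elements. -/
theorem stmt19 {F : Type*} [Field F] [IsAlgClosed F]
    {n : ℕ} (hn : 5 ≤ n)
    (U : Type*) [AddCommGroup U] [Module F U] [FiniteDimensional F U]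
    (Ψ : Representation F
      (MulAction.stabilizer (alternatingGroup (Fin n)) (⟨n - 1, by omega⟩ : Fin n)) U)
    (hΨ : RepIrreducible Ψ) :
    {Φ : Representation F (alternatingGroup (Fin n)) U |
        Φ.comp (MulAction.stabilizer (alternatingGroup (Fin n))
          (⟨n - 1, by omega⟩ : Fin n)).subtype = Ψ}.Finite ∧
      {Φ : Representation F (alternatingGroup (Fin n)) U |
        Φ.comp (MulAction.stabilizer (alternatingGroup (Fin n))
          (⟨n - 1, by omega⟩ : Fin n)).subtype = Ψ}.ncard ≤ 3 := by
  let c : FivePoints (Fin n) :=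
    { l := ⟨n - 1, by omega⟩
      m := ⟨n - 2, by omega⟩
      q := ⟨n - 3, by omega⟩
      x := ⟨0, by omega⟩
      y := ⟨1, by omega⟩
      ml := by rw [ne_eq, Fin.mk.injEq]; omega
      ql := by rw [ne_eq, Fin.mk.injEq]; omega
      xl := by rw [ne_eq, Fin.mk.injEq]; omega
      yl := by rw [ne_eq, Fin.mk.injEq]; omega
      qm := by rw [ne_eq, Fin.mk.injEq]; omega
      xm := by rw [ne_eq, Fin.mk.injEq]; omega
      ym := by rw [ne_eq, Fin.mk.injEq]; omega
      xq := by rw [ne_eq, Fin.mk.injEq]; omega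
      yq := by rw [ne_eq, Fin.mk.injEq]; omega
      xy := by rw [ne_eq, Fin.mk.injEq]; omega }
  exact c.ncard_extensions_le Ψ hΨ
end
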